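/- Duality between cuspidal butterflies and cuspidal S_1^+ singularities: let f be a generalized timelike minimal surface with real Weierstrass data (g1, g2, ω1 du, ω2 dv) and let p be a singular point lying in Σ^g(f) \ Σ^ω(f) (i.e. g1(p)g2(p) = 1 and ω1(p)ω2(p) ≠ 0). Then f is A-equivalent at p to the cuspidal butterfly f_CBF(u,v) = (u, 5v^4 + 2uv, 4v^5 + uv^2 - u^2) at the origin if and only if the conjugate surface f̂ is A-equivalent at p to the cuspidal S_1^+ singularity f_{CS1+}(u,v) = (u, v^2, v^3(u^2 + v^2)) at the origin. -/

import Mathlib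

noncomputable section

open Real Filter

abbrev R2 : Type := ℝ × ℝ
abbrev R3 : Type := ℝ × ℝ × ℝ

/-- The partial derivative in the `u`-direction. -/
def pu (f : R2 → R3) (p : R2) : R3 := fderiv ℝ f p (1, 0)
/-- The partial derivative in the `v`-direction. -/
def pv (f : R2 → R3) (p : R2) : R3 := fderiv ℝ f p (0, 1)

/-- Determinant of three column vectors in ℝ³. -/
def det3 (a b c : R3) : ℝ :=
  a.1 * (b.2.1 * c.2.2 - b.2.2 * c.2.1)
  - b.1 * (a.2.1 * c.2.2 - a.2.2 * c.2.1)
  + c.1 * (a.2.1 * b.2.2 - a.2.2 * b.2.1)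

/-- Determinant of two vectors in ℝ². -/
def det2 (a b : R2) : ℝ := a.1 * b.2 - a.2 * b.1

/-- Euclidean inner product on ℝ³. -/
def ip3 (a b : R3) : ℝ := a.1 * b.1 + a.2.1 * b.2.1 + a.2.2 * b.2.2

/-- `f : ℝ² → ℝ³ = 𝕃³` is the generalized timelike minimal surface with real Weierstrass
data `(g1, g2, w1 du, w2 dv)`: it is smooth, its partial derivatives are
`f_u = (ω1/2)·(-1-g1², 1-g1², 2g1)` and `f_v = (ω2/2)·(1+g2², 1-g2², -2g2)`
(which encodes the Weierstrass-type integral representation), and it is an immersion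
on an open dense set. -/
structure IsGTMS (f : R2 → R3) (g1 g2 w1 w2 : ℝ → ℝ) : Prop where
  smooth_f : ContDiff ℝ (⊤ : ℕ∞) f
  smooth_g1 : ContDiff ℝ (⊤ : ℕ∞) g1
  smooth_g2 : ContDiff ℝ (⊤ : ℕ∞) g2
  smooth_w1 : ContDiff ℝ (⊤ : ℕ∞) w1
  smooth_w2 : ContDiff ℝ (⊤ : ℕ∞) w2
  deriv_u : ∀ p : R2, pu f p =
    ((-1 - g1 p.1 ^ 2) * w1 p.1 / 2, (1 - g1 p.1 ^ 2) * w1 p.1 / 2, g1 p.1 * w1 p.1)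
  deriv_v : ∀ p : R2, pv f p =
    ((1 + g2 p.2 ^ 2) * w2 p.2 / 2, (1 - g2 p.2 ^ 2) * w2 p.2 / 2, -(g2 p.2 * w2 p.2))
  dense_immersion : Dense {p : R2 | Function.Injective (fderiv ℝ f p)}

/-- `Φ` is a germ of diffeomorphism at `p`. -/
def IsLocalDiffeoAt {E F : Type*} [NormedAddCommGroup E] [NormedSpace ℝ E]
    [NormedAddCommGroup F] [NormedSpace ℝ F] (Φ : E → F) (p : E) : Prop :=
  ∃ (U : Set E) (V : Set F) (Φinv : F → E),
    IsOpen U ∧ p ∈ U ∧ IsOpen V ∧ Φ p ∈ V ∧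
    ContDiffOn ℝ (⊤ : ℕ∞) Φ U ∧ ContDiffOn ℝ (⊤ : ℕ∞) Φinv V ∧
    Set.MapsTo Φ U V ∧ Set.MapsTo Φinv V U ∧
    (∀ x ∈ U, Φinv (Φ x) = x) ∧ (∀ y ∈ V, Φ (Φinv y) = y)

/-- 𝒜-equivalence of the germ of `f1` at `p1` and the germ of `f2` at `p2`. -/
def AEquiv (f1 : R2 → R3) (p1 : R2) (f2 : R2 → R3) (p2 : R2) : Prop :=
  ∃ (Φ : R2 → R2) (Ψ : R3 → R3),
    IsLocalDiffeoAt Φ p1 ∧ Φ p1 = p2 ∧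
    IsLocalDiffeoAt Ψ (f1 p1) ∧ Ψ (f1 p1) = f2 p2 ∧
    ∀ᶠ x in nhds p1, Ψ (f1 x) = f2 (Φ x)

/-- The canonical unit normal of a generalized timelike minimal surface. -/
def gtmsNormal (g1 g2 : ℝ → ℝ) (p : R2) : R3 :=
  (Real.sqrt ((1 - g1 p.1 * g2 p.2) ^ 2 + 2 * (g1 p.1 + g2 p.2) ^ 2))⁻¹ •
    (g1 p.1 + g2 p.2, -g1 p.1 + g2 p.2, 1 + g1 p.1 * g2 p.2)

/-- The signed area density function `λ = det(f_u, f_v, n)`. -/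
def areaDensity (f : R2 → R3) (g1 g2 : ℝ → ℝ) (p : R2) : ℝ :=
  det3 (pu f p) (pv f p) (gtmsNormal g1 g2 p)

/-- `f` is a front at `p`: the Legendrian lift `(f, n)` is an immersion at `p`,
where `n` is the canonical unit normal. -/
def IsFrontAt (f : R2 → R3) (g1 g2 : ℝ → ℝ) (p : R2) : Prop :=
  Function.Injective (fderiv ℝ (fun q => (f q, gtmsNormal g1 g2 q)) p)

/-- The differential of `f` at `p` has rank one. -/
def RankOne (f : R2 → R3) (p : R2) : Prop :=
  LinearMap.rank (fderiv ℝ f p).toLinearMap = 1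

/-- Directional derivative of `F` along the vector field `X`. -/
def vD (X : R2 → R2) (F : R2 → R3) : R2 → R3 := fun q => fderiv ℝ F q (X q)

/-- `φ_i = g_i' / (g_i² ω_i)`. -/
def phiW (g w : ℝ → ℝ) : ℝ → ℝ := fun t => deriv g t / (g t ^ 2 * w t)
/-- `Φ_i = (g_i/g_i') φ_i'`. -/
def PhiW (g w : ℝ → ℝ) : ℝ → ℝ := fun t => g t / deriv g t * deriv (phiW g w) t

/-- standard cuspidal butterfly -/
def fCBF : R2 → R3 := fun q =>
  (q.1, 5 * q.2 ^ 4 + 2 * q.1 * q.2, 4 * q.2 ^ 5 + q.1 * q.2 ^ 2 - q.1 ^ 2)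
/-- standard cuspidal S₁⁺ singularity -/
def fCS1p : R2 → R3 := fun q => (q.1, q.2 ^ 2, q.2 ^ 3 * (q.1 ^ 2 + q.2 ^ 2))
/-- standard cuspidal S₁⁻ singularity -/
def fCS1m : R2 → R3 := fun q => (q.1, q.2 ^ 2, q.2 ^ 3 * (q.1 ^ 2 - q.2 ^ 2))
/-- standard cuspidal edge -/
def fCE : R2 → R3 := fun q => (q.1, q.2 ^ 2, q.2 ^ 3)
/-- standard (2,5)-cuspidal edge -/
def fCE25 : R2 → R3 := fun q => (q.1, q.2 ^ 2, q.2 ^ 5)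
/-- standard cuspidal beaks -/
def fCBK : R2 → R3 := fun q =>
  (q.2, q.1 ^ 3 - q.1 * q.2 ^ 2, 3 * q.1 ^ 4 - 2 * q.1 ^ 2 * q.2 ^ 2)
/-- standard cuspidal lips -/
def fCLP : R2 → R3 := fun q =>
  (q.2, q.1 ^ 3 + q.1 * q.2 ^ 2, 3 * q.1 ^ 4 + 2 * q.1 ^ 2 * q.2 ^ 2)
/-- standard D₄⁺ singularity -/
def fD4p : R2 → R3 := fun q =>
  (q.1 * q.2, q.1 ^ 2 + 3 * q.2 ^ 2, q.1 ^ 2 * q.2 + q.2 ^ 3)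
/-- standard D₄⁻ singularity -/
def fD4m : R2 → R3 := fun q =>
  (q.1 * q.2, q.1 ^ 2 - 3 * q.2 ^ 2, q.1 ^ 2 * q.2 - q.2 ^ 3)

open scoped ContDiff Topology

theorem exists_contDiff_eventuallyEq {E F : Type*} [NormedAddCommGroup E] [NormedSpace ℝ E]
    [FiniteDimensional ℝ E] [NormedAddCommGroup F] [NormedSpace ℝ F] {f : E → F} {p : E}
    (h : ∀ᶠ x in 𝓝 p, ContDiffAt ℝ ∞ f x) : ∃ g : E → F, ContDiff ℝ ∞ g ∧ g =ᶠ[𝓝 p] f := by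
  obtain ⟨r, hr, hball⟩ := Metric.eventually_nhds_iff_ball.1 h
  let b : ContDiffBump p := ⟨r / 4, r / 2, by positivity, by linarith⟩
  refine ⟨fun x => b x • f x, ?_, ?_⟩
  · rw [contDiff_iff_contDiffAt]
    intro x
    by_cases hx : x ∈ Metric.ball p r
    · exact b.contDiffAt.smul (hball x hx)
    · have hx' : x ∉ tsupport b := by
        rw [b.tsupport_eq]
        simp only [Metric.mem_closedBall, Metric.mem_ball, not_lt, b] at hx ⊢
        linarith
      have : (fun x => b x • f x) =ᶠ[𝓝 x] fun _ => 0 := by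
        filter_upwards [notMem_tsupport_iff_eventuallyEq.1 hx'] with y hy
        simp [hy]
      exact contDiffAt_const.congr_of_eventuallyEq this
  · filter_upwards [b.eventuallyEq_one] with x hx
    simp [hx]

theorem isLocalDiffeoAt_of_equiv {E F : Type*} [NormedAddCommGroup E] [NormedSpace ℝ E]
    [CompleteSpace E] [NormedAddCommGroup F] [NormedSpace ℝ F]
    {f : E → F} {p : E} (hf : ContDiff ℝ ∞ f) (e : E ≃L[ℝ] F)
    (he : HasFDerivAt f (e : E →L[ℝ] F) p) : IsLocalDiffeoAt f p := by
  have hn : (∞ : WithTop ℕ∞) ≠ 0 := by simp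
  set H := hf.contDiffAt.toOpenPartialHomeomorph f he hn with hH
  have hHf : ∀ x, H x = f x := fun x => rfl
  let S : Set E := {x | fderiv ℝ f x ∈ Set.range ((↑) : (E ≃L[ℝ] F) → E →L[ℝ] F)}
  have hS : IsOpen S :=
    (ContinuousLinearEquiv.isOpen (𝕜 := ℝ) (E := E) (F := F)).preimage (hf.continuous_fderiv hn)
  have hpS : p ∈ S := ⟨e, he.fderiv.symm⟩
  have hps : p ∈ H.source := hf.contDiffAt.mem_toOpenPartialHomeomorph_source he hn
  refine ⟨H.source ∩ S, H '' (H.source ∩ S), H.symm, H.open_source.inter hS, ⟨hps, hpS⟩,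
    H.isOpen_image_of_subset_source (H.open_source.inter hS) Set.inter_subset_left,
    ⟨p, ⟨hps, hpS⟩, rfl⟩, hf.contDiffOn, ?_, fun x hx => ⟨x, hx, rfl⟩, ?_, ?_, ?_⟩
  · rintro _ ⟨x, ⟨hx, e', he'⟩, rfl⟩
    refine (H.contDiffAt_symm (f₀' := e') (H.map_source hx) ?_ hf.contDiffAt).contDiffWithinAt
    rw [H.left_inv hx, he']
    exact (hf.differentiable hn x).hasFDerivAt
  · rintro _ ⟨x, hx, rfl⟩
    rw [H.left_inv hx.1]
    exact hx
  · rintro x hx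
    exact H.left_inv hx.1
  · rintro _ ⟨x, hx, rfl⟩
    rw [H.left_inv hx.1]
    rfl

theorem isLocalDiffeoAt_of_injective {E : Type*} [NormedAddCommGroup E] [NormedSpace ℝ E]
    [FiniteDimensional ℝ E] {f : E → E} {p : E} (hf : ContDiff ℝ ∞ f)
    (h : Function.Injective (fderiv ℝ f p)) : IsLocalDiffeoAt f p := by
  have := FiniteDimensional.complete ℝ E
  let e : E ≃L[ℝ] E :=
    (LinearEquiv.ofInjectiveEndo (fderiv ℝ f p : E →ₗ[ℝ] E) h).toContinuousLinearEquiv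
  refine isLocalDiffeoAt_of_equiv hf e ?_
  have : (e : E →L[ℝ] E) = fderiv ℝ f p := by ext x; rfl
  rw [this]
  exact (hf.differentiable (by simp) p).hasFDerivAt

namespace IsLocalDiffeoAt

variable {E F : Type*} [NormedAddCommGroup E] [NormedSpace ℝ E] [NormedAddCommGroup F]
  [NormedSpace ℝ F] {f : E → F} {p : E}

theorem exists_symm (h : IsLocalDiffeoAt f p) : ∃ g : F → E, IsLocalDiffeoAt g (f p) ∧
    g (f p) = p ∧ (∀ᶠ x in 𝓝 p, g (f x) = x) ∧ ∀ᶠ y in 𝓝 (f p), f (g y) = y := by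
  obtain ⟨U, V, g, hU, hp, hV, hfp, hf, hg, hm, hm', h1, h2⟩ := h
  exact ⟨g, ⟨V, U, f, hV, hfp, hU, hm' hfp, hg, hf, hm', hm, h2, h1⟩, h1 p hp,
    eventually_of_mem (hU.mem_nhds hp) h1, eventually_of_mem (hV.mem_nhds hfp) h2⟩

theorem eventually_contDiffAt (h : IsLocalDiffeoAt f p) : ∀ᶠ x in 𝓝 p, ContDiffAt ℝ ∞ f x := by
  obtain ⟨U, V, g, hU, hp, hV, hfp, hf, -⟩ := h
  filter_upwards [hU.mem_nhds hp] with x hx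
  exact hf.contDiffAt (hU.mem_nhds hx)

theorem continuousAt (h : IsLocalDiffeoAt f p) : ContinuousAt f p :=
  h.eventually_contDiffAt.self_of_nhds.continuousAt

theorem injective_fderiv (h : IsLocalDiffeoAt f p) : Function.Injective (fderiv ℝ f p) := by
  obtain ⟨g, hg, hgp, hgf, -⟩ := h.exists_symm
  have hn : (∞ : WithTop ℕ∞) ≠ 0 := by simp
  have h1 := (h.eventually_contDiffAt.self_of_nhds.differentiableAt hn).hasFDerivAt
  have h2 := (hg.eventually_contDiffAt.self_of_nhds.differentiableAt hn).hasFDerivAt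
  have h3 : HasFDerivAt id (ContinuousLinearMap.id ℝ E) p := hasFDerivAt_id p
  have h4 := ((h2.comp p h1).congr_of_eventuallyEq
    (hgf.mono fun x hx => hx.symm : id =ᶠ[𝓝 p] g ∘ f)).unique h3
  intro x y hxy
  have := congrArg (fun L : E →L[ℝ] E => L (x - y)) h4
  simp only [ContinuousLinearMap.comp_apply, map_sub, hxy, sub_self,
    ContinuousLinearMap.id_apply] at this
  exact (sub_eq_zero.1 this.symm)

theorem congr {g : E → F} (h : IsLocalDiffeoAt f p) (hfg : g =ᶠ[𝓝 p] f) :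
    IsLocalDiffeoAt g p := by
  obtain ⟨U, V, g', hU, hp, hV, hfp, hf, hg, hm, hm', h1, h2⟩ := h
  obtain ⟨W, hW, hWo, hpW⟩ := eventually_nhds_iff.1 hfg
  refine ⟨U ∩ W, V ∩ g' ⁻¹' W, g', hU.inter hWo, ⟨hp, hpW⟩,
    hg.continuousOn.isOpen_inter_preimage hV hWo, ?_, ?_, hg.mono Set.inter_subset_left, ?_, ?_,
    ?_, ?_⟩
  · rw [hW p hpW]
    exact ⟨hfp, by simpa [h1 p hp] using hpW⟩
  · exact (hf.mono Set.inter_subset_left).congr fun x hx => hW x hx.2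
  · intro x hx
    rw [hW x hx.2]
    exact ⟨hm hx.1, by simpa [h1 x hx.1] using hx.2⟩
  · intro y hy
    exact ⟨hm' hy.1, hy.2⟩
  · intro x hx
    rw [hW x hx.2, h1 x hx.1]
  · intro y hy
    rw [hW _ hy.2, h2 y hy.1]

theorem exists_global [FiniteDimensional ℝ E] (h : IsLocalDiffeoAt f p) :
    ∃ g : E → F, ContDiff ℝ ∞ g ∧ Function.Injective (fderiv ℝ g p) ∧ g =ᶠ[𝓝 p] f := by
  obtain ⟨g, hg, hgf⟩ := exists_contDiff_eventuallyEq h.eventually_contDiffAt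
  refine ⟨g, hg, ?_, hgf⟩
  rw [hgf.fderiv_eq]
  exact h.injective_fderiv

/-- A local diffeomorphism between finite-dimensional spaces has a global smooth map as a local
inverse germ. -/
theorem exists_global_symm [FiniteDimensional ℝ F] (h : IsLocalDiffeoAt f p) :
    ∃ g : F → E, ContDiff ℝ ∞ g ∧ IsLocalDiffeoAt g (f p) ∧ g (f p) = p ∧
      (∀ᶠ x in 𝓝 p, g (f x) = x) ∧ ∀ᶠ y in 𝓝 (f p), f (g y) = y := by
  obtain ⟨g0, hg0, hgp, h1, h2⟩ := h.exists_symm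
  obtain ⟨g, hg, hgf⟩ := exists_contDiff_eventuallyEq hg0.eventually_contDiffAt
  refine ⟨g, hg, hg0.congr hgf, by rw [hgf.self_of_nhds, hgp], ?_, ?_⟩
  · filter_upwards [h1, h.continuousAt.eventually hgf] with x hx hx'
    rw [hx', hx]
  · filter_upwards [h2, hgf] with y hy hy'
    rw [hy', hy]

end IsLocalDiffeoAt

namespace AEquiv

variable {f1 f2 f3 : R2 → R3} {p1 p2 p3 : R2}

theorem of_global (Φ : R2 → R2) (Ψ : R3 → R3) (hΦ : ContDiff ℝ ∞ Φ) (hΨ : ContDiff ℝ ∞ Ψ)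
    (hΦi : Function.Injective (fderiv ℝ Φ p1)) (hΨi : Function.Injective (fderiv ℝ Ψ (f1 p1)))
    (hp : Φ p1 = p2) (h : ∀ᶠ x in 𝓝 p1, Ψ (f1 x) = f2 (Φ x)) : AEquiv f1 p1 f2 p2 :=
  ⟨Φ, Ψ, isLocalDiffeoAt_of_injective hΦ hΦi, hp, isLocalDiffeoAt_of_injective hΨ hΨi,
    by rw [h.self_of_nhds, hp], h⟩

theorem exists_global (h : AEquiv f1 p1 f2 p2) (hf1 : ContinuousAt f1 p1) :
    ∃ (Φ : R2 → R2) (Ψ : R3 → R3), ContDiff ℝ ∞ Φ ∧ ContDiff ℝ ∞ Ψ ∧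
      Function.Injective (fderiv ℝ Φ p1) ∧ Function.Injective (fderiv ℝ Ψ (f1 p1)) ∧
      Φ p1 = p2 ∧ Ψ (f1 p1) = f2 p2 ∧ ∀ᶠ x in 𝓝 p1, Ψ (f1 x) = f2 (Φ x) := by
  obtain ⟨Φ, Ψ, hΦ, hp, hΨ, hp', h⟩ := h
  obtain ⟨Φ', h1, h2, h3⟩ := hΦ.exists_global
  obtain ⟨Ψ', h4, h5, h6⟩ := hΨ.exists_global
  refine ⟨Φ', Ψ', h1, h4, h2, h5, by rw [h3.self_of_nhds, hp], by rw [h6.self_of_nhds, hp'], ?_⟩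
  filter_upwards [h, h3, hf1.eventually h6] with x hx hx1 hx2
  rw [hx1, hx2, hx]

theorem symm (h : AEquiv f1 p1 f2 p2) (hf1 : ContinuousAt f1 p1) : AEquiv f2 p2 f1 p1 := by
  obtain ⟨Φ, Ψ, hΦ, rfl, hΨ, hp', h⟩ := h
  obtain ⟨Φ', h1, h2, h3, h4⟩ := hΦ.exists_symm
  obtain ⟨Ψ', h5, h6, h7, h8⟩ := hΨ.exists_symm
  refine ⟨Φ', Ψ', h1, h2, hp' ▸ h5, hp' ▸ h6, ?_⟩
  have hc : Tendsto Φ' (𝓝 (Φ p1)) (𝓝 p1) := by simpa [h2] using h1.continuousAt.tendsto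
  filter_upwards [h4, hc.eventually h, hc.eventually (hf1.eventually h7)] with y hy hy1 hy2
  rw [← hy2, hy1, hy]

theorem trans (h12 : AEquiv f1 p1 f2 p2) (h23 : AEquiv f2 p2 f3 p3) (hf1 : ContinuousAt f1 p1)
    (hf2 : ContinuousAt f2 p2) : AEquiv f1 p1 f3 p3 := by
  obtain ⟨Φ, Ψ, h1, h2, h3, h4, rfl, hp, h⟩ := h12.exists_global hf1
  obtain ⟨Φ', Ψ', h1', h2', h3', h4', rfl, hp', h'⟩ := h23.exists_global hf2
  have hn : (∞ : WithTop ℕ∞) ≠ 0 := by simp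
  refine of_global (Φ' ∘ Φ) (Ψ' ∘ Ψ) (h1'.comp h1) (h2'.comp h2) ?_ ?_ rfl ?_
  · rw [fderiv_comp _ (h1'.differentiable hn _) (h1.differentiable hn _)]
    exact h3'.comp h3
  · rw [fderiv_comp _ (h2'.differentiable hn _) (h2.differentiable hn _), hp]
    exact h4'.comp h4
  · filter_upwards [h, h1.continuous.continuousAt.eventually h'] with x hx hx'
    simp [hx, hx']

end AEquiv

/-- Smooth implicit function theorem in finite dimension, with a globally smooth solution. -/
theorem exists_implicit {A B : Type*} [NormedAddCommGroup A] [NormedSpace ℝ A]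
    [FiniteDimensional ℝ A] [NormedAddCommGroup B] [NormedSpace ℝ B] [FiniteDimensional ℝ B]
    {R : A × B → B} (hR : ContDiff ℝ ∞ R) {a0 : A} {b0 : B} (h0 : R (a0, b0) = 0)
    (hi : ∀ v, fderiv ℝ R (a0, b0) (0, v) = 0 → v = 0) :
    ∃ φ : A → B, ContDiff ℝ ∞ φ ∧ φ a0 = b0 ∧ ∀ᶠ a in 𝓝 a0, R (a, φ a) = 0 := by
  have hn : (∞ : WithTop ℕ∞) ≠ 0 := by simp
  let f : A × B → A × B := fun z => (z.1, R z)
  have hf : ContDiff ℝ ∞ f := contDiff_fst.prodMk hR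
  have hd : HasFDerivAt f ((ContinuousLinearMap.fst ℝ A B).prod (fderiv ℝ R (a0, b0))) (a0, b0) :=
    hasFDerivAt_fst.prodMk (hR.differentiable hn _).hasFDerivAt
  have hloc : IsLocalDiffeoAt f (a0, b0) := by
    refine isLocalDiffeoAt_of_injective hf ?_
    rw [hd.fderiv, injective_iff_map_eq_zero]
    rintro ⟨x, y⟩ hxy
    simp only [ContinuousLinearMap.prod_apply, ContinuousLinearMap.coe_fst', Prod.mk_eq_zero] at hxy
    obtain ⟨rfl, h2⟩ := hxy
    simp [hi y h2]
  obtain ⟨g, hg, -, hgp, h1, h2⟩ := hloc.exists_global_symm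
  have hfa : f (a0, b0) = (a0, 0) := by simp [f, h0]
  rw [hfa] at hgp h2
  have hc : Tendsto (fun a : A => (a, (0 : B))) (𝓝 a0) (𝓝 (a0, 0)) :=
    (Continuous.prodMk_left (0 : B)).tendsto a0
  refine ⟨fun a => (g (a, 0)).2, contDiff_snd.comp (hg.comp (contDiff_id.prodMk contDiff_const)),
    by simp [hgp], ?_⟩
  filter_upwards [hc.eventually h2] with a ha
  have h3 : (g (a, 0)).1 = a := congrArg Prod.fst ha
  have h4 : R (g (a, 0)) = 0 := congrArg Prod.snd ha
  have h5 : (a, (g (a, 0)).2) = g (a, 0) := Prod.ext h3.symm rfl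
  rw [h5, h4]

section ParametricIntegral

open MeasureTheory

variable {E F : Type} [NormedAddCommGroup E] [NormedSpace ℝ E] [FiniteDimensional ℝ E]
  [NormedAddCommGroup F] [NormedSpace ℝ F]

theorem hasFDerivAt_paramIntegral {g : ℝ × E → F} (hg : ContDiff ℝ ∞ g) (a b : ℝ) (x : E) :
    HasFDerivAt (fun x => ∫ t in a..b, g (t, x))
      (∫ t in a..b, (fderiv ℝ g (t, x)).comp (ContinuousLinearMap.inr ℝ ℝ E)) x := by
  have hn : (∞ : WithTop ℕ∞) ≠ 0 := by simp
  have : ProperSpace E := FiniteDimensional.proper ℝ E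
  have hc : Continuous fun z : ℝ × E => (fderiv ℝ g z).comp (ContinuousLinearMap.inr ℝ ℝ E) :=
    (hg.continuous_fderiv hn).clm_comp continuous_const
  obtain ⟨C, hC⟩ := ((isCompact_uIcc (a := a) (b := b)).prod
    (isCompact_closedBall x 1)).exists_bound_of_continuousOn hc.continuousOn
  refine intervalIntegral.hasFDerivAt_integral_of_dominated_of_fderiv_le (𝕜 := ℝ)
    (F := fun x t => g (t, x)) (bound := fun _ => C)
    (F' := fun x t => (fderiv ℝ g (t, x)).comp (ContinuousLinearMap.inr ℝ ℝ E))
    (Metric.closedBall_mem_nhds x one_pos) ?_ ?_ ?_ ?_ ?_ ?_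
  · exact Eventually.of_forall fun y =>
      (hg.continuous.comp (Continuous.prodMk_left y)).aestronglyMeasurable
  · exact (hg.continuous.comp (Continuous.prodMk_left x)).intervalIntegrable _ _
  · exact (hc.comp (Continuous.prodMk_left x)).aestronglyMeasurable
  · exact Eventually.of_forall fun t ht y hy => hC (t, y) ⟨Set.uIoc_subset_uIcc ht, hy⟩
  · exact intervalIntegrable_const
  · refine Eventually.of_forall fun t ht y hy => ?_
    have h1 : HasFDerivAt (fun y : E => (t, y)) (ContinuousLinearMap.inr ℝ ℝ E) y :=
      hasFDerivAt_prodMk_right t y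
    exact (hg.differentiable hn (t, y)).hasFDerivAt.comp y h1

theorem contDiff_paramIntegral {g : ℝ × E → F} (hg : ContDiff ℝ ∞ g) (a b : ℝ) :
    ContDiff ℝ ∞ fun x => ∫ t in a..b, g (t, x) := by
  have key : ∀ (n : ℕ) {F : Type} [NormedAddCommGroup F] [NormedSpace ℝ F] (g : ℝ × E → F),
      ContDiff ℝ ∞ g → ContDiff ℝ n fun x => ∫ t in a..b, g (t, x) := by
    intro n
    induction n with
    | zero =>
      intro F _ _ g hg
      rw [Nat.cast_zero, contDiff_zero, continuous_iff_continuousAt]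
      exact fun x => (hasFDerivAt_paramIntegral hg a b x).continuousAt
    | succ n ih =>
      intro F _ _ g hg
      have := (contDiff_succ_iff_hasFDerivAt (𝕜 := ℝ) (n := n)
        (f := fun x => ∫ t in a..b, g (t, x))).2 ⟨_, ih _
        (hg.fderiv_right (m := ∞) (by simp) |>.clm_comp contDiff_const),
        hasFDerivAt_paramIntegral hg a b⟩
      exact_mod_cast this
  exact contDiff_infty.2 fun n => key n g hg

theorem norm_iteratedFDeriv_paramIntegral_le (a b : ℝ) (k : ℕ) {C : ℝ} :
    ∀ {F : Type} [NormedAddCommGroup F] [NormedSpace ℝ F] {g : ℝ × E → F},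
      ContDiff ℝ ∞ g → (∀ t ∈ Set.uIcc a b, ∀ x, ‖iteratedFDeriv ℝ k g (t, x)‖ ≤ C) →
      ∀ x, ‖iteratedFDeriv ℝ k (fun x => ∫ t in a..b, g (t, x)) x‖ ≤ C * |b - a| := by
  induction k with
  | zero =>
    intro F _ _ g hg h x
    rw [norm_iteratedFDeriv_zero]
    refine intervalIntegral.norm_integral_le_of_norm_le_const fun t ht => ?_
    simpa using h t (Set.uIoc_subset_uIcc ht) x
  | succ k ih =>
    intro F _ _ g hg h x
    have h1 : fderiv ℝ (fun x => ∫ t in a..b, g (t, x)) = fun x =>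
        ∫ t in a..b, (fderiv ℝ g (t, x)).comp (ContinuousLinearMap.inr ℝ ℝ E) :=
      funext fun x => (hasFDerivAt_paramIntegral hg a b x).fderiv
    rw [← norm_iteratedFDeriv_fderiv, h1]
    have hg' : ContDiff ℝ ∞ (fderiv ℝ g) := hg.fderiv_right (m := ∞) (by simp)
    refine ih (g := fun z => (fderiv ℝ g z).comp (ContinuousLinearMap.inr ℝ ℝ E))
      (hg'.clm_comp contDiff_const) (fun t ht x => ?_) x
    let L := (ContinuousLinearMap.compL ℝ E (ℝ × E) F).flip (ContinuousLinearMap.inr ℝ ℝ E)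
    have hL : ‖L‖ ≤ 1 := by
      refine ContinuousLinearMap.opNorm_le_bound _ zero_le_one fun A => ?_
      refine (ContinuousLinearMap.opNorm_comp_le A (ContinuousLinearMap.inr ℝ ℝ E)).trans ?_
      rw [one_mul]
      exact mul_le_of_le_one_right (norm_nonneg _) (ContinuousLinearMap.norm_inr_le_one ℝ ℝ E)
    have h2 := L.norm_iteratedFDeriv_comp_left (hg'.contDiffAt (x := (t, x))) (n := k)
      (by exact_mod_cast le_top)
    have h3 := h t ht x
    rw [← norm_iteratedFDeriv_fderiv] at h3
    calc _ ≤ ‖L‖ * ‖iteratedFDeriv ℝ k (fderiv ℝ g) (t, x)‖ := h2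
      _ ≤ 1 * C := mul_le_mul hL h3 (norm_nonneg _) zero_le_one
      _ = C := one_mul C

end ParametricIntegral

/-- Hadamard's lemma in one variable, with parameters and difference quotient along a graph. -/
theorem exists_hadamard {E : Type} [NormedAddCommGroup E] [NormedSpace ℝ E]
    [FiniteDimensional ℝ E] {f : ℝ × E → ℝ} (hf : ContDiff ℝ ∞ f) {σ : E → ℝ}
    (hσ : ContDiff ℝ ∞ σ) : ∃ g : ℝ × E → ℝ, ContDiff ℝ ∞ g ∧
      (∀ t x, f (t, x) - f (σ x, x) = (t - σ x) * g (t, x)) ∧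
      ∀ x, g (σ x, x) = deriv (fun t => f (t, x)) (σ x) := by
  have hn : (∞ : WithTop ℕ∞) ≠ 0 := by simp
  have hf' : ContDiff ℝ ∞ (fun z => fderiv ℝ f z (1, 0)) :=
    (hf.fderiv_right (m := ∞) (by simp)).clm_apply contDiff_const
  have hd : ∀ t x, HasDerivAt (fun t => f (t, x)) (fderiv ℝ f (t, x) (1, 0)) t := fun t x =>
    ((hf.differentiable hn (t, x)).hasFDerivAt).comp_hasDerivAt t
      ((hasDerivAt_id t).prodMk (hasDerivAt_const t x))
  refine ⟨fun z => ∫ θ in (0 : ℝ)..1, fderiv ℝ f (σ z.2 + θ * (z.1 - σ z.2), z.2) (1, 0),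
    contDiff_paramIntegral (g := fun w : ℝ × (ℝ × E) =>
      fderiv ℝ f (σ w.2.2 + w.1 * (w.2.1 - σ w.2.2), w.2.2) (1, 0)) ?_ 0 1, ?_, ?_⟩
  · exact hf'.comp (f := fun w : ℝ × (ℝ × E) =>
      (σ w.2.2 + w.1 * (w.2.1 - σ w.2.2), w.2.2)) (by fun_prop)
  · intro t x
    have h1 : ∀ θ ∈ Set.uIcc (0 : ℝ) 1, HasDerivAt (fun θ => f (σ x + θ * (t - σ x), x))
        ((t - σ x) * fderiv ℝ f (σ x + θ * (t - σ x), x) (1, 0)) θ := by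
      intro θ _
      have h2 : HasDerivAt (fun θ : ℝ => σ x + θ * (t - σ x)) (t - σ x) θ := by
        simpa using ((hasDerivAt_id θ).mul_const (t - σ x)).const_add (σ x)
      have := (hd (σ x + θ * (t - σ x)) x).comp θ h2
      rwa [mul_comm] at this
    have hcont : Continuous fun θ : ℝ => fderiv ℝ f (σ x + θ * (t - σ x), x) (1, 0) :=
      hf'.continuous.comp (f := fun θ : ℝ => (σ x + θ * (t - σ x), x)) (by fun_prop)
    have h3 := intervalIntegral.integral_eq_sub_of_hasDerivAt h1
      ((continuous_const.mul hcont).intervalIntegrable _ _)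
    rw [intervalIntegral.integral_const_mul] at h3
    rw [h3]
    simp
  · intro x
    simp [(hd (σ x) x).deriv]

theorem exists_hadamard_zero {E : Type} [NormedAddCommGroup E] [NormedSpace ℝ E]
    [FiniteDimensional ℝ E] {f : ℝ × E → ℝ} (hf : ContDiff ℝ ∞ f) : ∃ g : ℝ × E → ℝ,
      ContDiff ℝ ∞ g ∧ (∀ t x, f (t, x) = f (0, x) + t * g (t, x)) ∧
      ∀ x, g (0, x) = deriv (fun t => f (t, x)) 0 := by
  obtain ⟨g, h1, h2, h3⟩ := exists_hadamard hf (σ := fun _ => 0) contDiff_const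
  refine ⟨g, h1, fun t x => ?_, h3⟩
  have := h2 t x
  rw [sub_zero] at this
  linarith

/-- Hadamard's lemma in one variable. -/
theorem exists_hadamard_one {f : ℝ → ℝ} (hf : ContDiff ℝ ∞ f) : ∃ g : ℝ → ℝ,
      ContDiff ℝ ∞ g ∧ (∀ t, f t = f 0 + t * g t) ∧ g 0 = deriv f 0 := by
  obtain ⟨g, h1, h2, h3⟩ := exists_hadamard_zero (E := ℝ) (f := fun z => f z.1)
    (hf.comp contDiff_fst)
  exact ⟨fun t => g (t, 0), h1.comp (contDiff_id.prodMk contDiff_const), fun t => h2 t 0, h3 0⟩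

/-- A family of reals growing at most polynomially in `m`, uniformly in the second index. -/
def PolyBound {ι : Type} (v : ℕ → ι → ℝ) : Prop :=
  ∃ (C : ℝ) (N : ℕ), 0 ≤ C ∧ ∀ m i, |v m i| ≤ C * ((m : ℝ) + 1) ^ N

namespace PolyBound

variable {ι κ : Type} {v w : ℕ → ι → ℝ}

theorem mono (hw : PolyBound w) (h : ∀ m i, |v m i| ≤ w m i) : PolyBound v := by
  obtain ⟨C, N, hC, H⟩ := hw
  exact ⟨C, N, hC, fun m i => (h m i).trans ((le_abs_self _).trans (H m i))⟩

theorem const (c : ℝ) : PolyBound (fun (_ : ℕ) (_ : ι) => c) :=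
  ⟨|c|, 0, abs_nonneg c, fun m i => by simp⟩

theorem of_le (c : ℝ) (h : ∀ m i, |v m i| ≤ c) : PolyBound v := (const c).mono h

theorem nat : PolyBound (fun (m : ℕ) (_ : ι) => (m : ℝ) + 1) :=
  ⟨1, 1, zero_le_one, fun m i => by rw [abs_of_pos (by positivity)]; simp⟩

theorem mul (hv : PolyBound v) (hw : PolyBound w) : PolyBound (fun m i => v m i * w m i) := by
  obtain ⟨C, N, hC, H⟩ := hv
  obtain ⟨C', N', hC', H'⟩ := hw
  refine ⟨C * C', N + N', mul_nonneg hC hC', fun m i => ?_⟩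
  rw [abs_mul, pow_add]
  calc _ ≤ (C * ((m : ℝ) + 1) ^ N) * (C' * ((m : ℝ) + 1) ^ N') :=
        mul_le_mul (H m i) (H' m i) (abs_nonneg _) ((abs_nonneg _).trans (H m i))
    _ = _ := by ring

theorem add (hv : PolyBound v) (hw : PolyBound w) : PolyBound (fun m i => v m i + w m i) := by
  obtain ⟨C, N, hC, H⟩ := hv
  obtain ⟨C', N', hC', H'⟩ := hw
  refine ⟨C + C', N + N', add_nonneg hC hC', fun m i => (abs_add_le _ _).trans ?_⟩
  have h1 : (1 : ℝ) ≤ (m : ℝ) + 1 := by simp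
  have h2 : ((m : ℝ) + 1) ^ N ≤ ((m : ℝ) + 1) ^ (N + N') := pow_le_pow_right₀ h1 (by omega)
  have h3 : ((m : ℝ) + 1) ^ N' ≤ ((m : ℝ) + 1) ^ (N + N') := pow_le_pow_right₀ h1 (by omega)
  calc _ ≤ C * ((m : ℝ) + 1) ^ N + C' * ((m : ℝ) + 1) ^ N' := add_le_add (H m i) (H' m i)
    _ ≤ C * ((m : ℝ) + 1) ^ (N + N') + C' * ((m : ℝ) + 1) ^ (N + N') := by gcongr
    _ = _ := by ring

theorem sum {α : Type} {s : Finset α} {v : α → ℕ → ι → ℝ} (h : ∀ a ∈ s, PolyBound (v a)) :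
    PolyBound (fun m i => ∑ a ∈ s, v a m i) := by
  classical
  induction s using Finset.induction_on with
  | empty => simpa using const (ι := ι) 0
  | insert a s ha ih =>
    simp only [Finset.sum_insert ha]
    exact (h a (by simp)).add (ih fun b hb => h b (by simp [hb]))

theorem pow (hv : PolyBound v) (k : ℕ) : PolyBound (fun m i => v m i ^ k) := by
  induction k with
  | zero => simpa using const (ι := ι) 1
  | succ k ih => simpa only [pow_succ] using ih.mul hv

theorem comp (hv : PolyBound v) (f : ℕ → κ → ι) : PolyBound (fun m i => v m (f m i)) := by
  obtain ⟨C, N, hC, H⟩ := hv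
  exact ⟨C, N, hC, fun m i => H m _⟩

end PolyBound

section Moderate

variable {A B F G H : Type} [NormedAddCommGroup A] [NormedSpace ℝ A] [NormedAddCommGroup B]
  [NormedSpace ℝ B] [NormedAddCommGroup F] [NormedSpace ℝ F] [NormedAddCommGroup G]
  [NormedSpace ℝ G] [NormedAddCommGroup H] [NormedSpace ℝ H]

/-- A sequence of smooth maps all of whose derivatives grow at most polynomially in the index. -/
def Moderate (T : ℕ → A → F) : Prop :=
  (∀ m, ContDiff ℝ ∞ (T m)) ∧ ∀ k, PolyBound fun m x => ‖iteratedFDeriv ℝ k (T m) x‖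

/-- Like `Moderate`, with no condition on the maps themselves, only on their derivatives. -/
def ModerateDeriv (T : ℕ → A → F) : Prop :=
  (∀ m, ContDiff ℝ ∞ (T m)) ∧ ∀ k, 1 ≤ k → PolyBound fun m x => ‖iteratedFDeriv ℝ k (T m) x‖

/-- A smooth map with bounded derivatives of all orders. -/
def BddDeriv (g : A → F) : Prop := Moderate fun _ : ℕ => g

theorem Moderate.moderateDeriv {T : ℕ → A → F} (h : Moderate T) : ModerateDeriv T :=
  ⟨h.1, fun k _ => h.2 k⟩

theorem norm_iteratedFDeriv_const_le (k : ℕ) (c : F) (x : A) :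
    ‖iteratedFDeriv ℝ k (fun _ : A => c) x‖ ≤ ‖c‖ := by
  rcases k with _ | k
  · simp
  · simp [iteratedFDeriv_succ_const]

theorem moderate_const {c : ℕ → F} (h : PolyBound fun m (_ : A) => ‖c m‖) :
    Moderate fun m (_ : A) => c m :=
  ⟨fun m => contDiff_const, fun k => h.mono fun m x => by
    rw [abs_norm]; exact norm_iteratedFDeriv_const_le k _ x⟩

theorem moderateDeriv_clm {L : ℕ → A →L[ℝ] F} (h : PolyBound fun m (_ : A) => ‖L m‖) :
    ModerateDeriv fun m x => L m x := by
  refine ⟨fun m => (L m).contDiff, fun k hk => h.mono fun m x => ?_⟩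
  obtain ⟨k, rfl⟩ := Nat.exists_eq_add_of_le' hk
  rw [abs_norm, ← norm_iteratedFDeriv_fderiv]
  have : fderiv ℝ (fun x => L m x) = fun _ => L m := funext fun x => (L m).fderiv
  rw [this]
  exact norm_iteratedFDeriv_const_le k _ x

theorem Moderate.comp {g : ℕ → F → G} {T : ℕ → A → F} (hg : Moderate g) (hT : ModerateDeriv T) :
    Moderate fun m x => g m (T m x) := by
  refine ⟨fun m => (hg.1 m).comp (hT.1 m), fun k => ?_⟩
  have h1 : PolyBound fun m x => ∑ i ∈ Finset.range (k + 1), ‖iteratedFDeriv ℝ i (g m) (T m x)‖ :=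
    PolyBound.sum fun i _ => (hg.2 i).comp T
  have h2 : PolyBound fun m x => 1 + ∑ i ∈ Finset.Icc 1 k, ‖iteratedFDeriv ℝ i (T m) x‖ :=
    (PolyBound.const 1).add (PolyBound.sum fun i hi => hT.2 i (Finset.mem_Icc.1 hi).1)
  refine (((PolyBound.const (k.factorial : ℝ)).mul h1).mul (h2.pow k)).mono fun m x => ?_
  rw [abs_norm]
  have hnn : ∀ i ∈ Finset.Icc 1 k, 0 ≤ ‖iteratedFDeriv ℝ i (T m) x‖ := fun i _ => norm_nonneg _
  refine norm_iteratedFDeriv_comp_le (hg.1 m) (hT.1 m) (n := k) (by exact_mod_cast le_top) x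
    (fun i hi => ?_) fun i hi hik => ?_
  · exact Finset.single_le_sum (f := fun i => ‖iteratedFDeriv ℝ i (g m) (T m x)‖)
      (fun i _ => norm_nonneg _) (Finset.mem_range.2 (by omega))
  · have h3 := Finset.single_le_sum hnn (Finset.mem_Icc.2 ⟨hi, hik⟩)
    have h4 := Finset.sum_nonneg hnn
    exact (h3.trans (by linarith)).trans
      (le_self_pow₀ (by linarith) (by omega))

theorem polyBound_bilin (L : F →L[ℝ] G →L[ℝ] H) {S : ℕ → A → F} {T : ℕ → A → G} (k : ℕ)
    (hS : ∀ m, ContDiff ℝ ∞ (S m)) (hT : ∀ m, ContDiff ℝ ∞ (T m))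
    (hSb : ∀ i ≤ k, PolyBound fun m x => ‖iteratedFDeriv ℝ i (S m) x‖)
    (hTb : ∀ i ≤ k, PolyBound fun m x => ‖iteratedFDeriv ℝ i (T m) x‖) :
    PolyBound fun m x => ‖iteratedFDeriv ℝ k (fun x => L (S m x) (T m x)) x‖ := by
  refine ((PolyBound.const ‖L‖).mul (PolyBound.sum (s := Finset.range (k + 1)) fun i hi =>
    ((PolyBound.const (k.choose i : ℝ)).mul (hSb i (by simp at hi; omega))).mul
      (hTb (k - i) (by omega)))).mono fun m x => ?_
  rw [abs_norm]
  exact L.norm_iteratedFDeriv_le_of_bilinear (hS m) (hT m) x (by exact_mod_cast le_top)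

theorem Moderate.bilin (L : F →L[ℝ] G →L[ℝ] H) {S : ℕ → A → F} {T : ℕ → A → G}
    (hS : Moderate S) (hT : Moderate T) : Moderate fun m x => L (S m x) (T m x) :=
  ⟨fun m => (L.contDiff.comp (hS.1 m)).clm_apply (hT.1 m),
    fun k => polyBound_bilin L k hS.1 hT.1 (fun i _ => hS.2 i) fun i _ => hT.2 i⟩

theorem Moderate.mul {R : Type} [NormedRing R] [NormedAlgebra ℝ R] {S T : ℕ → A → R}
    (hS : Moderate S) (hT : Moderate T) : Moderate fun m x => S m x * T m x :=
  hS.bilin (ContinuousLinearMap.mul ℝ R) hT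

theorem Moderate.clm (L : F →L[ℝ] G) {S : ℕ → A → F} (hS : Moderate S) :
    Moderate fun m x => L (S m x) := by
  refine ⟨fun m => L.contDiff.comp (hS.1 m), fun k => ?_⟩
  refine ((PolyBound.const ‖L‖).mul (hS.2 k)).mono fun m x => ?_
  rw [abs_norm]
  exact L.norm_iteratedFDeriv_comp_left (hS.1 m).contDiffAt (by exact_mod_cast le_top)

theorem Moderate.add {S T : ℕ → A → F} (hS : Moderate S) (hT : Moderate T) :
    Moderate fun m x => S m x + T m x := by
  refine ⟨fun m => (hS.1 m).add (hT.1 m), fun k => ((hS.2 k).add (hT.2 k)).mono fun m x => ?_⟩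
  have hk : (k : WithTop ℕ∞) ≤ ∞ := by exact_mod_cast le_top
  rw [abs_norm]
  have := iteratedFDeriv_add_apply (𝕜 := ℝ) (x := x) (i := k) ((hS.1 m).of_le hk).contDiffAt
    ((hT.1 m).of_le hk).contDiffAt
  change ‖iteratedFDeriv ℝ k (S m + T m) x‖ ≤ _
  rw [this]
  exact norm_add_le _ _

theorem Moderate.sum {α : Type} {s : Finset α} {S : α → ℕ → A → F}
    (h : ∀ a ∈ s, Moderate (S a)) : Moderate fun m x => ∑ a ∈ s, S a m x := by
  classical
  induction s using Finset.induction_on with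
  | empty => simpa using moderate_const (A := A) (c := fun _ => (0 : F)) (by
      simpa using PolyBound.const (ι := A) 0)
  | insert a s ha ih =>
    simp only [Finset.sum_insert ha]
    exact (h a (by simp)).add (ih fun b hb => h b (by simp [hb]))

theorem Moderate.pow {R : Type} [NormedRing R] [NormedAlgebra ℝ R] {S : ℕ → A → R}
    (hS : Moderate S) (k : ℕ) : Moderate fun m x => S m x ^ k := by
  induction k with
  | zero =>
    simpa only [pow_zero] using moderate_const (A := A) (c := fun _ => (1 : R))
      (PolyBound.const _)
  | succ k ih => simpa only [pow_succ] using ih.mul hS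

theorem Moderate.inv {T : ℕ → A → ℝ} (hT : Moderate T) (hpos : ∀ m x, 0 < T m x)
    (hb : PolyBound fun m x => (T m x)⁻¹) : Moderate fun m x => (T m x)⁻¹ := by
  have hS : ∀ m, ContDiff ℝ ∞ fun x => (T m x)⁻¹ := fun m => (hT.1 m).inv fun x => (hpos m x).ne'
  refine ⟨hS, fun k => ?_⟩
  induction k using Nat.strong_induction_on with
  | _ k ih =>
    rcases k with _ | k
    · exact hb.mono fun m x => by
        rw [abs_norm, norm_iteratedFDeriv_zero, Real.norm_eq_abs, abs_of_pos (inv_pos.2 (hpos m x))]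
    · have hT' : ∀ m, ContDiff ℝ ∞ (fderiv ℝ (T m)) := fun m =>
        (hT.1 m).fderiv_right (m := ∞) (by simp)
      have hd : ∀ m, fderiv ℝ (fun x => (T m x)⁻¹) = fun x =>
          (-((T m x)⁻¹ * (T m x)⁻¹)) • fderiv ℝ (T m) x := by
        intro m
        funext x
        have := ((hasDerivAt_inv (hpos m x).ne').comp_hasFDerivAt x
          ((hT.1 m).differentiable (by simp) x).hasFDerivAt).fderiv
        rw [sq, mul_inv] at this
        exact this
      simp_rw [← norm_iteratedFDeriv_fderiv (n := k), hd]
      have h1 : ∀ i ≤ k, PolyBound fun m x =>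
          ‖iteratedFDeriv ℝ i (fun x => (T m x)⁻¹ * (T m x)⁻¹) x‖ := fun i hi =>
        polyBound_bilin (ContinuousLinearMap.mul ℝ ℝ) i hS hS (fun j hj => ih j (by omega))
          fun j hj => ih j (by omega)
      refine polyBound_bilin (-ContinuousLinearMap.lsmul ℝ ℝ) k (S := fun m x =>
        (T m x)⁻¹ * (T m x)⁻¹) (T := fun m => fderiv ℝ (T m)) (fun m => (hS m).mul (hS m)) hT' h1
        (fun i _ => ?_) |>.mono fun m x => ?_
      · simp_rw [norm_iteratedFDeriv_fderiv]
        exact hT.2 (i + 1)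
      · rw [abs_norm]
        refine le_of_eq ?_
        congr 2
        funext y
        simp

theorem Moderate.integral [FiniteDimensional ℝ A] {T : ℕ → ℝ × A → F} (hT : Moderate T)
    (a b : ℝ) : Moderate fun m x => ∫ t in a..b, T m (t, x) := by
  refine ⟨fun m => contDiff_paramIntegral (hT.1 m) a b, fun k => ?_⟩
  obtain ⟨C, N, hC, H⟩ := hT.2 k
  refine ⟨C * |b - a|, N, by positivity, fun m x => ?_⟩
  rw [abs_norm]
  refine (norm_iteratedFDeriv_paramIntegral_le a b k (hT.1 m) fun t _ y =>
    (le_abs_self _).trans (H m (t, y))) x |>.trans_eq (by ring)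

theorem bddDeriv_of_isCompact {g : A → F} (hg : ContDiff ℝ ∞ g) {K : Set A} (hK : IsCompact K)
    (M : ℝ) (h : ∀ x, (∃ c, ‖c‖ ≤ M ∧ g =ᶠ[𝓝 x] fun _ => c) ∨
      ∃ v, x + v ∈ K ∧ ∀ z, g (z + v) = g z) : BddDeriv g := by
  refine ⟨fun _ => hg, fun k => ?_⟩
  obtain ⟨C, hC⟩ := hK.exists_bound_of_continuousOn
    (hg.continuous_iteratedFDeriv (m := k) (by exact_mod_cast le_top)).continuousOn
  refine PolyBound.of_le (max M C) fun m x => ?_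
  rw [abs_norm]
  rcases h x with ⟨c, hc, hgc⟩ | ⟨v, hv, hgv⟩
  · rw [(hgc.iteratedFDeriv ℝ k).self_of_nhds]
    exact (norm_iteratedFDeriv_const_le k c x).trans (hc.trans (le_max_left _ _))
  · have h1 := iteratedFDeriv_comp_add_right (𝕜 := ℝ) (f := g) k v x
    simp_rw [hgv] at h1
    rw [h1]
    exact (hC _ hv).trans (le_max_right _ _)

theorem bddDeriv_smoothTransition : BddDeriv Real.smoothTransition := by
  refine bddDeriv_of_isCompact Real.smoothTransition.contDiff (isCompact_Icc (a := (0 : ℝ)) (b := 1))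
    1 fun x => ?_
  rcases lt_or_ge x 0 with h | h
  · refine Or.inl ⟨0, by simp, ?_⟩
    filter_upwards [Iio_mem_nhds h] with y hy
    exact Real.smoothTransition.zero_of_nonpos hy.le
  · rcases lt_or_ge 1 x with h' | h'
    · refine Or.inl ⟨1, by simp, ?_⟩
      filter_upwards [Ioi_mem_nhds h'] with y hy
      exact Real.smoothTransition.one_of_one_le hy.le
    · exact Or.inr ⟨0, by simpa using ⟨h, h'⟩, by simp⟩

theorem bddDeriv_of_hasCompactSupport {g : A → F} (hg : ContDiff ℝ ∞ g)
    (h : HasCompactSupport g) : BddDeriv g := by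
  refine bddDeriv_of_isCompact hg h.isCompact 0 fun x => ?_
  by_cases hx : x ∈ tsupport g
  · exact Or.inr ⟨0, by simpa using hx, by simp⟩
  · exact Or.inl ⟨0, by simp, notMem_tsupport_iff_eventuallyEq.1 hx⟩

theorem bddDeriv_of_periodic {g : ℝ → F} (hg : ContDiff ℝ ∞ g) {c : ℝ} (hc : 0 < c)
    (h : Function.Periodic g c) : BddDeriv g := by
  refine bddDeriv_of_isCompact hg (isCompact_Icc (a := (0 : ℝ)) (b := c)) 0 fun x => Or.inr ?_
  refine ⟨-(toIcoDiv hc 0 x • c), ?_, fun z => ?_⟩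
  · have := sub_toIcoDiv_zsmul_mem_Ico hc 0 x
    rw [← sub_eq_add_neg]
    exact ⟨this.1, by simpa using this.2.le⟩
  · rw [← sub_eq_add_neg]
    exact h.sub_zsmul_eq _

theorem BddDeriv.moderate {g : A → F} (h : BddDeriv g) : Moderate fun _ : ℕ => g := h

theorem BddDeriv.comp_clm {g : A → F} (h : BddDeriv g) (L : B →L[ℝ] A) :
    BddDeriv fun x => g (L x) :=
  Moderate.comp (T := fun _ x => L x) h (moderateDeriv_clm (PolyBound.const _))

theorem Moderate.comp_clm {g : ℕ → A → F} (h : Moderate g) (L : B →L[ℝ] A) :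
    Moderate fun m x => g m (L x) :=
  Moderate.comp (T := fun _ x => L x) h (moderateDeriv_clm (PolyBound.const _))

end Moderate

section Division

/-- If a monic polynomial of degree `d` and `d + 1` well separated radii are given, then the
polynomial is bounded below on one of the corresponding circles. -/
theorem exists_circle_le_norm_eval {q : Polynomial ℂ} (hq : q.Monic) {d : ℕ}
    (hd : q.natDegree = d) {δ : ℝ} (hδ : 0 < δ) {ρ : Fin (d + 1) → ℝ}
    (hρ : ∀ j j', j ≠ j' → 2 * δ ≤ |ρ j - ρ j'|) :
    ∃ j, ∀ z : ℂ, ‖z‖ = ρ j → δ ^ d ≤ ‖q.eval z‖ := by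
  have hcard : Multiset.card q.roots = d := by
    rw [← hd]
    exact Polynomial.splits_iff_card_roots.1 (IsAlgClosed.splits q)
  have h1 : ∃ j, ∀ r ∈ q.roots, δ ≤ |‖r‖ - ρ j| := by
    by_contra! hcon
    choose r hr hr' using hcon
    have hle : q.roots.toFinset.card < (Finset.univ : Finset (Fin (d + 1))).card := by
      rw [Finset.card_univ, Fintype.card_fin]
      exact Nat.lt_succ_of_le (hcard ▸ Multiset.toFinset_card_le _)
    obtain ⟨j, -, j', -, hne, heq⟩ := Finset.exists_ne_map_eq_of_card_lt_of_maps_to hle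
      (f := r) fun j _ => Multiset.mem_toFinset.2 (hr j)
    have h2 := hr' j
    have h3 := hr' j'
    rw [← heq] at h3
    have h4 := hρ j j' hne
    rw [abs_lt] at h2 h3
    rcases le_abs.1 h4 with h5 | h5 <;> linarith [h2.1, h2.2, h3.1, h3.2]
  obtain ⟨j, hj⟩ := h1
  refine ⟨j, fun z hz => ?_⟩
  rw [(IsAlgClosed.splits q).eval_eq_prod_roots_of_monic hq, ← hcard]
  have key : ∀ s : Multiset ℂ, (∀ r ∈ s, δ ≤ |‖r‖ - ρ j|) →
      δ ^ Multiset.card s ≤ ‖(s.map (z - ·)).prod‖ := by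
    intro s
    induction s using Multiset.induction_on with
    | empty => simp
    | cons a s ih =>
      intro hs
      rw [Multiset.card_cons, Multiset.map_cons, Multiset.prod_cons, norm_mul, pow_succ']
      refine mul_le_mul ?_ (ih fun r hr => hs r (Multiset.mem_cons_of_mem hr)) (by positivity)
        (norm_nonneg _)
      refine (hs a (Multiset.mem_cons_self a s)).trans ?_
      rw [← hz, norm_sub_rev]
      exact abs_norm_sub_norm_le a z
  exact key _ hj

/-- The extension of the sine in the variable `ζ = exp (i θ)`. -/
def sineMap (ζ : ℂ) : ℂ := (ζ - ζ⁻¹) / (2 * Complex.I)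

/-- The value of the monic polynomial with lower coefficients `b`. -/
def monicEval {n : ℕ} (b : Fin n → ℂ) (z : ℂ) : ℂ := z ^ n + ∑ i, b i * z ^ (i : ℕ)

/-- The coefficients of the difference quotient of `monicEval`. -/
def divCoeff {n : ℕ} (b : Fin n → ℂ) (i : Fin n) (z : ℂ) : ℂ :=
  z ^ (n - 1 - (i : ℕ)) + ∑ k : Fin n, if i < k then b k * z ^ ((k : ℕ) - 1 - (i : ℕ)) else 0

theorem sum_divCoeff_mul {n : ℕ} (b : Fin n → ℂ) (z t : ℂ) :
    (∑ i, divCoeff b i z * t ^ (i : ℕ)) * (z - t) = monicEval b z - monicEval b t := by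
  have hgeom : ∀ k : ℕ, (∑ i ∈ Finset.range k, z ^ (k - 1 - i) * t ^ i) * (z - t) = z ^ k - t ^ k := by
    intro k
    have := (Commute.all t z).geom_sum₂_mul k
    simp_rw [mul_comm (t ^ _)] at this
    linear_combination -this
  simp only [divCoeff, add_mul, Finset.sum_add_distrib, monicEval]
  have h1 := Fin.sum_univ_eq_sum_range (fun i => z ^ (n - 1 - i) * t ^ i) n
  rw [h1, hgeom]
  have h2 : ∑ i : Fin n, (∑ k : Fin n, if i < k then b k * z ^ ((k : ℕ) - 1 - (i : ℕ)) else 0) *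
      t ^ (i : ℕ) = ∑ k : Fin n, b k * ∑ i ∈ Finset.range k, z ^ ((k : ℕ) - 1 - i) * t ^ i := by
    simp_rw [Finset.sum_mul]
    rw [Finset.sum_comm]
    refine Finset.sum_congr rfl fun k _ => ?_
    rw [Finset.mul_sum]
    have h3 := Fin.sum_univ_eq_sum_range
      (fun i => if i < (k : ℕ) then b k * (z ^ ((k : ℕ) - 1 - i) * t ^ i) else 0) n
    calc _ = ∑ i : Fin n, if (i : ℕ) < (k : ℕ) then
          b k * (z ^ ((k : ℕ) - 1 - i) * t ^ (i : ℕ)) else 0 := by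
          refine Finset.sum_congr rfl fun i _ => ?_
          simp only [Fin.lt_def]
          split_ifs <;> ring
      _ = _ := by
          rw [h3, ← Finset.sum_filter]
          refine Finset.sum_congr ?_ fun _ _ => rfl
          ext i
          simp only [Finset.mem_filter, Finset.mem_range]
          have := k.2
          omega
  rw [h2, Finset.sum_mul]
  simp_rw [mul_assoc, hgeom, mul_sub, Finset.sum_sub_distrib]
  ring

theorem exists_polynomial_monicEval_sineMap {n : ℕ} (b : Fin n → ℂ) :
    ∃ q : Polynomial ℂ, q.Monic ∧ q.natDegree = 2 * n ∧
      ∀ ζ : ℂ, ζ ≠ 0 → q.eval ζ = (2 * Complex.I * ζ) ^ n * monicEval b (sineMap ζ) := by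
  open Polynomial in
  have hm : ((X : ℂ[X]) ^ 2 - 1).Monic := by
    have := monic_X_pow_sub_C (1 : ℂ) two_ne_zero
    simpa using this
  have hdeg : ((X : ℂ[X]) ^ 2 - 1).natDegree = 2 := by
    have := natDegree_X_pow_sub_C (n := 2) (r := (1 : ℂ))
    simpa using this
  have hm' : (((X : ℂ[X]) ^ 2 - 1) ^ n).Monic := hm.pow n
  have hdeg' : (((X : ℂ[X]) ^ 2 - 1) ^ n).natDegree = 2 * n := by
    rw [hm.natDegree_pow, hdeg, mul_comm]
  set r : ℂ[X] := ∑ i : Fin n,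
    C (b i) * (((X : ℂ[X]) ^ 2 - 1) ^ (i : ℕ) * (C (2 * Complex.I) * X) ^ (n - (i : ℕ))) with hr
  have hrdeg : r.degree < (((X : ℂ[X]) ^ 2 - 1) ^ n).degree := by
    rw [degree_eq_natDegree hm'.ne_zero, hdeg']
    refine (degree_sum_le _ _).trans_lt ?_
    rw [Finset.sup_lt_iff (by exact_mod_cast WithBot.bot_lt_coe (2 * n))]
    intro i _
    refine lt_of_le_of_lt (degree_le_natDegree) ?_
    norm_cast
    have h1 : (((X : ℂ[X]) ^ 2 - 1) ^ (i : ℕ)).natDegree ≤ 2 * (i : ℕ) := by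
      rw [hm.natDegree_pow, hdeg, mul_comm]
    have h2 : ((C (2 * Complex.I) * (X : ℂ[X])) ^ (n - (i : ℕ))).natDegree ≤ n - (i : ℕ) := by
      refine natDegree_pow_le.trans ?_
      have : (C (2 * Complex.I) * (X : ℂ[X])).natDegree ≤ 1 := (natDegree_C_mul_le _ _).trans natDegree_X_le
      nlinarith
    have h3 := (natDegree_C_mul_le (b i) (((X : ℂ[X]) ^ 2 - 1) ^ (i : ℕ) *
      (C (2 * Complex.I) * X) ^ (n - (i : ℕ)))).trans (natDegree_mul_le_of_le h1 h2)
    have := i.2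
    omega
  refine ⟨((X : ℂ[X]) ^ 2 - 1) ^ n + r, hm'.add_of_left hrdeg, ?_, fun ζ hζ => ?_⟩
  · rw [natDegree_add_eq_left_of_degree_lt hrdeg, hdeg']
  · have hI : Complex.I ≠ 0 := Complex.I_ne_zero
    have hs : ζ ^ 2 - 1 = 2 * Complex.I * ζ * sineMap ζ := by
      rw [sineMap]
      field_simp
    simp only [eval_add, eval_pow, eval_sub, eval_X, eval_one, hr, eval_finsetSum, eval_mul,
      eval_C, monicEval, mul_add, Finset.mul_sum]
    rw [hs]
    congr 1
    · ring
    · refine Finset.sum_congr rfl fun i _ => ?_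
      have : (2 * Complex.I * ζ) ^ n = (2 * Complex.I * ζ) ^ (i : ℕ) *
          (2 * Complex.I * ζ) ^ (n - (i : ℕ)) := by
        rw [← pow_add]
        congr 1
        have := i.2
        omega
      rw [this]
      ring

/-- Cauchy's formula for the logarithmic derivative of `sineMap - sineMap ζ0`. -/
theorem integral_sineMap_residue {ρ : ℝ} (hρ : 1 < ρ) {ζ0 : ℂ} (h0 : ‖ζ0‖ = 1) (M : ℕ) :
    ∫ σ in (0 : ℝ)..2 * π, circleMap 0 ρ σ ^ (M + 1) *
      ((circleMap 0 ρ σ + (circleMap 0 ρ σ)⁻¹) / (2 * Complex.I)) *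
        (sineMap (circleMap 0 ρ σ) - sineMap ζ0)⁻¹ =
      2 * π * (ζ0 ^ (M + 1) + (-ζ0⁻¹) ^ (M + 1)) := by
  have hI : Complex.I ≠ 0 := Complex.I_ne_zero
  have hζ0 : ζ0 ≠ 0 := by
    rintro rfl
    simp at h0
  have hcauchy : ∀ (w : ℂ) (N : ℕ), ‖w‖ ≤ 1 →
      ∮ z in C(0, ρ), (z - w)⁻¹ • z ^ N = (2 * π * Complex.I) • w ^ N := fun w N hw =>
    DiffContOnCl.circleIntegral_sub_inv_smul (Differentiable.diffContOnCl (by fun_prop))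
      (by simpa using hw.trans_lt hρ)
  have hcirc : ∀ (w : ℂ) (N : ℕ), ‖w‖ ≤ 1 →
      CircleIntegrable (fun z => (z - w)⁻¹ • z ^ N) 0 ρ := by
    intro w N hw
    refine ContinuousOn.circleIntegrable (by linarith) ?_
    have hne : ∀ z ∈ Metric.sphere (0 : ℂ) ρ, z - w ≠ 0 := ?_
    · exact ContinuousOn.smul (f := fun z : ℂ => (z - w)⁻¹) (g := fun z : ℂ => z ^ N)
        (ContinuousOn.inv₀ (f := fun z : ℂ => z - w) (by fun_prop) hne) (by fun_prop)
    intro z hz h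
    rw [sub_eq_zero] at h
    subst h
    have : ‖z‖ = ρ := by simpa using hz
    linarith
  have h1 := hcauchy ζ0 (M + 1) h0.le
  have h2 := hcauchy (-ζ0⁻¹) (M + 1) (by simp [h0])
  have h3 := hcauchy 0 (M + 1) (by simp)
  have i1 := hcirc ζ0 (M + 1) h0.le
  have i2 := hcirc (-ζ0⁻¹) (M + 1) (by simp [h0])
  have i3 := hcirc 0 (M + 1) (by simp)
  have h4 := circleIntegral.integral_sub (i1.add i2) i3
  have h5 := circleIntegral.integral_add i1 i2
  simp only [Pi.add_apply] at h4
  rw [h5, h1, h2, h3] at h4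
  simp only [circleIntegral] at h4
  have h6 : ∀ σ : ℝ, deriv (circleMap 0 ρ) σ • ((circleMap 0 ρ σ - ζ0)⁻¹ •
      circleMap 0 ρ σ ^ (M + 1) + (circleMap 0 ρ σ - -ζ0⁻¹)⁻¹ • circleMap 0 ρ σ ^ (M + 1) -
      (circleMap 0 ρ σ - 0)⁻¹ • circleMap 0 ρ σ ^ (M + 1)) = Complex.I * (circleMap 0 ρ σ ^ (M + 1) *
      ((circleMap 0 ρ σ + (circleMap 0 ρ σ)⁻¹) / (2 * Complex.I)) *
        (sineMap (circleMap 0 ρ σ) - sineMap ζ0)⁻¹) := by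
    intro σ
    have hz : ‖circleMap 0 ρ σ‖ = ρ := by simp [abs_of_pos (zero_lt_one.trans hρ)]
    rw [deriv_circleMap]
    set z := circleMap 0 ρ σ
    have hz0 : z ≠ 0 := by
      rintro h
      rw [h] at hz
      simp at hz
      linarith
    have e1 : z - ζ0 ≠ 0 := by
      intro h
      rw [sub_eq_zero.1 h] at hz
      linarith
    have e2 : z * ζ0 + 1 ≠ 0 := by
      intro h
      have : ‖z * ζ0‖ = 1 := by rw [eq_neg_of_add_eq_zero_left h]; simp
      rw [norm_mul, hz, h0] at this
      linarith
    have e3 : z - -ζ0⁻¹ = (z * ζ0 + 1) / ζ0 := by field_simp; ring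
    have e4 : sineMap z - sineMap ζ0 = (z - ζ0) * (z * ζ0 + 1) / (2 * Complex.I * z * ζ0) := by
      simp only [sineMap]
      field_simp
      ring
    rw [e3, e4, sub_zero]
    simp only [smul_eq_mul]
    field_simp
    ring
  simp_rw [h6] at h4
  rw [intervalIntegral.integral_const_mul] at h4
  refine mul_left_cancel₀ hI (h4.trans ?_)
  simp
  ring

end Division

section ModerateWeights

variable {A F : Type} [NormedAddCommGroup A] [NormedSpace ℝ A] [NormedAddCommGroup F]
  [NormedSpace ℝ F]

theorem PolyBound.moderate_const {c : ℕ → ℝ} (h : PolyBound fun m (_ : Unit) => c m) :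
    Moderate fun m (_ : A) => c m := by
  obtain ⟨C, N, hC, H⟩ := h
  exact _root_.moderate_const ⟨C, N, hC, fun m _ => by simpa using H m ()⟩

theorem moderate_const' (c : F) : Moderate fun (_ : ℕ) (_ : A) => c :=
  _root_.moderate_const (PolyBound.const _)

theorem Moderate.const_mul {T : ℕ → A → ℝ} (hT : Moderate T) {c : ℕ → ℝ}
    (h : PolyBound fun m (_ : Unit) => c m) : Moderate fun m x => c m * T m x :=
  Moderate.mul (PolyBound.moderate_const h) hT

/-- A smooth cutoff of a moderate family, equal to `1` where `c * T ≤ e` and vanishing where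
`c * T ≥ e + 1`. -/
theorem Moderate.cutoff {T : ℕ → A → ℝ} (hT : Moderate T) {c : ℕ → ℝ}
    (h : PolyBound fun m (_ : Unit) => c m) (e : ℝ) :
    Moderate fun m x => 1 - Real.smoothTransition (c m * T m x - e) := by
  have h1 : Moderate fun m x => c m * T m x + -e := (hT.const_mul h).add (moderate_const' _)
  have h2 := (Moderate.comp bddDeriv_smoothTransition h1.moderateDeriv).const_mul
    (PolyBound.const (-1))
  have h3 := (moderate_const' (A := A) (1 : ℝ)).add h2
  simpa only [sub_eq_add_neg, neg_mul, one_mul] using h3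

theorem Moderate.exists_lipschitz {T : ℕ → A → ℝ} (hT : Moderate T) :
    ∃ L : ℕ → ℝ, PolyBound (fun m (_ : Unit) => L m) ∧ (∀ m, 1 ≤ L m) ∧
      ∀ m x y, |T m x - T m y| ≤ L m * ‖x - y‖ := by
  obtain ⟨C, N, hC, H⟩ := hT.2 1
  have hL : ∀ m : ℕ, (0 : ℝ) ≤ C * ((m : ℝ) + 1) ^ N := fun m => by positivity
  refine ⟨fun m => C * ((m : ℝ) + 1) ^ N + 1, ?_, fun m => by linarith [hL m], fun m x y => ?_⟩
  · exact (((PolyBound.const C).mul (PolyBound.nat.pow N))).add (PolyBound.const 1)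
  · rw [← Real.norm_eq_abs]
    refine Convex.norm_image_sub_le_of_norm_fderiv_le (𝕜 := ℝ) (s := Set.univ) (fun z _ =>
      ((hT.1 m).differentiable (by simp)).differentiableAt) (fun z _ => ?_) convex_univ
      (Set.mem_univ _) (Set.mem_univ _)
    have := H m z
    rw [abs_norm, ← norm_iteratedFDeriv_fderiv, norm_iteratedFDeriv_zero] at this
    linarith

theorem exists_weights_of_lower_bound [FiniteDimensional ℝ A] {ι : Type} [Fintype ι]
    {P : ι → ℕ → ℝ × A → ℂ} (hP : ∀ j, Moderate (P j)) {ε : ℕ → ℝ} (hε : ∀ m, 0 < ε m)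
    (hε' : PolyBound fun m (_ : Unit) => (ε m)⁻¹)
    (hlow : ∀ m a, ∃ j, ∀ σ, ε m ≤ ‖P j m (σ, a)‖) :
    ∃ (w : ι → ℕ → A → ℝ) (V : ι → ℕ → ℝ × A → ℂ), (∀ j, Moderate (w j)) ∧
      (∀ j, Moderate (V j)) ∧ (∀ m a, ∑ j, w j m a = 1) ∧
      ∀ j m a, w j m a ≠ 0 → ∀ σ ∈ Set.Icc 0 (2 * π),
        P j m (σ, a) ≠ 0 ∧ V j m (σ, a) = (P j m (σ, a))⁻¹ := by
  have hpi := Real.pi_gt_three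
  have hεi : ∀ m, 0 < (ε m)⁻¹ := fun m => inv_pos.2 (hε m)
  set q : ι → ℕ → ℝ × A → ℝ := fun j m x => (ε m)⁻¹ ^ 2 *
    (Complex.reCLM (P j m x) ^ 2 + Complex.imCLM (P j m x) ^ 2) with hq
  have hqn : ∀ j m x, q j m x = ((ε m)⁻¹ * ‖P j m x‖) ^ 2 := fun j m x => by
    rw [mul_pow, Complex.sq_norm, Complex.normSq_apply]
    simp only [hq, Complex.reCLM_apply, Complex.imCLM_apply]
    ring
  have hqm : ∀ j, Moderate (q j) := fun j =>
    ((((hP j).clm Complex.reCLM).pow 2).add (((hP j).clm Complex.imCLM).pow 2)).const_mul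
      (hε'.pow 2)
  have hq0 : ∀ j m x, 0 ≤ q j m x := fun j m x => by rw [hqn]; positivity
  choose L hL hL1 hLip using fun j => (hqm j).exists_lipschitz
  set χ : ι → ℕ → ℝ × A → ℝ := fun j m x => 1 - Real.smoothTransition (2 * q j m x - 1) with hχ
  have hχm : ∀ j, Moderate (χ j) := fun j => (hqm j).cutoff (PolyBound.const 2) 1
  have hχ0 : ∀ j m x, 0 ≤ χ j m x := fun j m x =>
    sub_nonneg.2 (Real.smoothTransition.le_one _)
  set I : ι → ℕ → A → ℝ := fun j m a => ∫ σ in (0 : ℝ)..4 * π, χ j m (σ, a) with hI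
  have hIm : ∀ j, Moderate (I j) := fun j => (hχm j).integral 0 (4 * π)
  set W : ι → ℕ → A → ℝ := fun j m a => 1 - Real.smoothTransition (4 * L j m * I j m a - 0)
    with hW
  have hWm : ∀ j, Moderate (W j) := fun j =>
    (hIm j).cutoff (c := fun m => 4 * L j m) ((PolyBound.const 4).mul (hL j)) 0
  have hW0 : ∀ j m a, 0 ≤ W j m a := fun j m a =>
    sub_nonneg.2 (Real.smoothTransition.le_one _)
  have hWne : ∀ j m a, W j m a ≠ 0 → ∀ σ ∈ Set.Icc 0 (2 * π), 1 / 4 < q j m (σ, a) := by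
    intro j m a hne σ hσ
    by_contra! hle
    apply hne
    have hL0 : 0 < L j m := zero_lt_one.trans_le (hL1 j m)
    have hlen : 1 / (4 * L j m) ≤ 1 := by
      rw [div_le_one (by positivity)]
      linarith [hL1 j m]
    have hlen0 : 0 < 1 / (4 * L j m) := by positivity
    have hone : ∀ τ ∈ Set.Icc σ (σ + 1 / (4 * L j m)), χ j m (τ, a) = 1 := by
      intro τ hτ
      have h1 := hLip j m (τ, a) (σ, a)
      have h2 : ‖((τ, a) : ℝ × A) - (σ, a)‖ = τ - σ := by
        rw [Prod.mk_sub_mk, sub_self, Prod.norm_mk, norm_zero, max_eq_left (norm_nonneg _),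
          Real.norm_eq_abs, abs_of_nonneg (by linarith [hτ.1])]
      rw [h2] at h1
      have h3 : L j m * (τ - σ) ≤ L j m * (1 / (4 * L j m)) :=
        mul_le_mul_of_nonneg_left (by linarith [hτ.2]) hL0.le
      have h4 : L j m * (1 / (4 * L j m)) = 1 / 4 := by field_simp
      have h5 := (abs_le.1 h1).2
      simp only [hχ]
      rw [Real.smoothTransition.zero_of_nonpos (by linarith), sub_zero]
    have hcont : Continuous fun σ : ℝ => χ j m (σ, a) :=
      ((hχm j).1 m).continuous.comp (by fun_prop)
    have hIge : 1 / (4 * L j m) ≤ I j m a := by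
      calc 1 / (4 * L j m) = ∫ τ in σ..σ + 1 / (4 * L j m), χ j m (τ, a) := by
            rw [intervalIntegral.integral_congr (g := fun _ => (1 : ℝ))]
            · simp
            · intro τ hτ
              rw [Set.uIcc_of_le (by linarith)] at hτ
              exact hone τ hτ
        _ ≤ I j m a := by
            refine intervalIntegral.integral_mono_interval hσ.1 (by linarith)
              (by linarith [hσ.2]) (Eventually.of_forall fun τ => hχ0 j m _)
              (hcont.intervalIntegrable _ _)
    have : 1 ≤ 4 * L j m * I j m a - 0 := by
      have := mul_le_mul_of_nonneg_left hIge (by positivity : 0 ≤ 4 * L j m)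
      rw [mul_one_div_cancel (by positivity)] at this
      linarith
    simp only [hW]
    rw [Real.smoothTransition.one_of_one_le this, sub_self]
  have hWone : ∀ m a, ∃ j, W j m a = 1 := by
    intro m a
    obtain ⟨j, hj⟩ := hlow m a
    refine ⟨j, ?_⟩
    have h1 : ∀ σ, χ j m (σ, a) = 0 := fun σ => by
      have : 1 ≤ q j m (σ, a) := by
        rw [hqn]
        refine one_le_pow₀ ?_
        rw [inv_mul_eq_div, one_le_div (hε m)]
        exact hj σ
      simp only [hχ]
      rw [Real.smoothTransition.one_of_one_le (by linarith), sub_self]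
    simp only [hW, hI, h1]
    simp
  set S : ℕ → A → ℝ := fun m a => ∑ j, W j m a with hS
  have hS1 : ∀ m a, 1 ≤ S m a := fun m a => by
    obtain ⟨j, hj⟩ := hWone m a
    rw [← hj]
    exact Finset.single_le_sum (f := fun j => W j m a) (fun j _ => hW0 j m a) (Finset.mem_univ j)
  have hSm : Moderate fun m a => (S m a)⁻¹ :=
    (Moderate.sum fun j _ => hWm j).inv (fun m a => zero_lt_one.trans_le (hS1 m a))
      (PolyBound.of_le 1 fun m a => by
        have := hS1 m a
        have h0 : 0 < S m a := by linarith
        change |(S m a)⁻¹| ≤ 1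
        rw [abs_of_pos (inv_pos.2 h0)]
        exact inv_le_one_of_one_le₀ this)
  set D : ι → ℕ → ℝ × A → ℝ := fun j m x =>
    q j m x + (1 - Real.smoothTransition (8 * q j m x - 1)) with hD
  have hD8 : ∀ j m x, 1 / 8 ≤ D j m x := by
    intro j m x
    have h1 := Real.smoothTransition.le_one (8 * q j m x - 1)
    rcases le_or_gt (1 / 8) (q j m x) with h | h
    · simp only [hD]
      linarith
    · simp only [hD]
      rw [Real.smoothTransition.zero_of_nonpos (by linarith)]
      linarith [hq0 j m x]
  have hDm : ∀ j, Moderate fun m x => (D j m x)⁻¹ := fun j =>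
    ((hqm j).add ((hqm j).cutoff (PolyBound.const 8) 1)).inv
      (fun m x => lt_of_lt_of_le (by norm_num) (hD8 j m x))
      (PolyBound.of_le 8 fun m x => by
        have h0 : 0 < D j m x := lt_of_lt_of_le (by norm_num) (hD8 j m x)
        change |(D j m x)⁻¹| ≤ 8
        rw [abs_of_pos (inv_pos.2 h0)]
        exact inv_le_of_inv_le₀ (by norm_num) (by linarith [hD8 j m x]))
  refine ⟨fun j m a => W j m a * (S m a)⁻¹,
    fun j m x => (((ε m)⁻¹ ^ 2 * (D j m x)⁻¹ : ℝ) : ℂ) * (starRingEnd ℂ) (P j m x),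
    fun j => (hWm j).mul hSm, fun j => ?_, fun m a => ?_, fun j m a hne σ hσ => ?_⟩
  · exact (((hDm j).const_mul (hε'.pow 2)).clm Complex.ofRealCLM).mul
      ((hP j).clm Complex.conjCLE.toContinuousLinearMap)
  · rw [← Finset.sum_mul]
    exact mul_inv_cancel₀ (zero_lt_one.trans_le (hS1 m a)).ne'
  · have h1 := hWne j m a (left_ne_zero_of_mul hne) σ hσ
    have h2 : D j m (σ, a) = q j m (σ, a) := by
      simp only [hD]
      rw [Real.smoothTransition.one_of_one_le (by linarith)]
      ring
    have h3 : (0 : ℝ) < ‖P j m (σ, a)‖ ^ 2 := by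
      rw [hqn, mul_pow] at h1
      have h4 : 0 < (ε m)⁻¹ ^ 2 := by have := hεi m; positivity
      by_contra! h5
      nlinarith
    have h4 : (ε m)⁻¹ ^ 2 * (D j m (σ, a))⁻¹ = (‖P j m (σ, a)‖ ^ 2)⁻¹ := by
      rw [h2, hqn]
      have := (hε m).ne'
      have h5 := h3.ne'
      field_simp
    refine ⟨fun h0 => by simp [h0] at h3, ?_⟩
    simp only [h4]
    rw [Complex.inv_def, Complex.sq_norm, mul_comm]

end ModerateWeights

section Remainders

theorem exists_bddDeriv_eq_id : ∃ ψ : ℝ → ℝ, BddDeriv ψ ∧ ∀ y, |y| ≤ 1 → ψ y = y := by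
  let f : ContDiffBump (0 : ℝ) := ⟨1, 2, one_pos, one_lt_two⟩
  refine ⟨fun y => f y * y, bddDeriv_of_hasCompactSupport (f.contDiff.mul contDiff_id)
    f.hasCompactSupport.mul_right, fun y hy => ?_⟩
  simp only
  rw [f.one_of_mem_closedBall (by simpa using hy), one_mul]

theorem bddDeriv_exp_mul_I : BddDeriv fun σ : ℝ => Complex.exp (σ * Complex.I) := by
  refine bddDeriv_of_periodic ?_ Real.two_pi_pos fun σ => ?_
  · exact (Complex.ofRealCLM.contDiff.mul contDiff_const).cexp
  · push_cast
    exact Complex.exp_mul_I_periodic σ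

variable {A : Type} [NormedAddCommGroup A] [NormedSpace ℝ A]

theorem moderate_exp_mul_I {c : ℕ → ℝ} (hc : PolyBound fun m (_ : Unit) => c m) :
    Moderate fun m (x : ℝ × A) => Complex.exp ((c m * x.1 : ℝ) * Complex.I) := by
  refine Moderate.comp (T := fun m (x : ℝ × A) => c m * x.1) bddDeriv_exp_mul_I
    (moderateDeriv_clm (L := fun m => c m • ContinuousLinearMap.fst ℝ ℝ A) ?_)
  refine (((hc.mul hc).add (PolyBound.const 1)).comp fun _ (_ : ℝ × A) => ()).mono fun m x => ?_
  rw [abs_norm, norm_smul, Real.norm_eq_abs]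
  have h1 := ContinuousLinearMap.norm_fst_le ℝ ℝ A
  have h2 := mul_le_mul_of_nonneg_left h1 (abs_nonneg (c m))
  have h3 := abs_mul_abs_self (c m)
  nlinarith [sq_nonneg (|c m| - 1)]

theorem Moderate.sub_const_smul {T S : ℕ → A → ℂ} (hT : Moderate T) (hS : Moderate S) (c e : ℂ) :
    Moderate fun m x => (T m x + c * S m x) / e := by
  have := (hT.add ((moderate_const' c).mul hS)).mul (moderate_const' e⁻¹)
  simpa only [div_eq_mul_inv] using this

theorem Moderate.monicEval {n : ℕ} {b : Fin n → ℕ → A → ℂ} (hb : ∀ i, Moderate (b i))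
    {z : ℕ → A → ℂ} (hz : Moderate z) :
    Moderate fun m x => monicEval (fun i => b i m x) (z m x) :=
  (hz.pow n).add (Moderate.sum fun i _ => (hb i).mul (hz.pow i))

theorem Moderate.divCoeff {n : ℕ} {b : Fin n → ℕ → A → ℂ} (hb : ∀ i, Moderate (b i))
    {z : ℕ → A → ℂ} (hz : Moderate z) (i : Fin n) :
    Moderate fun m x => divCoeff (fun i => b i m x) i (z m x) := by
  refine (hz.pow _).add (Moderate.sum fun k _ => ?_)
  by_cases h : i < k
  · simpa only [if_pos h] using (hb k).mul (hz.pow _)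
  · simpa only [if_neg h] using moderate_const' (A := A) (0 : ℂ)

theorem exists_moderate_remainder (n : ℕ) : ∃ R : Fin n → ℕ → (Fin n → ℝ) → ℂ,
    (∀ i, Moderate (R i)) ∧ ∀ m (a : Fin n → ℝ), (∀ i, |a i| ≤ 1) → ∀ (t : ℝ) (ζ : ℂ),
      ‖ζ‖ = 1 → sineMap ζ = t → t ^ n + ∑ i, a i * t ^ (i : ℕ) = 0 →
        ∑ i, R i m a * (t : ℂ) ^ (i : ℕ) = ζ ^ (m + 1) + (-ζ⁻¹) ^ (m + 1) := by
  obtain ⟨ψ, hψ, hψ1⟩ := exists_bddDeriv_eq_id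
  have hI : Complex.I ≠ 0 := Complex.I_ne_zero
  set d : ℕ := 2 * n with hd
  set b : Fin n → (Fin n → ℝ) → ℂ := fun i a => (ψ (a i) : ℂ) with hb
  have hbm : ∀ i, Moderate fun (_ : ℕ) (x : ℝ × (Fin n → ℝ)) => b i x.2 := fun i =>
    ((hψ.comp_clm ((ContinuousLinearMap.proj i).comp
      (ContinuousLinearMap.snd ℝ ℝ (Fin n → ℝ)))).moderate).clm Complex.ofRealCLM
  set ρ : ℕ → Fin (d + 1) → ℝ := fun m j => 1 + (1 + (j : ℝ) / (d + 1)) / (m + 1) with hρ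
  have hfrac : ∀ j : Fin (d + 1), 0 ≤ (j : ℝ) / (d + 1) ∧ (j : ℝ) / (d + 1) ≤ 1 := fun j => by
    refine ⟨by positivity, ?_⟩
    rw [div_le_one (by positivity)]
    have := j.2
    exact_mod_cast this.le
  have hρ1 : ∀ m j, 1 < ρ m j := fun m j => by
    have := (hfrac j).1
    simp only [hρ]
    have : (0 : ℝ) < (1 + (j : ℝ) / (d + 1)) / (m + 1) := by positivity
    linarith
  have hρle : ∀ m j, ρ m j ≤ 1 + 2 / (m + 1) := fun m j => by
    simp only [hρ]
    gcongr
    linarith [(hfrac j).2]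
  have hρ3 : ∀ m j, ρ m j ≤ 3 := fun m j => by
    refine (hρle m j).trans ?_
    have : (2 : ℝ) / (m + 1) ≤ 2 := by
      rw [div_le_iff₀ (by positivity)]
      have : (0 : ℝ) ≤ m := by positivity
      linarith
    linarith
  have hρpow : ∀ m j, ρ m j ^ (m + 1) ≤ Real.exp 2 := fun m j => by
    have h1 : ρ m j ≤ Real.exp (2 / (m + 1)) := by
      have := Real.add_one_le_exp ((2 : ℝ) / (m + 1))
      linarith [hρle m j]
    refine (pow_le_pow_left₀ (zero_lt_one.trans (hρ1 m j)).le h1 _).trans_eq ?_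
    rw [← Real.exp_nat_mul]
    congr 1
    push_cast
    field_simp
  set δ : ℕ → ℝ := fun m => 1 / (2 * (d + 1) * (m + 1)) with hδ
  have hδ0 : ∀ m, 0 < δ m := fun m => by simp only [hδ]; positivity
  have hsep : ∀ m j j', j ≠ j' → 2 * δ m ≤ |ρ m j - ρ m j'| := by
    intro m j j' hne
    have h1 : ρ m j - ρ m j' = ((j : ℝ) - j') * (2 * δ m) := by
      simp only [hρ, hδ]
      field_simp
      ring
    have h2 : (1 : ℝ) ≤ |(j : ℝ) - j'| := by
      have : (1 : ℤ) ≤ |((j : ℕ) : ℤ) - ((j' : ℕ) : ℤ)| := by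
        refine Int.one_le_abs ?_
        rw [sub_ne_zero]
        exact_mod_cast fun h => hne (Fin.ext h)
      exact_mod_cast this
    rw [h1, abs_mul, abs_of_pos (by linarith [hδ0 m] : 0 < 2 * δ m)]
    nlinarith [hδ0 m]
  set ε : ℕ → ℝ := fun m => δ m ^ d / 6 ^ n with hε
  have hε0 : ∀ m, 0 < ε m := fun m => by have := hδ0 m; simp only [hε]; positivity
  have hεinv : PolyBound fun m (_ : Unit) => (ε m)⁻¹ := by
    refine ((PolyBound.const (6 ^ n : ℝ)).mul
      (((PolyBound.const (2 * ((d : ℝ) + 1))).mul PolyBound.nat).pow d)).mono fun m _ => ?_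
    rw [abs_of_pos (inv_pos.2 (hε0 m))]
    simp only [hε, hδ]
    rw [one_div, inv_div, inv_pow, div_inv_eq_mul]
  set Z : Fin (d + 1) → ℕ → ℝ × (Fin n → ℝ) → ℂ := fun j m x => circleMap 0 (ρ m j) x.1 with hZ
  have hZeq : ∀ j m x, Z j m x = (ρ m j : ℂ) * Complex.exp (((1 : ℝ) * x.1 : ℝ) * Complex.I) :=
    fun j m x => by simp [hZ, circleMap]
  have hZpow : ∀ j m x, Z j m x ^ (m + 1) = ((ρ m j ^ (m + 1) : ℝ) : ℂ) *
      Complex.exp ((((m : ℝ) + 1) * x.1 : ℝ) * Complex.I) := fun j m x => by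
    rw [hZeq, mul_pow, ← Complex.exp_nat_mul]
    push_cast
    ring_nf
  have hZinv : ∀ j m x, (Z j m x)⁻¹ = (((ρ m j)⁻¹ : ℝ) : ℂ) *
      Complex.exp ((-1 * x.1 : ℝ) * Complex.I) := fun j m x => by
    rw [hZeq, mul_inv, ← Complex.exp_neg]
    push_cast
    ring_nf
  have hZm : ∀ j, Moderate (Z j) := fun j => by
    have h1 : Moderate fun m (_ : ℝ × (Fin n → ℝ)) => ρ m j :=
      PolyBound.moderate_const (PolyBound.of_le 3 fun m _ => by
        rw [abs_of_pos (zero_lt_one.trans (hρ1 m j))]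
        exact hρ3 m j)
    have := (h1.clm Complex.ofRealCLM).mul (moderate_exp_mul_I (A := Fin n → ℝ)
      (PolyBound.const 1))
    simpa only [Complex.ofRealCLM_apply, ← hZeq] using this
  have hZinvm : ∀ j, Moderate fun m x => (Z j m x)⁻¹ := fun j => by
    have h1 : Moderate fun m (_ : ℝ × (Fin n → ℝ)) => (ρ m j)⁻¹ :=
      PolyBound.moderate_const (PolyBound.of_le 1 fun m _ => by
        rw [abs_of_pos (inv_pos.2 (zero_lt_one.trans (hρ1 m j)))]
        exact inv_le_one_of_one_le₀ (hρ1 m j).le)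
    have := (h1.clm Complex.ofRealCLM).mul (moderate_exp_mul_I (A := Fin n → ℝ)
      (PolyBound.const (-1)))
    simpa only [Complex.ofRealCLM_apply, ← hZinv] using this
  have hZpowm : ∀ j, Moderate fun m x => Z j m x ^ (m + 1) := fun j => by
    have h1 : Moderate fun m (_ : ℝ × (Fin n → ℝ)) => ρ m j ^ (m + 1) :=
      PolyBound.moderate_const (PolyBound.of_le (Real.exp 2) fun m _ => by
        rw [abs_of_pos (pow_pos (zero_lt_one.trans (hρ1 m j)) _)]
        exact hρpow m j)
    have := (h1.clm Complex.ofRealCLM).mul (moderate_exp_mul_I (A := Fin n → ℝ)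
      PolyBound.nat)
    simpa only [Complex.ofRealCLM_apply, ← hZpow] using this
  have hsm : ∀ j, Moderate fun m x => sineMap (Z j m x) := fun j => by
    have := (hZm j).sub_const_smul (hZinvm j) (-1) (2 * Complex.I)
    simpa only [sineMap, neg_mul, one_mul, ← sub_eq_add_neg] using this
  have hcm : ∀ j, Moderate fun m x => (Z j m x + (Z j m x)⁻¹) / (2 * Complex.I) := fun j => by
    have := (hZm j).sub_const_smul (hZinvm j) 1 (2 * Complex.I)
    simpa only [one_mul] using this
  set P : Fin (d + 1) → ℕ → ℝ × (Fin n → ℝ) → ℂ := fun j m x =>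
    monicEval (fun i => b i x.2) (sineMap (Z j m x)) with hP
  have hPm : ∀ j, Moderate (P j) := fun j => Moderate.monicEval hbm (hsm j)
  have hlow : ∀ m a, ∃ j, ∀ σ, ε m ≤ ‖P j m (σ, a)‖ := by
    intro m a
    obtain ⟨q, hq, hqd, hqe⟩ := exists_polynomial_monicEval_sineMap (fun i => b i a)
    obtain ⟨j, hj⟩ := exists_circle_le_norm_eval hq hqd (hδ0 m) (hsep m)
    refine ⟨j, fun σ => ?_⟩
    have hn : ‖Z j m (σ, a)‖ = ρ m j := by
      simp [hZ, abs_of_pos (zero_lt_one.trans (hρ1 m j))]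
    have hne : Z j m (σ, a) ≠ 0 := by
      rw [← norm_pos_iff, hn]
      exact zero_lt_one.trans (hρ1 m j)
    have h1 := hj _ hn
    rw [hqe _ hne, norm_mul, norm_pow, norm_mul, norm_mul, hn, Complex.norm_I] at h1
    simp only [Complex.norm_ofNat, mul_one] at h1
    have h2 : (2 * ρ m j) ^ n ≤ 6 ^ n :=
      pow_le_pow_left₀ (by linarith [hρ1 m j]) (by linarith [hρ3 m j]) _
    simp only [hε]
    rw [div_le_iff₀ (by positivity), mul_comm]
    exact h1.trans (mul_le_mul_of_nonneg_right h2 (norm_nonneg _))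
  obtain ⟨w, V, hw, hV, hw1, hwV⟩ := exists_weights_of_lower_bound hPm hε0 hεinv hlow
  set T : Fin n → Fin (d + 1) → ℕ → ℝ × (Fin n → ℝ) → ℂ := fun i j m x =>
    Z j m x ^ (m + 1) * ((Z j m x + (Z j m x)⁻¹) / (2 * Complex.I)) *
      (divCoeff (fun i => b i x.2) i (sineMap (Z j m x)) * V j m x) with hT
  have hTm : ∀ i j, Moderate (T i j) := fun i j =>
    ((hZpowm j).mul (hcm j)).mul ((Moderate.divCoeff hbm (hsm j) i).mul (hV j))
  refine ⟨fun i m a => ∑ j, (w j m a : ℂ) * ((2 * π : ℂ)⁻¹ * ∫ σ in (0 : ℝ)..2 * π, T i j m (σ, a)),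
    fun i => Moderate.sum fun j _ => ((hw j).clm Complex.ofRealCLM).mul
      ((moderate_const' _).mul ((hTm i j).integral 0 (2 * π))), ?_⟩
  intro m a ha t ζ hζ hζt hroot
  have hba : ∀ i, b i a = a i := fun i => by simp [hb, hψ1 _ (ha i)]
  have hroot' : monicEval (fun i => b i a) (sineMap ζ) = 0 := by
    simp only [monicEval, hba, hζt]
    exact_mod_cast hroot
  have hπ : (2 * π : ℂ) ≠ 0 := by exact_mod_cast Real.two_pi_pos.ne'
  have key : ∀ j, (w j m a : ℂ) * ((2 * π : ℂ)⁻¹ * ∑ i,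
      (∫ σ in (0 : ℝ)..2 * π, T i j m (σ, a)) * (t : ℂ) ^ (i : ℕ)) =
        w j m a * (ζ ^ (m + 1) + (-ζ⁻¹) ^ (m + 1)) := by
    intro j
    rcases eq_or_ne (w j m a) 0 with h0 | h0
    · simp [h0]
    congr 1
    rw [inv_mul_eq_iff_eq_mul₀ hπ, ← integral_sineMap_residue (hρ1 m j) hζ m]
    simp_rw [← intervalIntegral.integral_mul_const]
    rw [← intervalIntegral.integral_finsetSum]
    · refine intervalIntegral.integral_congr fun σ hσ => ?_
      rw [Set.uIcc_of_le Real.two_pi_pos.le] at hσ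
      obtain ⟨hP0, hPV⟩ := hwV j m a h0 σ hσ
      simp only [hT, hPV]
      have h1 := sum_divCoeff_mul (fun i => b i a) (sineMap (Z j m (σ, a))) (sineMap ζ)
      rw [hroot', sub_zero] at h1
      have h2 : sineMap (Z j m (σ, a)) - sineMap ζ ≠ 0 := by
        intro h
        rw [h, mul_zero] at h1
        exact hP0 h1.symm
      have h3 : (sineMap (Z j m (σ, a)) - sineMap ζ)⁻¹ =
          ∑ i, divCoeff (fun i => b i a) i (sineMap (Z j m (σ, a))) * (P j m (σ, a))⁻¹ *
            (t : ℂ) ^ (i : ℕ) := by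
        simp_rw [mul_right_comm]
        rw [← Finset.sum_mul, ← hζt]
        rw [eq_mul_inv_iff_mul_eq₀ hP0, inv_mul_eq_iff_eq_mul₀ h2, mul_comm]
        exact h1.symm
      change _ = Z j m (σ, a) ^ (m + 1) * ((Z j m (σ, a) + (Z j m (σ, a))⁻¹) / (2 * Complex.I)) *
        (sineMap (Z j m (σ, a)) - sineMap ζ)⁻¹
      rw [h3, Finset.mul_sum]
      refine Finset.sum_congr rfl fun i _ => ?_
      ring
    · intro i _
      refine Continuous.intervalIntegrable ?_ _ _
      exact (((hTm i j).1 m).continuous.comp (by fun_prop)).mul continuous_const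
  calc _ = ∑ j, (w j m a : ℂ) * ((2 * π : ℂ)⁻¹ * ∑ i,
      (∫ σ in (0 : ℝ)..2 * π, T i j m (σ, a)) * (t : ℂ) ^ (i : ℕ)) := by
        simp_rw [Finset.sum_mul, Finset.mul_sum]
        rw [Finset.sum_comm]
        refine Finset.sum_congr rfl fun j _ => Finset.sum_congr rfl fun i _ => ?_
        ring
    _ = _ := by
        simp_rw [key]
        rw [← Finset.sum_mul]
        have : ∑ j, (w j m a : ℂ) = 1 := by exact_mod_cast hw1 m a
        rw [this, one_mul]

end Remainders

section FourierSums

/-- The exponential `θ ↦ exp (-i (m + 1) θ)`. -/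
def expMode (m : ℕ) (θ : ℝ) : ℂ := Complex.exp ((-((m : ℝ) + 1) * θ : ℝ) * Complex.I)

theorem hasDerivAt_expMode (m : ℕ) (θ : ℝ) :
    HasDerivAt (expMode m) (-(((m : ℂ) + 1) * Complex.I) * expMode m θ) θ := by
  have h1 : HasDerivAt (fun θ : ℝ => ((-((m : ℝ) + 1) * θ : ℝ) : ℂ) * Complex.I)
      (((-((m : ℝ) + 1) * 1 : ℝ) : ℂ) * Complex.I) θ :=
    (((hasDerivAt_id θ).const_mul _).ofReal_comp).mul_const _
  have h2 := h1.cexp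
  refine h2.congr_deriv ?_
  simp only [expMode]
  push_cast
  ring

theorem expMode_two_pi (m : ℕ) : expMode m (2 * π) = 1 := by
  rw [expMode, Complex.exp_eq_one_iff]
  refine ⟨-(m + 1), ?_⟩
  push_cast
  ring

theorem continuous_expMode (m : ℕ) : Continuous (expMode m) :=
  continuous_iff_continuousAt.2 fun θ => (hasDerivAt_expMode m θ).continuousAt

variable {B : Type} [NormedAddCommGroup B] [NormedSpace ℝ B]

theorem moderate_expMode : Moderate fun m (x : ℝ × B) => expMode m x.1 :=
  moderate_exp_mul_I (c := fun m => -((m : ℝ) + 1))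
    (by simpa only [neg_mul, one_mul] using (PolyBound.const (-1)).mul PolyBound.nat)

/-- The partial derivative in the first variable. -/
def partialFst (g : ℝ × B → ℂ) (p : ℝ × B) : ℂ := fderiv ℝ g p (1, 0)

theorem hasDerivAt_partialFst {g : ℝ × B → ℂ} (hg : ContDiff ℝ ∞ g) (x : B) (θ : ℝ) :
    HasDerivAt (fun θ => g (θ, x)) (partialFst g (θ, x)) θ := by
  have h1 : HasFDerivAt g (fderiv ℝ g (θ, x)) (θ, x) :=
    ((hg.differentiable (by simp)).differentiableAt).hasFDerivAt
  have h2 : HasDerivAt (fun θ : ℝ => (θ, x)) ((1 : ℝ), (0 : B)) θ :=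
    (hasDerivAt_id θ).prodMk (hasDerivAt_const θ x)
  exact h1.comp_hasDerivAt θ h2

theorem BddDeriv.partialFst {g : ℝ × B → ℂ} (hg : BddDeriv g) : BddDeriv (partialFst g) := by
  have h1 : BddDeriv (fderiv ℝ g) := by
    refine ⟨fun m => (hg.1 m).fderiv_right (by simp), fun k => ?_⟩
    simp_rw [norm_iteratedFDeriv_fderiv]
    exact hg.2 (k + 1)
  exact h1.moderate.clm (ContinuousLinearMap.apply ℝ ℂ ((1 : ℝ), (0 : B)))

theorem partialFst_periodic {g : ℝ × B → ℂ} (hg : ContDiff ℝ ∞ g)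
    (hp : ∀ θ x, g (θ + 2 * π, x) = g (θ, x)) (θ : ℝ) (x : B) :
    partialFst g (θ + 2 * π, x) = partialFst g (θ, x) := by
  have h1 := (hasDerivAt_partialFst hg x (θ + 2 * π)).comp_add_const θ (2 * π)
  have h2 := hasDerivAt_partialFst hg x θ
  simp_rw [hp] at h1
  exact h1.unique h2

theorem integral_expMode_partialFst {g : ℝ × B → ℂ} (hg : ContDiff ℝ ∞ g)
    (hp : ∀ θ x, g (θ + 2 * π, x) = g (θ, x)) (m : ℕ) (x : B) :
    ∫ θ in (0 : ℝ)..2 * π, expMode m θ * partialFst g (θ, x) =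
      (((m : ℂ) + 1) * Complex.I) * ∫ θ in (0 : ℝ)..2 * π, expMode m θ * g (θ, x) := by
  have hc : Continuous fun θ : ℝ => partialFst g (θ, x) := by
    have : Continuous (partialFst g) :=
      (hg.continuous_fderiv (by simp)).clm_apply continuous_const
    exact this.comp (by fun_prop)
  rw [intervalIntegral.integral_mul_deriv_eq_deriv_mul
    (fun θ _ => hasDerivAt_expMode m θ) (fun θ _ => hasDerivAt_partialFst hg x θ)
    (Continuous.intervalIntegrable (continuous_const.mul (continuous_expMode m)) _ _)
    (hc.intervalIntegrable _ _)]
  have h0 : g (2 * π, x) = g (0, x) := by simpa using hp 0 x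
  have h1 : expMode m 0 = 1 := by simp [expMode]
  rw [h0, expMode_two_pi, h1, sub_self, zero_sub, ← intervalIntegral.integral_neg,
    ← intervalIntegral.integral_const_mul]
  exact intervalIntegral.integral_congr fun θ _ => by ring

theorem integral_expMode_iterate {g : ℝ × B → ℂ} (hg : BddDeriv g)
    (hp : ∀ θ x, g (θ + 2 * π, x) = g (θ, x)) (N : ℕ) :
    ∃ gN : ℝ × B → ℂ, BddDeriv gN ∧ ∀ m x, ∫ θ in (0 : ℝ)..2 * π, expMode m θ * gN (θ, x) =
      (((m : ℂ) + 1) * Complex.I) ^ N * ∫ θ in (0 : ℝ)..2 * π, expMode m θ * g (θ, x) := by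
  suffices ∃ gN : ℝ × B → ℂ, BddDeriv gN ∧ (∀ θ x, gN (θ + 2 * π, x) = gN (θ, x)) ∧
      ∀ m x, ∫ θ in (0 : ℝ)..2 * π, expMode m θ * gN (θ, x) =
      (((m : ℂ) + 1) * Complex.I) ^ N * ∫ θ in (0 : ℝ)..2 * π, expMode m θ * g (θ, x) by
    obtain ⟨gN, h1, -, h2⟩ := this
    exact ⟨gN, h1, h2⟩
  induction N with
  | zero => exact ⟨g, hg, hp, by simp⟩
  | succ N ih =>
    obtain ⟨gN, h1, h2, h3⟩ := ih
    refine ⟨partialFst gN, h1.partialFst, partialFst_periodic (h1.1 0) h2, fun m x => ?_⟩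
    rw [integral_expMode_partialFst (h1.1 0) h2, h3, pow_succ']
    ring

theorem Moderate.integral_mul_le [FiniteDimensional ℝ B] {S : ℕ → ℝ × B → ℂ} (hS : Moderate S)
    (k : ℕ) : ∃ N : ℕ, ∀ g : ℝ × B → ℂ, BddDeriv g → ∃ C : ℝ, 0 ≤ C ∧ ∀ m x,
      ‖iteratedFDeriv ℝ k (fun x => ∫ θ in (0 : ℝ)..2 * π, S m (θ, x) * g (θ, x)) x‖ ≤
        C * ((m : ℝ) + 1) ^ N := by
  have h1 : PolyBound fun m x => ∑ i ∈ Finset.range (k + 1),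
      (k.choose i : ℝ) * ‖iteratedFDeriv ℝ i (S m) x‖ :=
    PolyBound.sum fun i _ => (PolyBound.const _).mul (hS.2 i)
  obtain ⟨C, N, hC, H⟩ := h1
  refine ⟨N, fun g hg => ?_⟩
  have h2 : ∃ C' : ℝ, 0 ≤ C' ∧ ∀ i ∈ Finset.range (k + 1), ∀ x,
      ‖iteratedFDeriv ℝ i g x‖ ≤ C' := by
    choose C' N' hC' H' using hg.2
    refine ⟨∑ i ∈ Finset.range (k + 1), C' i, Finset.sum_nonneg fun i _ => hC' i,
      fun i hi x => ?_⟩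
    have := H' i 0 x
    simp only [abs_norm, Nat.cast_zero, zero_add, one_pow, mul_one] at this
    exact this.trans (Finset.single_le_sum (f := C') (fun i _ => hC' i) hi)
  obtain ⟨C', hC', H'⟩ := h2
  refine ⟨C' * C * |2 * π - 0|, by positivity, fun m x => ?_⟩
  have h3 : ∀ p, ‖iteratedFDeriv ℝ k (fun p => S m p * g p) p‖ ≤
      C' * (C * ((m : ℝ) + 1) ^ N) := by
    intro p
    refine (norm_iteratedFDeriv_mul_le (hS.1 m) (hg.1 0) p (by exact_mod_cast le_top)).trans ?_
    refine le_trans ?_ (mul_le_mul_of_nonneg_left ((le_abs_self _).trans (H m p)) hC')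
    rw [Finset.mul_sum]
    refine Finset.sum_le_sum fun i hi => ?_
    rw [mul_comm C']
    refine mul_le_mul_of_nonneg_left (H' _ ?_ p) (by positivity)
    simp only [Finset.mem_range] at hi ⊢
    omega
  refine (norm_iteratedFDeriv_paramIntegral_le 0 (2 * π) k ((hS.1 m).mul (hg.1 0))
    (fun t _ y => h3 (t, y)) x).trans_eq ?_
  ring

/-- Fourier series with coefficients modulated by a moderate family converge to smooth maps. -/
theorem summable_contDiff_tsum_expMode [FiniteDimensional ℝ B] {g : ℝ × B → ℂ} (hg : BddDeriv g)
    (hp : ∀ θ x, g (θ + 2 * π, x) = g (θ, x)) {R : ℕ → B → ℂ} (hR : Moderate R) :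
    (∀ x, Summable fun m => R m x * ∫ θ in (0 : ℝ)..2 * π, expMode m θ * g (θ, x)) ∧
      ContDiff ℝ ∞ fun x => ∑' m, R m x * ∫ θ in (0 : ℝ)..2 * π, expMode m θ * g (θ, x) := by
  have hS : Moderate fun m (p : ℝ × B) => R m p.2 * expMode m p.1 :=
    (hR.comp_clm (ContinuousLinearMap.snd ℝ ℝ B)).mul moderate_expMode
  have hb : ∀ k : ℕ, ∃ C : ℝ, 0 ≤ C ∧ ∀ m x, ‖iteratedFDeriv ℝ k (fun x => R m x *
      ∫ θ in (0 : ℝ)..2 * π, expMode m θ * g (θ, x)) x‖ ≤ C * (1 / ((m : ℝ) + 1) ^ 2) := by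
    intro k
    obtain ⟨N, hN⟩ := hS.integral_mul_le k
    obtain ⟨gN, hgN, hgN'⟩ := integral_expMode_iterate hg hp (N + 2)
    obtain ⟨C, hC, H⟩ := hN gN hgN
    refine ⟨C, hC, fun m x => ?_⟩
    set c : ℂ := (((m : ℂ) + 1) * Complex.I) ^ (N + 2) with hc
    have hcn : ‖c‖ = ((m : ℝ) + 1) ^ (N + 2) := by
      rw [hc, norm_pow, norm_mul, Complex.norm_I, mul_one]
      congr 1
      exact_mod_cast Complex.norm_natCast (m + 1)
    have hc0 : c ≠ 0 := by
      rw [← norm_pos_iff, hcn]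
      positivity
    have h1 : (fun x => ∫ θ in (0 : ℝ)..2 * π, R m x * expMode m θ * gN (θ, x)) =
        c • fun x => R m x * ∫ θ in (0 : ℝ)..2 * π, expMode m θ * g (θ, x) := by
      funext x
      simp_rw [mul_assoc, intervalIntegral.integral_const_mul]
      rw [hgN', Pi.smul_apply, smul_eq_mul]
      ring
    have h2 := H m x
    simp only at h2
    have hcd : ContDiff ℝ ∞ fun x => R m x * ∫ θ in (0 : ℝ)..2 * π, expMode m θ * g (θ, x) :=
      (hR.1 m).mul (contDiff_paramIntegral (g := fun p : ℝ × B => expMode m p.1 * g p)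
        (((moderate_expMode (B := B)).1 m).mul (hg.1 0)) 0 (2 * π))
    rw [h1, iteratedFDeriv_const_smul_apply (hcd.contDiffAt.of_le (by exact_mod_cast le_top)),
      norm_smul, hcn, pow_add, mul_assoc, mul_comm C] at h2
    rw [mul_one_div, le_div_iff₀ (by positivity), mul_comm]
    exact le_of_mul_le_mul_left h2 (by positivity)
  have hsum : ∀ C : ℝ, Summable fun m : ℕ => C * (1 / ((m : ℝ) + 1) ^ 2) := fun C => by
    have := (summable_nat_add_iff 1).2 (Real.summable_one_div_nat_pow.2 one_lt_two)
    refine Summable.mul_left _ (by simpa using this)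
  choose C hC H using hb
  constructor
  · intro x
    refine Summable.of_norm_bounded (hsum (C 0)) fun m => ?_
    have := H 0 m x
    rwa [norm_iteratedFDeriv_zero] at this
  · refine contDiff_tsum (N := ⊤) (v := fun k (m : ℕ) => C k * (1 / ((m : ℝ) + 1) ^ 2)) (fun m => ?_)
      (fun k _ => hsum _) fun k m x _ => H k m x
    exact (hR.1 m).mul (contDiff_paramIntegral (g := fun p : ℝ × B => expMode m p.1 * g p)
        (((moderate_expMode (B := B)).1 m).mul (hg.1 0)) 0 (2 * π))

/-- The Fourier series of a real function, folded over the nonnegative modes. -/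
theorem hasSum_re_expMode {g : ℝ → ℝ} (hg : Continuous g) (hp : ∀ θ, g (θ + 2 * π) = g θ)
    (hs : Summable fun m => ∫ θ in (0 : ℝ)..2 * π, expMode m θ * (g θ : ℂ)) (θ : ℝ) :
    HasSum (fun m => (π⁻¹ * ((∫ θ in (0 : ℝ)..2 * π, expMode m θ * (g θ : ℂ)) *
      Complex.exp (θ * Complex.I) ^ (m + 1))).re)
      (g θ - (2 * π)⁻¹ * ∫ θ in (0 : ℝ)..2 * π, g θ) := by
  have : Fact (0 < 2 * π) := ⟨Real.two_pi_pos⟩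
  set gc : ℝ → ℂ := fun θ => (g θ : ℂ) with hgc
  have hper : Function.Periodic gc (2 * π) := fun θ => by simp [hgc, hp θ]
  let f : C(AddCircle (2 * π), ℂ) :=
    ⟨hper.lift, continuous_coinduced_dom.2 (Complex.continuous_ofReal.comp hg)⟩
  have hfc : ∀ n : ℤ, fourierCoeff f n = (2 * π : ℂ)⁻¹ * ∫ θ in (0 : ℝ)..2 * π,
      Complex.exp (-(n * θ) * Complex.I) * (g θ : ℂ) := by
    intro n
    rw [fourierCoeff_eq_intervalIntegral f n 0, zero_add, one_div, Complex.real_smul]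
    push_cast
    congr 1
    refine intervalIntegral.integral_congr fun θ _ => ?_
    have h1 : f (θ : AddCircle (2 * π)) = (g θ : ℂ) := hper.lift_coe θ
    simp only [h1, smul_eq_mul, fourier_coe_apply]
    congr 2
    have : (π : ℂ) ≠ 0 := by exact_mod_cast Real.pi_ne_zero
    push_cast
    field_simp
  have hpos : ∀ m : ℕ, fourierCoeff f ((m + 1 : ℕ) : ℤ) = (2 * π : ℂ)⁻¹ *
      ∫ θ in (0 : ℝ)..2 * π, expMode m θ * (g θ : ℂ) := by
    intro m
    rw [hfc]
    congr 1
    refine intervalIntegral.integral_congr fun θ _ => ?_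
    simp only [expMode]
    push_cast
    ring_nf
  have hconj : ∀ h : ℝ → ℂ, (starRingEnd ℂ) (∫ θ in (0 : ℝ)..2 * π, h θ) =
      ∫ θ in (0 : ℝ)..2 * π, (starRingEnd ℂ) (h θ) := fun h => by
    simp only [intervalIntegral.integral_of_le Real.two_pi_pos.le, integral_conj]
  have hneg : ∀ n : ℤ, fourierCoeff f (-n) = (starRingEnd ℂ) (fourierCoeff f n) := by
    intro n
    rw [hfc, hfc, map_mul, hconj]
    congr 1
    · rw [map_inv₀, map_mul, Complex.conj_ofReal, Complex.conj_ofNat]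
    · refine intervalIntegral.integral_congr fun θ _ => ?_
      simp only [map_mul, Complex.conj_ofReal, ← Complex.exp_conj, map_neg, Complex.conj_I,
        map_intCast]
      push_cast
      ring_nf
  have hsm : Summable (fourierCoeff f) := by
    have h1 : Summable fun m : ℕ => fourierCoeff f (m : ℤ) := by
      rw [← summable_nat_add_iff 1]
      simp_rw [hpos]
      exact hs.mul_left _
    refine Summable.of_nat_of_neg h1 ?_
    simp_rw [hneg]
    exact (Complex.conjCLE.toContinuousLinearMap.summable h1 :)
  have h1 := (has_pointwise_sum_fourier_series_of_summable hsm (θ : AddCircle (2 * π))).nat_add_neg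
  rw [← hasSum_nat_add_iff' 1] at h1
  have h2 := Complex.hasSum_re h1
  have hf : f (θ : AddCircle (2 * π)) = (g θ : ℂ) := hper.lift_coe θ
  have hfo : ∀ n : ℤ, (fourier n (θ : AddCircle (2 * π)) : ℂ) =
      Complex.exp (n * θ * Complex.I) := fun n => by
    rw [fourier_coe_apply]
    congr 1
    have : (π : ℂ) ≠ 0 := by exact_mod_cast Real.pi_ne_zero
    push_cast
    field_simp
  have hzero : (fourierCoeff f 0).re = (2 * π)⁻¹ * ∫ θ in (0 : ℝ)..2 * π, g θ := by
    rw [hfc]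
    simp only [Int.cast_zero, zero_mul, neg_zero, Complex.exp_zero, one_mul]
    rw [intervalIntegral.integral_ofReal]
    exact_mod_cast rfl
  convert h2 using 1
  · funext m
    rw [hneg, hpos, hfo, hfo]
    have : Complex.exp ((-((m + 1 : ℕ) : ℤ) : ℤ) * θ * Complex.I) =
        (starRingEnd ℂ) (Complex.exp (((m + 1 : ℕ) : ℤ) * θ * Complex.I)) := by
      rw [← Complex.exp_conj]
      congr 1
      simp
      ring
    rw [this, smul_eq_mul, smul_eq_mul, ← map_mul, Complex.add_conj, Complex.ofReal_re,
      ← Complex.exp_nat_mul]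
    have h3 : ∀ z : ℂ, (((π⁻¹ : ℝ) : ℂ) * z).re = 2 * ((2 * π : ℂ)⁻¹ * z).re := fun z => by
      have : (2 * π : ℂ)⁻¹ = (((2 * π)⁻¹ : ℝ) : ℂ) := by push_cast; rfl
      rw [this, Complex.re_ofReal_mul, Complex.re_ofReal_mul, mul_inv]
      ring
    rw [h3]
    congr 2
    push_cast
    ring_nf
  · rw [hf]
    simp [hzero]

end FourierSums

section DivisionTheorem

variable {E : Type} [NormedAddCommGroup E] [NormedSpace ℝ E] [FiniteDimensional ℝ E]

theorem bddDeriv_of_periodic_of_bounded_support {g : ℝ × E → ℝ} (hg : ContDiff ℝ ∞ g) {c r : ℝ}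
    (hc : 0 < c) (hp : ∀ θ x, g (θ + c, x) = g (θ, x)) (h0 : ∀ θ x, r < ‖x‖ → g (θ, x) = 0) :
    BddDeriv g := by
  refine bddDeriv_of_isCompact hg
    ((isCompact_Icc (a := (0 : ℝ)) (b := c)).prod (isCompact_closedBall (0 : E) r)) 0 ?_
  rintro ⟨θ, x⟩
  rcases le_or_gt ‖x‖ r with hx | hx
  · refine Or.inr ⟨(-(toIcoDiv hc 0 θ • c), 0), ?_, ?_⟩
    · have := sub_toIcoDiv_zsmul_mem_Ico hc 0 θ
      refine ⟨?_, by simpa using hx⟩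
      change θ + -(toIcoDiv hc 0 θ • c) ∈ _
      rw [← sub_eq_add_neg]
      exact ⟨this.1, by simpa using this.2.le⟩
    · rintro ⟨y, z⟩
      have : Function.Periodic (fun θ => g (θ, z)) c := fun θ => hp θ z
      simpa [← sub_eq_add_neg] using this.sub_zsmul_eq (toIcoDiv hc 0 θ) (x := y)
  · refine Or.inl ⟨0, by simp, ?_⟩
    have : ∀ᶠ y : ℝ × E in 𝓝 (θ, x), r < ‖y.2‖ :=
      (continuous_snd.norm.tendsto _).eventually (lt_mem_nhds hx)
    filter_upwards [this] with y hy
    exact h0 y.1 y.2 hy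

/-- **Division theorem**: a smooth function agrees on the roots of the generic monic polynomial
with a polynomial of smaller degree whose coefficients are smooth functions of the parameters. -/
theorem exists_division (n : ℕ) {k : ℝ × E → ℝ} (hk : ContDiff ℝ ∞ k) :
    ∃ r : Fin (n + 1) → E × (Fin (n + 1) → ℝ) → ℝ, (∀ i, ContDiff ℝ ∞ (r i)) ∧
      ∀ (t : ℝ) (x : E) (a : Fin (n + 1) → ℝ), |t| ≤ 1 → ‖x‖ ≤ 1 → (∀ i, |a i| ≤ 1) →
        t ^ (n + 1) + ∑ i, a i * t ^ (i : ℕ) = 0 → k (t, x) = ∑ i, r i (x, a) * t ^ (i : ℕ) := by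
  obtain ⟨R, hR, hRroot⟩ := exists_moderate_remainder (n + 1)
  let φ : ContDiffBump (0 : E) := ⟨1, 2, one_pos, one_lt_two⟩
  set K : ℝ × E → ℝ := fun p => 2⁻¹ * k (Real.sin p.1, p.2) * φ p.2 with hK
  have hKs : ContDiff ℝ ∞ K := by
    have h1 : ContDiff ℝ ∞ fun p : ℝ × E => k (Real.sin p.1, p.2) :=
      hk.comp ((Real.contDiff_sin.comp contDiff_fst).prodMk contDiff_snd)
    exact (contDiff_const.mul h1).mul (φ.contDiff.comp contDiff_snd)
  have hKp : ∀ θ x, K (θ + 2 * π, x) = K (θ, x) := fun θ x => by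
    simp only [hK, Real.sin_add_two_pi]
  have hKb : BddDeriv K :=
    bddDeriv_of_periodic_of_bounded_support hKs Real.two_pi_pos hKp (r := 2) fun θ x hx => by
      simp only [hK]
      rw [φ.zero_of_le_dist (by simpa using hx.le), mul_zero]
  let B := E × (Fin (n + 1) → ℝ)
  set g : ℝ × B → ℂ := fun p => (K (p.1, p.2.1) : ℂ) with hg
  have hgb : BddDeriv g := (hKb.comp_clm ((ContinuousLinearMap.fst ℝ ℝ B).prod
    ((ContinuousLinearMap.fst ℝ E (Fin (n + 1) → ℝ)).comp
      (ContinuousLinearMap.snd ℝ ℝ B)))).moderate.clm Complex.ofRealCLM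
  have hgp : ∀ θ x, g (θ + 2 * π, x) = g (θ, x) := fun θ x => by simp only [hg, hKp]
  have hRB : ∀ i, Moderate fun m (x : B) => R i m x.2 := fun i =>
    (hR i).comp_clm (ContinuousLinearMap.snd ℝ E (Fin (n + 1) → ℝ))
  set c : ℕ → E → ℂ := fun m x => ∫ θ in (0 : ℝ)..2 * π, expMode m θ * (K (θ, x) : ℂ) with hc
  set S : Fin (n + 1) → B → ℂ := fun i p => ∑' m, R i m p.2 * c m p.1 with hS
  have hSs : ∀ i, ContDiff ℝ ∞ (S i) := fun i =>
    (summable_contDiff_tsum_expMode hgb hgp (hRB i)).2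
  have hSsum : ∀ i (p : B), HasSum (fun m => R i m p.2 * c m p.1) (S i p) := fun i p =>
    ((summable_contDiff_tsum_expMode hgb hgp (hRB i)).1 p).hasSum
  have hcsum : ∀ x, Summable fun m => c m x := fun x => by
    have := (summable_contDiff_tsum_expMode hgb hgp (R := fun _ _ => 1) (moderate_const' _)).1
      (x, 0)
    simpa only [one_mul] using this
  set c0 : E → ℝ := fun x => π⁻¹ * ∫ θ in (0 : ℝ)..2 * π, K (θ, x) with hc0
  have hc0s : ContDiff ℝ ∞ c0 := contDiff_const.mul (contDiff_paramIntegral hKs 0 (2 * π))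
  refine ⟨fun i p => π⁻¹ * (S i p).re + if i = 0 then c0 p.1 else 0, fun i => ?_, ?_⟩
  · refine (contDiff_const.mul (Complex.reCLM.contDiff.comp (hSs i))).add ?_
    split_ifs
    · exact hc0s.comp contDiff_fst
    · exact contDiff_const
  · intro t x a ht hx ha hroot
    set θ0 := Real.arcsin t with hθ0
    have hsin : Real.sin θ0 = t := Real.sin_arcsin (abs_le.1 ht).1 (abs_le.1 ht).2
    set ζ : ℂ := Complex.exp (θ0 * Complex.I) with hζ
    have hζn : ‖ζ‖ = 1 := Complex.norm_exp_ofReal_mul_I _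
    have hζs : sineMap ζ = t := by
      rw [sineMap, hζ, ← Complex.exp_neg, ← hsin, Complex.ofReal_sin, Complex.sin,
        neg_mul_eq_neg_mul]
      have hI : Complex.I ≠ 0 := Complex.I_ne_zero
      field_simp
      rw [Complex.I_sq]
      ring
    have hζ' : Complex.exp (((π - θ0 : ℝ) : ℂ) * Complex.I) = -ζ⁻¹ := by
      rw [hζ, ← Complex.exp_neg]
      push_cast
      rw [sub_mul, sub_eq_add_neg, Complex.exp_add, Complex.exp_pi_mul_I]
      ring
    have hKc : Continuous fun θ => K (θ, x) := hKs.continuous.comp (by fun_prop)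
    have h1 := hasSum_re_expMode hKc (fun θ => hKp θ x) (hcsum x) θ0
    have h2 := hasSum_re_expMode hKc (fun θ => hKp θ x) (hcsum x) (π - θ0)
    have h3 := h1.add h2
    rw [hζ'] at h3
    have h4 : HasSum (fun m => π⁻¹ * (∑ i, R i m a * c m x * (t : ℂ) ^ (i : ℕ)).re)
        (π⁻¹ * (∑ i, S i (x, a) * (t : ℂ) ^ (i : ℕ)).re) :=
      (Complex.hasSum_re (hasSum_sum fun i _ => (hSsum i (x, a)).mul_right _)).mul_left _
    have h5 : (fun m => (((π⁻¹ : ℝ) : ℂ) * (c m x * ζ ^ (m + 1))).re +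
        (((π⁻¹ : ℝ) : ℂ) * (c m x * (-ζ⁻¹) ^ (m + 1))).re) =
        fun m => π⁻¹ * (∑ i, R i m a * c m x * (t : ℂ) ^ (i : ℕ)).re := by
      funext m
      have h6 : ∑ i, R i m a * c m x * (t : ℂ) ^ (i : ℕ) =
          c m x * (ζ ^ (m + 1) + (-ζ⁻¹) ^ (m + 1)) := by
        rw [← hRroot m a ha t ζ hζn hζs hroot, Finset.mul_sum]
        exact Finset.sum_congr rfl fun i _ => by ring
      rw [h6, Complex.re_ofReal_mul, Complex.re_ofReal_mul, mul_add, Complex.add_re]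
      ring
    have h6 := h3.unique (h5 ▸ h4)
    have hKk : K (θ0, x) = 2⁻¹ * k (t, x) := by
      simp only [hK, hsin]
      rw [φ.one_of_mem_closedBall (by simpa using hx), mul_one]
    have hKk' : K (π - θ0, x) = 2⁻¹ * k (t, x) := by
      simp only [hK, Real.sin_pi_sub, hsin]
      rw [φ.one_of_mem_closedBall (by simpa using hx), mul_one]
    rw [hKk, hKk'] at h6
    have h7 : (∑ i, S i (x, a) * (t : ℂ) ^ (i : ℕ)).re = ∑ i, (S i (x, a)).re * t ^ (i : ℕ) := by
      rw [Complex.re_sum]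
      refine Finset.sum_congr rfl fun i _ => ?_
      rw [← Complex.ofReal_pow, Complex.re_mul_ofReal]
    rw [h7] at h6
    simp only [add_mul, Finset.sum_add_distrib, ite_mul, zero_mul, Finset.sum_ite_eq',
      Finset.mem_univ, if_true, Fin.val_zero, pow_zero, mul_one, mul_assoc, ← Finset.mul_sum]
    rw [← h6]
    simp only [hc0, mul_inv]
    ring

end DivisionTheorem

/-- The primitive of `G` vanishing at the origin. -/
def primitive (G : ℝ → ℝ) (x : ℝ) : ℝ := ∫ t in (0 : ℝ)..x, G t

@[simp] theorem primitive_zero (G : ℝ → ℝ) : primitive G 0 = 0 := by simp [primitive]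

theorem hasDerivAt_primitive {G : ℝ → ℝ} (hG : ContDiff ℝ ∞ G) (x : ℝ) :
    HasDerivAt (primitive G) (G x) x :=
  intervalIntegral.integral_hasDerivAt_right (hG.continuous.intervalIntegrable _ _)
    hG.continuous.stronglyMeasurable.stronglyMeasurableAtFilter hG.continuous.continuousAt

theorem contDiff_primitive {G : ℝ → ℝ} (hG : ContDiff ℝ ∞ G) : ContDiff ℝ ∞ (primitive G) := by
  rw [contDiff_infty_iff_deriv]
  refine ⟨fun x => (hasDerivAt_primitive hG x).differentiableAt, ?_⟩
  rwa [funext fun x => (hasDerivAt_primitive hG x).deriv]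

/-- The surface in null-type coordinates attached to two functions `G` and `H` of one variable. -/
def stdSurf (G H : ℝ → ℝ) : R2 → R3 := fun q =>
  (2 * q.1, primitive G (q.1 + q.2) + primitive H (q.1 - q.2),
    primitive (fun t => G t ^ 2) (q.1 + q.2) + primitive (fun t => H t ^ 2) (q.1 - q.2))

@[simp] theorem stdSurf_zero (G H : ℝ → ℝ) : stdSurf G H (0, 0) = (0, 0, 0) := by simp [stdSurf]

theorem contDiff_stdSurf {G H : ℝ → ℝ} (hG : ContDiff ℝ ∞ G) (hH : ContDiff ℝ ∞ H) :
    ContDiff ℝ ∞ (stdSurf G H) := by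
  have h1 := contDiff_primitive hG
  have h2 := contDiff_primitive hH
  have h3 := contDiff_primitive (hG.pow 2)
  have h4 := contDiff_primitive (hH.pow 2)
  unfold stdSurf
  fun_prop

theorem fderiv_stdSurf {G H : ℝ → ℝ} (hG : ContDiff ℝ ∞ G) (hH : ContDiff ℝ ∞ H) (q v : R2) :
    fderiv ℝ (stdSurf G H) q v =
      (2 * v.1, G (q.1 + q.2) * (v.1 + v.2) + H (q.1 - q.2) * (v.1 - v.2),
        G (q.1 + q.2) ^ 2 * (v.1 + v.2) + H (q.1 - q.2) ^ 2 * (v.1 - v.2)) := by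
  have ha : HasFDerivAt (fun q : R2 => q.1 + q.2)
      (ContinuousLinearMap.fst ℝ ℝ ℝ + ContinuousLinearMap.snd ℝ ℝ ℝ) q :=
    hasFDerivAt_fst.add hasFDerivAt_snd
  have hb : HasFDerivAt (fun q : R2 => q.1 - q.2)
      (ContinuousLinearMap.fst ℝ ℝ ℝ - ContinuousLinearMap.snd ℝ ℝ ℝ) q :=
    hasFDerivAt_fst.sub hasFDerivAt_snd
  have h1 := (hasDerivAt_primitive hG (q.1 + q.2)).comp_hasFDerivAt q ha
  have h2 := (hasDerivAt_primitive hH (q.1 - q.2)).comp_hasFDerivAt q hb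
  have h3 := (hasDerivAt_primitive (hG.pow 2) (q.1 + q.2)).comp_hasFDerivAt q ha
  have h4 := (hasDerivAt_primitive (hH.pow 2) (q.1 - q.2)).comp_hasFDerivAt q hb
  have h0 : HasFDerivAt (fun q : R2 => 2 * q.1) ((2 : ℝ) • ContinuousLinearMap.fst ℝ ℝ ℝ) q :=
    hasFDerivAt_fst.const_mul 2
  have h : HasFDerivAt (stdSurf G H) _ q := h0.prodMk ((h1.add h2).prodMk (h3.add h4))
  rw [h.fderiv]
  simp
  constructor <;> ring

/-- A generalized timelike minimal surface near a point with `ω₁ω₂ ≠ 0` and `g₂ ≠ 0` is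
`𝒜`-equivalent to a surface `stdSurf G H`, the functions `G` and `H` being `g₁` and `1 / g₂` in
suitable coordinates. -/
theorem IsGTMS.aequiv_stdSurf {f : R2 → R3} {g1 g2 w1 w2 : ℝ → ℝ} (hf : IsGTMS f g1 g2 w1 w2)
    (p : R2) (hg : g2 p.2 ≠ 0) (hw : w1 p.1 * w2 p.2 ≠ 0) {U V G H : ℝ → ℝ} (s : ℝ)
    (hU : ContDiff ℝ ∞ U) (hV : ContDiff ℝ ∞ V) (hG : ContDiff ℝ ∞ G) (hH : ContDiff ℝ ∞ H)
    (hU' : ∀ t, HasDerivAt U (w1 t) t) (hV' : ∀ t, HasDerivAt V (-(w2 t * g2 t ^ 2)) t)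
    (hU0 : U p.1 = 0) (hV0 : V p.2 = 0) (hGU : ∀ᶠ t in 𝓝 p.1, G (U t) = g1 t - s)
    (hHV : ∀ᶠ t in 𝓝 p.2, H (V t) = (g2 t)⁻¹ - s) : AEquiv f p (stdSurf G H) (0, 0) := by
  obtain ⟨hw1, hw2⟩ := mul_ne_zero_iff.1 hw
  let Φ : R2 → R2 := fun q => ((U q.1 + V q.2) / 2, (U q.1 - V q.2) / 2)
  let Ψ : R3 → R3 := fun X => (X.2.1 - X.1 - ((f p).2.1 - (f p).1),
    (X.2.2 - (f p).2.2) - s * (X.2.1 - X.1 - ((f p).2.1 - (f p).1)),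
    (-X.1 - X.2.1 + (f p).1 + (f p).2.1) - 2 * s * (X.2.2 - (f p).2.2)
      + s ^ 2 * (X.2.1 - X.1 - ((f p).2.1 - (f p).1)))
  have hΦ : ContDiff ℝ ∞ Φ := by fun_prop
  have hΨ : ContDiff ℝ ∞ Ψ := by fun_prop
  have hΦ' : ∀ q v : R2, fderiv ℝ Φ q v = ((w1 q.1 * v.1 + -(w2 q.2 * g2 q.2 ^ 2) * v.2) / 2,
      (w1 q.1 * v.1 - -(w2 q.2 * g2 q.2 ^ 2) * v.2) / 2) := by
    intro q v
    have h1 := (hU' q.1).comp_hasFDerivAt q (hasFDerivAt_fst (𝕜 := ℝ) (E := ℝ) (F := ℝ))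
    have h2 := (hV' q.2).comp_hasFDerivAt q (hasFDerivAt_snd (𝕜 := ℝ) (E := ℝ) (F := ℝ))
    have h : HasFDerivAt Φ _ q :=
      ((h1.add h2).mul_const (2⁻¹)).prodMk ((h1.sub h2).mul_const (2⁻¹))
    rw [h.fderiv]
    simp
    constructor <;> ring
  have hΨ' : ∀ X v : R3, fderiv ℝ Ψ X v = (v.2.1 - v.1, v.2.2 - s * (v.2.1 - v.1),
      (-v.1 - v.2.1) - 2 * s * v.2.2 + s ^ 2 * (v.2.1 - v.1)) := by
    intro X v
    let L : R3 →L[ℝ] R3 := LinearMap.toContinuousLinearMap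
      { toFun := fun v => (v.2.1 - v.1, v.2.2 - s * (v.2.1 - v.1),
          (-v.1 - v.2.1) - 2 * s * v.2.2 + s ^ 2 * (v.2.1 - v.1))
        map_add' := by
          intro a b
          ext <;> simp <;> ring
        map_smul' := by
          intro a b
          ext <;> simp <;> ring }
    have hL : Ψ = fun X => L X - L (f p) := by
      funext X
      ext <;> simp [Ψ, L] <;> ring
    rw [hL, ((L.hasFDerivAt (x := X)).sub_const (L (f p))).fderiv]
    rfl
  have hn : (∞ : WithTop ℕ∞) ≠ 0 := by simp
  have hΦp : Φ p = (0, 0) := by simp [Φ, hU0, hV0]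
  refine AEquiv.of_global Φ Ψ hΦ hΨ ?_ ?_ hΦp ?_
  · rw [injective_iff_map_eq_zero]
    rintro ⟨a, b⟩ hab
    simp only [hΦ', Prod.mk_eq_zero] at hab
    obtain ⟨h1, h2⟩ := hab
    have ha : w1 p.1 * a = 0 := by linarith
    have hb : w2 p.2 * g2 p.2 ^ 2 * b = 0 := by linarith
    simp_all
  · rw [injective_iff_map_eq_zero]
    rintro ⟨a, b, c⟩ hab
    simp only [hΨ', Prod.mk_eq_zero] at hab
    obtain ⟨h1, h2, h3⟩ := hab
    rw [h1] at h2 h3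
    have hc : c = 0 := by linarith
    rw [hc] at h3
    have hb : b = 0 := by linarith
    have ha : a = 0 := by linarith
    simp [ha, hb, hc]
  · have hev : ∀ᶠ q : R2 in 𝓝 p, G (U q.1) = g1 q.1 - s ∧ H (V q.2) = (g2 q.2)⁻¹ - s ∧
        g2 q.2 ≠ 0 :=
      (continuousAt_fst.eventually hGU).and ((continuousAt_snd.eventually hHV).and
        ((hf.smooth_g2.continuous.comp continuous_snd).continuousAt.eventually_ne hg))
    obtain ⟨r, hr, hball⟩ := Metric.eventually_nhds_iff_ball.1 hev
    refine eventually_of_mem (Metric.ball_mem_nhds p hr) ?_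
    refine Metric.isOpen_ball.eqOn_of_fderiv_eq (f := fun q => Ψ (f q))
      (g := fun q => stdSurf G H (Φ q)) (convex_ball p r).isPreconnected
      ((hΨ.comp hf.smooth_f).differentiable hn).differentiableOn
      (((contDiff_stdSurf hG hH).comp hΦ).differentiable hn).differentiableOn ?_
      (Metric.mem_ball_self hr) ?_
    · intro q hq
      obtain ⟨h1, h2, h3⟩ := hball q hq
      have hu := hf.deriv_u q
      have hv := hf.deriv_v q
      have e1 : fderiv ℝ (fun q => Ψ (f q)) q = (fderiv ℝ Ψ (f q)).comp (fderiv ℝ f q) :=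
        fderiv_comp q (hΨ.differentiable hn _) (hf.smooth_f.differentiable hn _)
      have e2 : fderiv ℝ (fun q => stdSurf G H (Φ q)) q
          = (fderiv ℝ (stdSurf G H) (Φ q)).comp (fderiv ℝ Φ q) :=
        fderiv_comp q ((contDiff_stdSurf hG hH).differentiable hn _) (hΦ.differentiable hn _)
      rw [e1, e2]
      have s1 : (Φ q).1 + (Φ q).2 = U q.1 := by simp only [Φ]; ring
      have s2 : (Φ q).1 - (Φ q).2 = V q.2 := by simp only [Φ]; ring
      have key : ∀ v : R2, fderiv ℝ f q v = v.1 • pu f q + v.2 • pv f q := by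
        intro v
        have : v = v.1 • ((1, 0) : R2) + v.2 • ((0, 1) : R2) := by ext <;> simp
        conv_lhs => rw [this, map_add, map_smul, map_smul]
        rfl
      ext <;>
      simp [key, hu, hv, hΨ', hΦ', fderiv_stdSurf hG hH, s1, s2, h1, h2] <;>
      field_simp <;> ring
    · simp [Ψ, hΦp]
      ring

theorem exists_localInverse {U : ℝ → ℝ} (hU : ContDiff ℝ ∞ U) {t0 d : ℝ} (h : HasDerivAt U d t0)
    (hd : d ≠ 0) : ∃ u : ℝ → ℝ, ContDiff ℝ ∞ u ∧ u (U t0) = t0 ∧ (∀ᶠ t in 𝓝 t0, u (U t) = t) ∧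
      ∀ᶠ x in 𝓝 (U t0), U (u x) = x := by
  have hloc : IsLocalDiffeoAt U t0 := by
    refine isLocalDiffeoAt_of_injective hU ?_
    rw [h.hasFDerivAt.fderiv, injective_iff_map_eq_zero]
    intro a ha
    simpa [hd] using ha
  obtain ⟨u, h1, -, h2⟩ := hloc.exists_global_symm
  exact ⟨u, h1, h2⟩

/-- A generalized timelike minimal surface and its conjugate surface near a `g`-singular point that
is not `ω`-singular are described by the same two functions of one variable. -/
theorem exists_aequiv_stdSurf {f fhat : R2 → R3} {g1 g2 w1 w2 : ℝ → ℝ} (hf : IsGTMS f g1 g2 w1 w2)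
    (hfhat : IsGTMS fhat g1 g2 w1 (fun v => -w2 v)) (p : R2) (hpg : g1 p.1 * g2 p.2 = 1)
    (hpw : w1 p.1 * w2 p.2 ≠ 0) : ∃ G H : ℝ → ℝ, ContDiff ℝ ∞ G ∧ ContDiff ℝ ∞ H ∧ G 0 = 0 ∧
      H 0 = 0 ∧ AEquiv f p (stdSurf G fun t => H (-t)) (0, 0) ∧
      AEquiv fhat p (stdSurf G H) (0, 0) := by
  obtain ⟨hw1, hw2⟩ := mul_ne_zero_iff.1 hpw
  have hg2 : g2 p.2 ≠ 0 := right_ne_zero_of_mul_eq_one hpg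
  have hs : (g2 p.2)⁻¹ = g1 p.1 := inv_eq_of_mul_eq_one_left hpg
  have hb : ContDiff ℝ ∞ fun t => w2 t * g2 t ^ 2 := hf.smooth_w2.mul (hf.smooth_g2.pow 2)
  let U : ℝ → ℝ := fun t => primitive w1 t - primitive w1 p.1
  let V : ℝ → ℝ := fun t => primitive (fun t => w2 t * g2 t ^ 2) t
    - primitive (fun t => w2 t * g2 t ^ 2) p.2
  have hU : ContDiff ℝ ∞ U := (contDiff_primitive hf.smooth_w1).sub contDiff_const
  have hV : ContDiff ℝ ∞ V := (contDiff_primitive hb).sub contDiff_const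
  have hU' : ∀ t, HasDerivAt U (w1 t) t := fun t =>
    (hasDerivAt_primitive hf.smooth_w1 t).sub_const _
  have hV' : ∀ t, HasDerivAt V (w2 t * g2 t ^ 2) t := fun t =>
    (hasDerivAt_primitive hb t).sub_const _
  have hU0 : U p.1 = 0 := sub_self _
  have hV0 : V p.2 = 0 := sub_self _
  obtain ⟨u, hu, hu0, huU, -⟩ := exists_localInverse hU (hU' p.1) hw1
  obtain ⟨v, hv, hv0, hvV, -⟩ := exists_localInverse hV (hV' p.2) (by positivity)
  obtain ⟨h, hh, hhg⟩ := exists_contDiff_eventuallyEq (f := fun t => (g2 t)⁻¹) (p := p.2) <| by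
    filter_upwards [hf.smooth_g2.continuous.continuousAt.eventually_ne hg2] with t ht
    exact hf.smooth_g2.contDiffAt.inv ht
  have hGU : ∀ᶠ t in 𝓝 p.1, g1 (u (U t)) - g1 p.1 = g1 t - g1 p.1 := by
    filter_upwards [huU] with t ht
    rw [ht]
  have hHV : ∀ᶠ t in 𝓝 p.2, h (v (V t)) - g1 p.1 = (g2 t)⁻¹ - g1 p.1 := by
    filter_upwards [hvV, hhg] with t ht ht'
    rw [ht, ht']
  rw [hU0] at hu0
  rw [hV0] at hv0
  have hG : ContDiff ℝ ∞ fun t => g1 (u t) - g1 p.1 := (hf.smooth_g1.comp hu).sub contDiff_const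
  have hH : ContDiff ℝ ∞ fun t => h (v t) - g1 p.1 := (hh.comp hv).sub contDiff_const
  refine ⟨fun t => g1 (u t) - g1 p.1, fun t => h (v t) - g1 p.1, hG, hH, by simp [hu0],
    by simp [hv0, hhg.self_of_nhds, hs], ?_, ?_⟩
  · exact hf.aequiv_stdSurf p hg2 hpw (V := fun t => -V t) (g1 p.1) hU hV.neg hG
      (hH.comp contDiff_neg) hU' (fun t => (hV' t).neg) hU0 (by simp [hV0]) hGU (by simpa using hHV)
  · exact hfhat.aequiv_stdSurf p hg2 (by simpa using hpw) (g1 p.1) hU hV hG hH hU'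
      (fun t => by simpa using hV' t) hU0 hV0 hGU hHV

theorem eq_zero_of_pow_mul_eq_zero {A : ℝ → ℝ} (hA : ContinuousAt A 0) (n : ℕ)
    (h : ∀ᶠ t in 𝓝 (0 : ℝ), t ^ n * A t = 0) : A 0 = 0 := by
  have h1 : ∀ᶠ t in 𝓝[≠] (0 : ℝ), A t = 0 := by
    filter_upwards [h.filter_mono nhdsWithin_le_nhds, self_mem_nhdsWithin] with t ht ht'
    exact (mul_eq_zero.1 ht).resolve_left (pow_ne_zero n ht')
  exact tendsto_nhds_unique ((hA.tendsto.mono_left nhdsWithin_le_nhds).congr' h1)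
    tendsto_const_nhds |>.trans rfl

/-- A factor with nonvanishing differential can be cancelled. -/
theorem eventually_eq_zero_of_mul_eq_zero {E : Type*} [NormedAddCommGroup E] [NormedSpace ℝ E]
    {R A : E → ℝ} (hR : ContDiff ℝ ∞ R) (hA : Continuous A) {p v : E} (hv : fderiv ℝ R p v ≠ 0)
    (h : ∀ᶠ q in 𝓝 p, R q * A q = 0) : ∀ᶠ q in 𝓝 p, A q = 0 := by
  have hc : Continuous fun q => fderiv ℝ R q v :=
    (hR.continuous_fderiv (by simp)).clm_apply continuous_const
  filter_upwards [hc.continuousAt.eventually_ne hv, eventually_eventually_nhds.2 h] with q hq hq'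
  have hl : HasDerivAt (fun t : ℝ => q + t • v) v 0 := by
    simpa using ((hasDerivAt_id (0 : ℝ)).smul_const v).const_add q
  have h0 : q + (0 : ℝ) • v = q := by simp
  have hd : HasDerivAt (fun t : ℝ => R (q + t • v)) (fderiv ℝ R q v) 0 := by
    have := (hR.differentiable (by simp) (q + (0 : ℝ) • v)).hasFDerivAt.comp_hasDerivAt 0 hl
    rwa [h0] at this
  by_cases hRq : R q = 0
  · have hcl : Continuous fun t : ℝ => q + t • v := by fun_prop
    have hcl' : Tendsto (fun t : ℝ => q + t • v) (𝓝 0) (𝓝 q) := by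
      simpa using hcl.tendsto 0
    have h1 : ∀ᶠ t in 𝓝[≠] (0 : ℝ), A (q + t • v) = 0 := by
      filter_upwards [hd.eventually_ne (c := 0) hq,
        (hcl'.eventually hq').filter_mono nhdsWithin_le_nhds] with t ht ht'
      exact (mul_eq_zero.1 ht').resolve_left ht
    have h2 := ((hA.tendsto q).comp hcl').mono_left (nhdsWithin_le_nhds (s := {(0:ℝ)}ᶜ))
    exact tendsto_nhds_unique (h2.congr' h1) tendsto_const_nhds
  · exact (mul_eq_zero.1 hq'.self_of_nhds).resolve_left hRq

/-- A solution of a linear equation whose inhomogeneity vanishes to order two vanishes exactly to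
order three. -/
theorem exists_eq_cube_mul {δ w k c e : ℝ → ℝ} (hδ : ContDiff ℝ ∞ δ) (hw : ContDiff ℝ ∞ w)
    (hk : ContinuousAt k 0) (hc : ContinuousAt c 0) (he : ContinuousAt e 0) (hδ0 : δ 0 = 0)
    (hw0 : w 0 = 0) (hw1 : deriv w 0 ≠ 0) (hk0 : k 0 ≠ 0) (hc0 : c 0 ≠ 0)
    (h : ∀ᶠ t in 𝓝 0, k t * deriv δ t = w t ^ 2 * c t + δ t * e t) :
    ∃ d : ℝ → ℝ, ContDiff ℝ ∞ d ∧ d 0 ≠ 0 ∧ (∀ t, δ t = t ^ 3 * d t) ∧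
      3 * (k 0 * d 0) = deriv w 0 ^ 2 * c 0 := by
  obtain ⟨W, hW, hwW, hW0⟩ := exists_hadamard_one hw
  obtain ⟨d1, hd1, hδ1, -⟩ := exists_hadamard_one hδ
  obtain ⟨d2, hd2, hδ2, -⟩ := exists_hadamard_one hd1
  obtain ⟨d3, hd3, hδ3, -⟩ := exists_hadamard_one hd2
  have hn : (∞ : WithTop ℕ∞) ≠ 0 := by simp
  have cd : ∀ {d : ℝ → ℝ}, ContDiff ℝ ∞ d → ContinuousAt (deriv d) 0 := fun hd =>
    (hd.continuous_deriv (by simp)).continuousAt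
  have hd : ∀ (n : ℕ) {d : ℝ → ℝ}, ContDiff ℝ ∞ d → (∀ t, δ t = t ^ n * d t) →
      ∀ t, deriv δ t = n * t ^ (n - 1) * d t + t ^ n * deriv d t := by
    intro n d hd hδd t
    rw [funext hδd]
    exact ((hasDerivAt_pow n t).mul (hd.differentiable hn t).hasDerivAt).deriv
  have cW := hW.continuous.continuousAt (x := 0)
  have c1 := hd1.continuous.continuousAt (x := 0)
  have c2 := hd2.continuous.continuousAt (x := 0)
  have c3 := hd3.continuous.continuousAt (x := 0)
  have c1' := cd hd1
  have c2' := cd hd2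
  have c3' := cd hd3
  rw [hw0] at hwW
  rw [hδ0] at hδ1
  have e1 : ∀ t, δ t = t ^ 1 * d1 t := fun t => by rw [hδ1]; ring
  have h1 : d1 0 = 0 := by
    have := h.self_of_nhds
    rw [hd 1 hd1 e1, hδ0, hw0] at this
    simpa [hk0] using this
  have e2 : ∀ t, δ t = t ^ 2 * d2 t := fun t => by rw [hδ1, hδ2, h1]; ring
  have h2 : d2 0 = 0 := by
    have := eq_zero_of_pow_mul_eq_zero (A := fun t => k t * (2 * d2 t + t * deriv d2 t)
      - t * W t ^ 2 * c t - t * d2 t * e t) (by fun_prop) 1 (by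
        filter_upwards [h] with t ht
        rw [hd 2 hd2 e2, hwW, e2] at ht
        push_cast at ht
        linear_combination ht)
    simpa [hk0] using this
  have e3 : ∀ t, δ t = t ^ 3 * d3 t := fun t => by rw [e2, hδ3, h2]; ring
  have h3 : k 0 * (3 * d3 0) - W 0 ^ 2 * c 0 = 0 := by
    have := eq_zero_of_pow_mul_eq_zero (A := fun t => k t * (3 * d3 t + t * deriv d3 t)
      - W t ^ 2 * c t - t * d3 t * e t) (by fun_prop) 2 (by
        filter_upwards [h] with t ht
        rw [hd 3 hd3 e3, hwW, e3] at ht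
        push_cast at ht
        linear_combination ht)
    simpa using this
  rw [hW0] at h3
  refine ⟨d3, hd3, ?_, e3, by linear_combination h3⟩
  rintro hd0
  rw [hd0] at h3
  simp [hw1, hc0] at h3

section Slices

variable {F : Type*} [NormedAddCommGroup F] [NormedSpace ℝ F] {A : R2 → F}

theorem hasDerivAt_slice_snd (hA : ContDiff ℝ ∞ A) (x t : ℝ) :
    HasDerivAt (fun t => A (x, t)) (fderiv ℝ A (x, t) (0, 1)) t :=
  (hA.differentiable (by simp) (x, t)).hasFDerivAt.comp_hasDerivAt t
    ((hasDerivAt_const t x).prodMk (hasDerivAt_id t))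

theorem hasDerivAt_slice_fst (hA : ContDiff ℝ ∞ A) (t y : ℝ) :
    HasDerivAt (fun t => A (t, y)) (fderiv ℝ A (t, y) (1, 0)) t :=
  (hA.differentiable (by simp) (t, y)).hasFDerivAt.comp_hasDerivAt t
    ((hasDerivAt_id t).prodMk (hasDerivAt_const t y))

theorem contDiff_fderiv_apply (hA : ContDiff ℝ ∞ A) (v : R2) :
    ContDiff ℝ ∞ fun q => fderiv ℝ A q v :=
  (hA.fderiv_right (by simp)).clm_apply contDiff_const

end Slices

/-- The factor by which `∂_y (stdSurf G H)` fails to be a unit field. -/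
def stdDensity (G H : ℝ → ℝ) (q : R2) : ℝ := G (q.1 + q.2) - H (q.1 - q.2)

/-- The slope of the limiting tangent field of `stdSurf G H`. -/
def stdSlope (G H : ℝ → ℝ) (q : R2) : ℝ := G (q.1 + q.2) + H (q.1 - q.2)

section Std

variable {G H : ℝ → ℝ}

theorem contDiff_stdDensity (hG : ContDiff ℝ ∞ G) (hH : ContDiff ℝ ∞ H) :
    ContDiff ℝ ∞ (stdDensity G H) := by
  unfold stdDensity
  fun_prop

theorem contDiff_stdSlope (hG : ContDiff ℝ ∞ G) (hH : ContDiff ℝ ∞ H) :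
    ContDiff ℝ ∞ (stdSlope G H) := by
  unfold stdSlope
  fun_prop

theorem fderiv_stdSurf_snd (hG : ContDiff ℝ ∞ G) (hH : ContDiff ℝ ∞ H) (q : R2) :
    fderiv ℝ (stdSurf G H) q (0, 1) = stdDensity G H q • (0, 1, stdSlope G H q) := by
  rw [fderiv_stdSurf hG hH]
  ext <;> simp [stdDensity, stdSlope] <;> ring

theorem fderiv_stdDensity (hG : ContDiff ℝ ∞ G) (hH : ContDiff ℝ ∞ H) (q v : R2) :
    fderiv ℝ (stdDensity G H) q v =
      deriv G (q.1 + q.2) * (v.1 + v.2) - deriv H (q.1 - q.2) * (v.1 - v.2) := by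
  have h1 := (hG.differentiable (by simp) (q.1 + q.2)).hasDerivAt.comp_hasFDerivAt q
    (hasFDerivAt_fst.add (hasFDerivAt_snd (𝕜 := ℝ) (E := ℝ) (F := ℝ)))
  have h2 := (hH.differentiable (by simp) (q.1 - q.2)).hasDerivAt.comp_hasFDerivAt q
    (hasFDerivAt_fst.sub (hasFDerivAt_snd (𝕜 := ℝ) (E := ℝ) (F := ℝ)))
  have h : HasFDerivAt (stdDensity G H) _ q := h1.sub h2
  rw [h.fderiv]
  simp
  ring

theorem fderiv_stdSlope (hG : ContDiff ℝ ∞ G) (hH : ContDiff ℝ ∞ H) (q v : R2) :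
    fderiv ℝ (stdSlope G H) q v =
      deriv G (q.1 + q.2) * (v.1 + v.2) + deriv H (q.1 - q.2) * (v.1 - v.2) := by
  have h1 := (hG.differentiable (by simp) (q.1 + q.2)).hasDerivAt.comp_hasFDerivAt q
    (hasFDerivAt_fst.add (hasFDerivAt_snd (𝕜 := ℝ) (E := ℝ) (F := ℝ)))
  have h2 := (hH.differentiable (by simp) (q.1 - q.2)).hasDerivAt.comp_hasFDerivAt q
    (hasFDerivAt_fst.sub (hasFDerivAt_snd (𝕜 := ℝ) (E := ℝ) (F := ℝ)))
  have h : HasFDerivAt (stdSlope G H) _ q := h1.add h2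
  rw [h.fderiv]
  simp
  ring

/-- Normalisation of an equivalence between `stdSurf G H` and a corank one germ. -/
theorem AEquiv.stdSurf_elim (hG : ContDiff ℝ ∞ G) (hH : ContDiff ℝ ∞ H) (hG0 : G 0 = 0)
    (hH0 : H 0 = 0) {f : R2 → R3} (hf : ContDiff ℝ ∞ f)
    (hf0 : ∀ v, fderiv ℝ f (0, 0) v = (v.1, 0, 0))
    (h : AEquiv (stdSurf G H) (0, 0) f (0, 0)) :
    ∃ (Φ : R2 → R2) (Ψ : R3 → R3) (N : R2 → R3), ContDiff ℝ ∞ Φ ∧ ContDiff ℝ ∞ Ψ ∧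
      ContDiff ℝ ∞ N ∧ Φ (0, 0) = (0, 0) ∧
      (∀ q, N q = fderiv ℝ Ψ (stdSurf G H q) (0, 1, stdSlope G H q)) ∧
      (∀ᶠ q in 𝓝 ((0, 0) : R2),
        fderiv ℝ f (Φ q) (fderiv ℝ Φ q (0, 1)) = stdDensity G H q • N q) ∧
      (fderiv ℝ Φ (0, 0) (0, 1)).1 = 0 ∧ (fderiv ℝ Φ (0, 0) (0, 1)).2 ≠ 0 ∧
      (fderiv ℝ Φ (0, 0) (1, 0)).1 ≠ 0 ∧
      ((N (0, 0)).2.2 = 0 → (N (0, 0)).2.1 ≠ 0 ∧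
        (fderiv ℝ Ψ (0, 0, 0) (0, 0, 1)).2.2 ≠ 0) := by
  have hn : (∞ : WithTop ℕ∞) ≠ 0 := by simp
  have hS := contDiff_stdSurf hG hH
  obtain ⟨Φ, Ψ, hΦ, hΨ, hΦi, hΨi, hΦ0, -, hev⟩ := h.exists_global hS.continuous.continuousAt
  rw [stdSurf_zero] at hΨi
  have key : ∀ᶠ q in 𝓝 ((0, 0) : R2), ∀ v, fderiv ℝ f (Φ q) (fderiv ℝ Φ q v)
      = fderiv ℝ Ψ (stdSurf G H q) (fderiv ℝ (stdSurf G H) q v) := by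
    filter_upwards [eventually_eventually_nhds.2 hev] with q hq v
    have h1 : (fun x => Ψ (stdSurf G H x)) =ᶠ[𝓝 q] fun x => f (Φ x) := hq
    have h2 : fderiv ℝ (fun x => Ψ (stdSurf G H x)) q
        = (fderiv ℝ Ψ (stdSurf G H q)).comp (fderiv ℝ (stdSurf G H) q) :=
      fderiv_comp q (hΨ.differentiable hn _) (hS.differentiable hn _)
    have h3 : fderiv ℝ (fun x => f (Φ x)) q = (fderiv ℝ f (Φ q)).comp (fderiv ℝ Φ q) :=
      fderiv_comp q (hf.differentiable hn _) (hΦ.differentiable hn _)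
    rw [← ContinuousLinearMap.comp_apply, ← ContinuousLinearMap.comp_apply, ← h2, ← h3,
      h1.fderiv_eq]
  have hN : ContDiff ℝ ∞ fun q => fderiv ℝ Ψ (stdSurf G H q) (0, 1, stdSlope G H q) := by
    have h1 := (hΨ.fderiv_right (m := ∞) (by simp)).comp hS
    exact h1.clm_apply (contDiff_const.prodMk (contDiff_const.prodMk (contDiff_stdSlope hG hH)))
  have hs0 : stdSlope G H (0, 0) = 0 := by simp [stdSlope, hG0, hH0]
  have hl0 : stdDensity G H (0, 0) = 0 := by simp [stdDensity, hG0, hH0]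
  have k0 := key.self_of_nhds
  simp only [hΦ0, hf0, stdSurf_zero] at k0
  have kx := k0 (1, 0)
  have ky := k0 (0, 1)
  rw [fderiv_stdSurf_snd hG hH, hl0, zero_smul, map_zero] at ky
  rw [fderiv_stdSurf hG hH] at kx
  simp only [add_zero, hG0, sub_zero, hH0] at kx
  have hy1 : (fderiv ℝ Φ (0, 0) (0, 1)).1 = 0 := congrArg Prod.fst ky
  have hx1 : (fderiv ℝ Φ (0, 0) (1, 0)).1 ≠ 0 := by
    intro hx
    rw [hx] at kx
    have := hΨi (kx.symm.trans (map_zero _).symm)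
    simp at this
  refine ⟨Φ, Ψ, _, hΦ, hΨ, hN, hΦ0, fun q => rfl, ?_, hy1, ?_, hx1, ?_⟩
  · filter_upwards [key] with q hq
    rw [hq, fderiv_stdSurf_snd hG hH, map_smul]
  · intro hy2
    have h1 : fderiv ℝ Φ (0, 0) (0, 1) = 0 := Prod.ext hy1 hy2
    have := hΦi (h1.trans (map_zero _).symm)
    simp at this
  · simp only [stdSurf_zero, hs0]
    set α := (fderiv ℝ Φ (0, 0) (1, 0)).1
    intro h3
    have hcomb : ∀ a b c : ℝ, fderiv ℝ Ψ (0, 0, 0) (a, b, c) = (a / 2) • (α, 0, 0)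
        + b • fderiv ℝ Ψ (0, 0, 0) (0, 1, 0) + c • fderiv ℝ Ψ (0, 0, 0) (0, 0, 1) := by
      intro a b c
      have : ((a, b, c) : R3) = (a / 2) • (2 * 1, 0 * 1 + 0 * 1, 0 ^ 2 * 1 + 0 ^ 2 * 1)
        + b • (0, 1, 0) + c • (0, 0, 1) := by ext <;> simp
      rw [this, map_add, map_add, map_smul, map_smul, map_smul, ← kx]
    have h2 : (fderiv ℝ Ψ (0, 0, 0) (0, 1, 0)).2.1 ≠ 0 := by
      intro h2
      have := hcomb (-2 * (fderiv ℝ Ψ (0, 0, 0) (0, 1, 0)).1 / α) 1 0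
      have h0 : fderiv ℝ Ψ (0, 0, 0) (-2 * (fderiv ℝ Ψ (0, 0, 0) (0, 1, 0)).1 / α, 1, 0) = 0 := by
        rw [this]
        ext <;> simp [h2, h3]
        field_simp
        ring
      have := hΨi (h0.trans (map_zero _).symm)
      simp at this
    refine ⟨h2, fun h33 => ?_⟩
    set u := fderiv ℝ Ψ (0, 0, 0) (0, 1, 0)
    set v := fderiv ℝ Ψ (0, 0, 0) (0, 0, 1)
    have h0 : fderiv ℝ Ψ (0, 0, 0) (-2 * (v.1 - v.2.1 / u.2.1 * u.1) / α, -v.2.1 / u.2.1, 1)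
        = 0 := by
      rw [hcomb]
      ext <;> simp [h3, h33] <;> field_simp <;> ring
    have := hΨi (h0.trans (map_zero _).symm)
    simp at this

/-- The criterion on `G` and `H` satisfied by both kinds of singularities. -/
def CubicContact (G H : ℝ → ℝ) : Prop :=
  deriv G 0 ≠ 0 ∧ ∃ d : ℝ → ℝ, ContDiff ℝ ∞ d ∧ d 0 ≠ 0 ∧ ∀ t, G t - H t = t ^ 3 * d t

theorem CubicContact.deriv_eq (hG : ContDiff ℝ ∞ G) (hH : ContDiff ℝ ∞ H) {d : ℝ → ℝ}
    (hd : ContDiff ℝ ∞ d) (h : ∀ t, G t - H t = t ^ 3 * d t) : deriv H 0 = deriv G 0 := by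
  have hn : (∞ : WithTop ℕ∞) ≠ 0 := by simp
  have h1 := (hG.differentiable hn 0).hasDerivAt.sub (hH.differentiable hn 0).hasDerivAt
  have h2 := (hasDerivAt_pow 3 (0 : ℝ)).mul (hd.differentiable hn 0).hasDerivAt
  have h3 : G - H = (fun t => t ^ 3) * d := funext h
  rw [h3] at h1
  have := h1.unique h2
  simp at this
  linarith

end Std

theorem contDiff_fCBF : ContDiff ℝ ∞ fCBF := by
  unfold fCBF
  fun_prop

theorem contDiff_fCS1p : ContDiff ℝ ∞ fCS1p := by
  unfold fCS1p
  fun_prop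

theorem fderiv_fCBF (q v : R2) : fderiv ℝ fCBF q v = (v.1,
    20 * q.2 ^ 3 * v.2 + 2 * q.1 * v.2 + 2 * q.2 * v.1,
    20 * q.2 ^ 4 * v.2 + q.2 ^ 2 * v.1 + 2 * q.1 * q.2 * v.2 - 2 * q.1 * v.1) := by
  have h1 := hasFDerivAt_fst (𝕜 := ℝ) (E := ℝ) (F := ℝ) (p := q)
  have h2 := hasFDerivAt_snd (𝕜 := ℝ) (E := ℝ) (F := ℝ) (p := q)
  have h : HasFDerivAt fCBF _ q := h1.prodMk ((((h2.pow 4).const_mul 5).add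
    ((h1.const_mul 2).mul h2)).prodMk
      ((((h2.pow 5).const_mul 4).add (h1.mul (h2.pow 2))).sub (h1.pow 2)))
  rw [h.fderiv]
  ext <;> simp <;> ring

theorem fderiv_fCS1p (q v : R2) : fderiv ℝ fCS1p q v = (v.1, 2 * q.2 * v.2,
    3 * q.2 ^ 2 * q.1 ^ 2 * v.2 + 2 * q.2 ^ 3 * q.1 * v.1 + 5 * q.2 ^ 4 * v.2) := by
  have h1 := hasFDerivAt_fst (𝕜 := ℝ) (E := ℝ) (F := ℝ) (p := q)
  have h2 := hasFDerivAt_snd (𝕜 := ℝ) (E := ℝ) (F := ℝ) (p := q)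
  have h : HasFDerivAt fCS1p _ q := h1.prodMk ((h2.pow 2).prodMk
    ((h2.pow 3).mul ((h1.pow 2).add (h2.pow 2))))
  rw [h.fderiv]
  ext
  · simp
  · simp
  · simp
    ring

section Components

variable {Φ : R2 → R2}

theorem hasDerivAt_slice_snd_fst (hΦ : ContDiff ℝ ∞ Φ) (x t : ℝ) :
    HasDerivAt (fun t => (Φ (x, t)).1) (fderiv ℝ Φ (x, t) (0, 1)).1 t :=
  (hasFDerivAt_fst (𝕜 := ℝ) (E := ℝ) (F := ℝ)).comp_hasDerivAt t (hasDerivAt_slice_snd hΦ x t)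

theorem hasDerivAt_slice_snd_snd (hΦ : ContDiff ℝ ∞ Φ) (x t : ℝ) :
    HasDerivAt (fun t => (Φ (x, t)).2) (fderiv ℝ Φ (x, t) (0, 1)).2 t :=
  (hasFDerivAt_snd (𝕜 := ℝ) (E := ℝ) (F := ℝ)).comp_hasDerivAt t (hasDerivAt_slice_snd hΦ x t)

theorem hasDerivAt_slice_fst_fst (hΦ : ContDiff ℝ ∞ Φ) (t y : ℝ) :
    HasDerivAt (fun t => (Φ (t, y)).1) (fderiv ℝ Φ (t, y) (1, 0)).1 t :=
  (hasFDerivAt_fst (𝕜 := ℝ) (E := ℝ) (F := ℝ)).comp_hasDerivAt t (hasDerivAt_slice_fst hΦ t y)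

theorem hasDerivAt_slice_fst_snd (hΦ : ContDiff ℝ ∞ Φ) (t y : ℝ) :
    HasDerivAt (fun t => (Φ (t, y)).2) (fderiv ℝ Φ (t, y) (1, 0)).2 t :=
  (hasFDerivAt_snd (𝕜 := ℝ) (E := ℝ) (F := ℝ)).comp_hasDerivAt t (hasDerivAt_slice_fst hΦ t y)

end Components

section ButterflyContact

variable {G H : ℝ → ℝ}

theorem tendsto_slice_snd (x : ℝ) : Tendsto (fun t : ℝ => (x, t)) (𝓝 0) (𝓝 (x, 0)) :=
  (Continuous.prodMk_right x).tendsto 0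

theorem tendsto_slice_fst (y : ℝ) : Tendsto (fun t : ℝ => (t, y)) (𝓝 0) (𝓝 (0, y)) :=
  (Continuous.prodMk_left y).tendsto 0

theorem cubicContact_of_aequiv_fCBF (hG : ContDiff ℝ ∞ G) (hH : ContDiff ℝ ∞ H) (hG0 : G 0 = 0)
    (hH0 : H 0 = 0) (h : AEquiv (stdSurf G H) (0, 0) fCBF (0, 0)) :
    CubicContact G fun t => H (-t) := by
  obtain ⟨Φ, Ψ, N, hΦ, hΨ, hN, hΦ0, -, hev, ha0, hb0, hx0, hN0⟩ :=
    h.stdSurf_elim hG hH hG0 hH0 contDiff_fCBF (fun v => by rw [fderiv_fCBF]; simp)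
  have hl0 : stdDensity G H (0, 0) = 0 := by simp [stdDensity, hG0, hH0]
  have hl := contDiff_stdDensity hG hH
  have hl' := fderiv_stdDensity hG hH
  have hδ : ∀ t, G t - H (-t) = stdDensity G H (0, t) := fun t => by simp [stdDensity]
  set l := stdDensity G H
  let b : R2 → ℝ := fun q => (fderiv ℝ Φ q (0, 1)).2
  let κ : R2 → ℝ := fun q => (N q).2.1 - 2 * (Φ q).2 * (N q).1
  let R : R2 → ℝ := fun q => 20 * (Φ q).2 ^ 3 + 2 * (Φ q).1
  have hdΦ := contDiff_fderiv_apply hΦ (0, 1)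
  have hb : ContDiff ℝ ∞ b := contDiff_snd.comp hdΦ
  have hκ : ContDiff ℝ ∞ κ := by fun_prop
  have hR : ContDiff ℝ ∞ R := by fun_prop
  have eq1 : ∀ᶠ q in 𝓝 ((0, 0) : R2), (fderiv ℝ Φ q (0, 1)).1 = l q * (N q).1 := by
    filter_upwards [hev] with q hq
    rw [fderiv_fCBF] at hq
    exact congrArg Prod.fst hq
  have eqκ : ∀ᶠ q in 𝓝 ((0, 0) : R2), l q * κ q = R q * b q := by
    filter_upwards [hev, eq1] with q hq hq1
    rw [fderiv_fCBF] at hq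
    have h2 := congrArg (fun z => z.2.1) hq
    simp only [Prod.smul_snd, Prod.smul_fst, smul_eq_mul] at h2
    simp only [κ, R, b]
    linear_combination -h2 + 2 * (Φ q).2 * hq1
  have hbne : ∀ᶠ q in 𝓝 ((0, 0) : R2), b q ≠ 0 := hb.continuous.continuousAt.eventually_ne hb0
  have hRx : fderiv ℝ R (0, 0) (1, 0) = 2 * (fderiv ℝ Φ (0, 0) (1, 0)).1 := by
    have h1 := (((hasDerivAt_slice_fst_snd hΦ 0 0).pow 3).const_mul 20).add
      ((hasDerivAt_slice_fst_fst hΦ 0 0).const_mul 2)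
    have := (hasDerivAt_slice_fst hR 0 0).unique h1
    simpa [hΦ0] using this
  have hRx0 : fderiv ℝ R (0, 0) (1, 0) ≠ 0 := by
    rw [hRx]
    exact mul_ne_zero two_ne_zero hx0
  have hA : ∀ᶠ q in 𝓝 ((0, 0) : R2),
      (N q).2.2 - (Φ q).2 * κ q - ((Φ q).2 ^ 2 - 2 * (Φ q).1) * (N q).1 = 0 := by
    refine eventually_eq_zero_of_mul_eq_zero hR (by fun_prop) hRx0 ?_
    filter_upwards [hev, eq1, eqκ, hbne] with q hq hq1 hqκ hqb
    rw [fderiv_fCBF] at hq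
    have h3 := congrArg (fun z => z.2.2) hq
    simp only [Prod.smul_snd, smul_eq_mul] at h3
    have : b q * (R q * ((N q).2.2 - (Φ q).2 * κ q
        - ((Φ q).2 ^ 2 - 2 * (Φ q).1) * (N q).1)) = 0 := by
      have h4 : l q * ((N q).2.2 - (Φ q).2 * κ q
        - ((Φ q).2 ^ 2 - 2 * (Φ q).1) * (N q).1) = 0 := by
        have : R q * b q = (20 * (Φ q).2 ^ 3 + 2 * (Φ q).1) * (fderiv ℝ Φ q (0, 1)).2 := rfl
        linear_combination -h3 - (Φ q).2 * hqκ - (Φ q).2 * this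
          + ((Φ q).2 ^ 2 - 2 * (Φ q).1) * hq1
      linear_combination κ q * h4 - ((N q).2.2 - (Φ q).2 * κ q
        - ((Φ q).2 ^ 2 - 2 * (Φ q).1) * (N q).1) * hqκ
    exact (mul_eq_zero.1 this).resolve_left hqb
  have hN2 : (N (0, 0)).2.1 ≠ 0 := by
    refine (hN0 ?_).1
    simpa [hΦ0] using hA.self_of_nhds
  have hκ0 : κ (0, 0) ≠ 0 := by simpa [κ, hΦ0] using hN2
  have c1 := hb.continuous
  have c2 := hκ.continuous
  have c3 := hN.continuous
  have c4 := (contDiff_fderiv_apply hb (0, 1)).continuous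
  have c5 := (contDiff_fderiv_apply hκ (0, 1)).continuous
  have cs : Continuous fun t : ℝ => ((0, t) : R2) := by fun_prop
  have hδs : ContDiff ℝ ∞ fun t => G t - H (-t) := hG.sub (hH.comp contDiff_neg)
  obtain ⟨d, hd, hd0, hGd, -⟩ := exists_eq_cube_mul (δ := fun t => G t - H (-t))
    (w := fun t => (Φ (0, t)).2)
    (k := fun t => b (0, t) * κ (0, t)) (c := fun t => 60 * b (0, t) ^ 3)
    (e := fun t => 2 * (N (0, t)).1 * b (0, t) ^ 2 + κ (0, t) * fderiv ℝ b (0, t) (0, 1)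
      - b (0, t) * fderiv ℝ κ (0, t) (0, 1)) hδs
    (contDiff_snd.comp (hΦ.comp (contDiff_const.prodMk contDiff_id)))
    (by fun_prop) (by fun_prop)
    (Continuous.continuousAt (((continuous_const.mul (continuous_fst.comp (c3.comp cs))).mul
      ((c1.comp cs).pow 2)).add ((c2.comp cs).mul (c4.comp cs)) |>.sub
        ((c1.comp cs).mul (c5.comp cs))))
    (by simp [hG0, hH0]) (by simp [hΦ0])
    (by rw [(hasDerivAt_slice_snd_snd hΦ 0 0).deriv]; exact hb0) (mul_ne_zero hb0 hκ0)
    (mul_ne_zero (by norm_num) (pow_ne_zero 3 hb0)) (by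
      filter_upwards [(tendsto_slice_snd 0).eventually eqκ.eventually_nhds,
        (tendsto_slice_snd 0).eventually eq1] with t ht ht1
      have e1 := (hasDerivAt_slice_snd hl 0 t).mul (hasDerivAt_slice_snd hκ 0 t)
      have e2 := ((((hasDerivAt_slice_snd_snd hΦ 0 t).pow 3).const_mul 20).add
        ((hasDerivAt_slice_snd_fst hΦ 0 t).const_mul 2)).mul (hasDerivAt_slice_snd hb 0 t)
      have e3 : (fun t => l (0, t) * κ (0, t)) =ᶠ[𝓝 t] fun t => R (0, t) * b (0, t) :=
        ((Continuous.prodMk_right (0 : ℝ)).tendsto t).eventually ht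
      have e4 := (e1.congr_of_eventuallyEq (e3.symm)).unique e2
      have e5 : deriv (fun t => G t - H (-t)) t = fderiv ℝ l (0, t) (0, 1) := by
        rw [funext hδ]
        exact (hasDerivAt_slice_snd hl 0 t).deriv
      have e6 := ht.self_of_nhds
      rw [e5, hδ]
      simp only [Nat.cast_ofNat, Nat.add_one_sub_one, Pi.add_apply, Pi.pow_apply] at e4
      have e7 : (fderiv ℝ Φ (0, t) (0, 1)).2 = b (0, t) := rfl
      have e8 : R (0, t) = 20 * (Φ (0, t)).2 ^ 3 + 2 * (Φ (0, t)).1 := rfl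
      rw [ht1, e7] at e4
      linear_combination b (0, t) * e4 - fderiv ℝ b (0, t) (0, 1) * e6
        - b (0, t) * fderiv ℝ b (0, t) (0, 1) * e8)
  refine ⟨fun hG1 => ?_, d, hd, hd0, hGd⟩
  have h1 := CubicContact.deriv_eq hG (hH.comp contDiff_neg) hd hGd
  have h2 : deriv (H ∘ fun t => -t) 0 = -deriv H 0 := by
    have := deriv_comp_neg H 0
    simpa [Function.comp_def] using this
  rw [h2, hG1] at h1
  have e1 := (hasDerivAt_slice_fst hl 0 0).mul (hasDerivAt_slice_fst hκ 0 0)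
  have e2 := (hasDerivAt_slice_fst hR 0 0).mul (hasDerivAt_slice_fst hb 0 0)
  have e3 : (fun t => l (t, 0) * κ (t, 0)) =ᶠ[𝓝 0] fun t => R (t, 0) * b (t, 0) :=
    (tendsto_slice_fst 0).eventually eqκ
  have e4 := (e1.congr_of_eventuallyEq (e3.symm)).unique e2
  have h3 : deriv H 0 = 0 := by linarith
  simp only [hl', hl0, add_zero, sub_zero, hG1, h3, zero_mul] at e4
  have hR0 : R (0, 0) = 0 := by simp [R, hΦ0]
  rw [hR0, zero_mul, add_zero] at e4
  exact mul_ne_zero hRx0 hb0 e4.symm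

end ButterflyContact

theorem cubicContact_of_aequiv_fCS1p {G H : ℝ → ℝ} (hG : ContDiff ℝ ∞ G) (hH : ContDiff ℝ ∞ H)
    (hG0 : G 0 = 0) (hH0 : H 0 = 0) (h : AEquiv (stdSurf G H) (0, 0) fCS1p (0, 0)) :
    CubicContact G H := by
  obtain ⟨Φ, Ψ, N, hΦ, hΨ, hN, hΦ0, hNΨ, hev, ha0, hb0, hx0, hN0⟩ :=
    h.stdSurf_elim hG hH hG0 hH0 contDiff_fCS1p (fun v => by rw [fderiv_fCS1p]; simp)
  have hl0 : stdDensity G H (0, 0) = 0 := by simp [stdDensity, hG0, hH0]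
  have hl := contDiff_stdDensity hG hH
  have hl' := fderiv_stdDensity hG hH
  have hs := contDiff_stdSlope hG hH
  have hs' := fderiv_stdSlope hG hH
  have hS := contDiff_stdSurf hG hH
  have hS' := fderiv_stdSurf_snd hG hH
  have hS0 := stdSurf_zero G H
  have hδ : ∀ t, G t - H t = stdDensity G H (t, 0) := fun t => by simp [stdDensity]
  set l := stdDensity G H
  set s := stdSlope G H
  set S := stdSurf G H
  have hn : (∞ : WithTop ℕ∞) ≠ 0 := by simp
  let b : R2 → ℝ := fun q => (fderiv ℝ Φ q (0, 1)).2
  let B : R2 → ℝ := fun q => (N q).2.1 / 2 * (3 * (Φ q).1 ^ 2 + 5 * (Φ q).2 ^ 2)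
    + 2 * (Φ q).2 ^ 2 * (Φ q).1 * (N q).1
  have hdΦ := contDiff_fderiv_apply hΦ (0, 1)
  have hb : ContDiff ℝ ∞ b := contDiff_snd.comp hdΦ
  have hB : ContDiff ℝ ∞ B := by fun_prop
  have hφ2 : ContDiff ℝ ∞ fun q => (Φ q).2 := contDiff_snd.comp hΦ
  have eq1 : ∀ᶠ q in 𝓝 ((0, 0) : R2), (fderiv ℝ Φ q (0, 1)).1 = l q * (N q).1 := by
    filter_upwards [hev] with q hq
    rw [fderiv_fCS1p] at hq
    exact congrArg Prod.fst hq
  have eq2 : ∀ᶠ q in 𝓝 ((0, 0) : R2), 2 * (Φ q).2 * b q = l q * (N q).2.1 := by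
    filter_upwards [hev] with q hq
    rw [fderiv_fCS1p] at hq
    exact congrArg (fun z => z.2.1) hq
  have hbne : ∀ᶠ q in 𝓝 ((0, 0) : R2), b q ≠ 0 := hb.continuous.continuousAt.eventually_ne hb0
  have hA : ∀ᶠ q in 𝓝 ((0, 0) : R2), (N q).2.2 - (Φ q).2 * B q = 0 := by
    refine eventually_eq_zero_of_mul_eq_zero hφ2 (by fun_prop) (v := (0, 1)) ?_ ?_
    · rwa [(hasDerivAt_slice_snd hφ2 0 0).unique (hasDerivAt_slice_snd_snd hΦ 0 0)]
    · filter_upwards [hev, eq1, eq2, hbne] with q hq hq1 hq2 hqb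
      rw [fderiv_fCS1p] at hq
      have h3 := congrArg (fun z => z.2.2) hq
      simp only [Prod.smul_snd, smul_eq_mul] at h3
      have hB' : B q = (N q).2.1 / 2 * (3 * (Φ q).1 ^ 2 + 5 * (Φ q).2 ^ 2)
        + 2 * (Φ q).2 ^ 2 * (Φ q).1 * (N q).1 := rfl
      have hb' : b q = (fderiv ℝ Φ q (0, 1)).2 := rfl
      have h4 : l q * ((N q).2.2 - (Φ q).2 * B q) = 0 := by
        rw [← hb', hq1] at h3
        rw [hB']
        linear_combination -h3 + (Φ q).2 / 2 * (3 * (Φ q).1 ^ 2 + 5 * (Φ q).2 ^ 2) * hq2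
      have h5 : b q * ((Φ q).2 * ((N q).2.2 - (Φ q).2 * B q)) = 0 := by
        linear_combination (N q).2.1 / 2 * h4 + ((N q).2.2 - (Φ q).2 * B q) / 2 * hq2
      exact (mul_eq_zero.1 h5).resolve_left hqb
  obtain ⟨hN2, hΨ33⟩ := hN0 (by simpa [hΦ0] using hA.self_of_nhds)
  let M : R2 → R3 := fun q => fderiv ℝ (fderiv ℝ Ψ) (S q) (0, 1, s q) (0, 1, s q)
  let P : R2 → R3 := fun q => fderiv ℝ Ψ (S q) (0, 0, 1)
  have hΨ1 : ContDiff ℝ ∞ (fderiv ℝ Ψ) := hΨ.fderiv_right (by simp)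
  have hΨ2 : ContDiff ℝ ∞ (fderiv ℝ (fderiv ℝ Ψ)) := hΨ1.fderiv_right (by simp)
  have hvs : ContDiff ℝ ∞ fun q => ((0, 1, s q) : R3) := by fun_prop
  have hM : ContDiff ℝ ∞ M := ((hΨ2.comp hS).clm_apply hvs).clm_apply hvs
  have hP : ContDiff ℝ ∞ P := (hΨ1.comp hS).clm_apply contDiff_const
  have hNy : ∀ q : R2, HasDerivAt (fun y => N (q.1, y))
      (l q • M q + fderiv ℝ s q (0, 1) • P q) q.2 := by
    intro q
    have h1 := (hΨ1.differentiable hn (S q)).hasFDerivAt.comp_hasDerivAt q.2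
      (hasDerivAt_slice_snd hS q.1 q.2)
    have h2 := (hasDerivAt_const q.2 (0 : ℝ)).prodMk
      ((hasDerivAt_const q.2 (1 : ℝ)).prodMk (hasDerivAt_slice_snd hs q.1 q.2))
    have h3 := h1.clm_apply h2
    rw [funext hNΨ]
    refine h3.congr_deriv ?_
    have h4 : ((0, 0, fderiv ℝ s q (0, 1)) : R3) = fderiv ℝ s q (0, 1) • (0, 0, 1) := by
      ext <;> simp
    change fderiv ℝ (fderiv ℝ Ψ) (S q) (fderiv ℝ S q (0, 1)) (0, 1, s q)
      + fderiv ℝ Ψ (S q) (0, 0, fderiv ℝ s q (0, 1)) = _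
    rw [h4, hS', map_smul, map_smul]
    rfl
  have c0 := hΦ.continuous
  have c1 := hb.continuous
  have c2 := hM.continuous
  have c3 := hN.continuous
  have c4 := hP.continuous
  have c5 := (contDiff_fderiv_apply hB (0, 1)).continuous
  have cs : Continuous fun t : ℝ => ((t, 0) : R2) := by fun_prop
  have d0 := c0.comp cs
  have d1 := c1.comp cs
  have d2 := c2.comp cs
  have d3 := c3.comp cs
  have d4 := c4.comp cs
  have d5 := c5.comp cs
  simp only [Function.comp_def] at d0 d1 d2 d3 d4 d5
  obtain ⟨d, hd, hd0, hGd, -⟩ := exists_eq_cube_mul (δ := fun t => G t - H t)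
    (w := fun t => (Φ (t, 0)).1) (k := fun t => 2 * b (t, 0) * (P (t, 0)).2.2)
    (c := fun t => 3 * b (t, 0) ^ 2 * (N (t, 0)).2.1)
    (e := fun t => 5 / 2 * (Φ (t, 0)).2 * b (t, 0) * (N (t, 0)).2.1 ^ 2
      + 2 * b (t, 0) * (Φ (t, 0)).2 * (Φ (t, 0)).1 * (N (t, 0)).1 * (N (t, 0)).2.1
      + (N (t, 0)).2.1 * fderiv ℝ B (t, 0) (0, 1) - 2 * b (t, 0) * (M (t, 0)).2.2) (hG.sub hH)
    (contDiff_fst.comp (hΦ.comp (contDiff_id.prodMk contDiff_const)))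
    (by fun_prop) (by fun_prop) (by fun_prop) (by simp [hG0, hH0]) (by simp [hΦ0])
    (by rw [(hasDerivAt_slice_fst_fst hΦ 0 0).deriv]; exact hx0)
    (mul_ne_zero (mul_ne_zero two_ne_zero hb0) (by simpa [P, hS0] using hΨ33))
    (mul_ne_zero (mul_ne_zero three_ne_zero (pow_ne_zero 2 hb0)) hN2) (by
      filter_upwards [(tendsto_slice_fst 0).eventually hA.eventually_nhds,
        (tendsto_slice_fst 0).eventually eq2] with t ht ht2
      have e1 : HasDerivAt (fun y => (N (t, y)).2.2) _ 0 :=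
        (hasFDerivAt_snd (𝕜 := ℝ) (E := ℝ) (F := ℝ)).comp_hasDerivAt 0
          ((hasFDerivAt_snd (𝕜 := ℝ) (E := ℝ) (F := ℝ × ℝ)).comp_hasDerivAt 0 (hNy (t, 0)))
      have e2 := (hasDerivAt_slice_snd_snd hΦ t 0).mul (hasDerivAt_slice_snd hB t 0)
      have e3 : (fun y => (N (t, y)).2.2) =ᶠ[𝓝 0] fun y => (Φ (t, y)).2 * B (t, y) := by
        filter_upwards [(tendsto_slice_snd t).eventually ht] with y hy
        linarith
      have e4 := (e1.congr_of_eventuallyEq (e3.symm)).unique e2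
      have e5 : deriv (fun t => G t - H t) t = fderiv ℝ s (t, 0) (0, 1) := by
        rw [((hG.differentiable hn t).hasDerivAt.fun_sub
          (hH.differentiable hn t).hasDerivAt).deriv, hs']
        simp
        ring
      rw [e5, hδ]
      have e7 : (fderiv ℝ Φ (t, 0) (0, 1)).2 = b (t, 0) := rfl
      have e8 : B (t, 0) = (N (t, 0)).2.1 / 2 * (3 * (Φ (t, 0)).1 ^ 2 + 5 * (Φ (t, 0)).2 ^ 2)
        + 2 * (Φ (t, 0)).2 ^ 2 * (Φ (t, 0)).1 * (N (t, 0)).1 := rfl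
      rw [e7] at e4
      simp only [ContinuousLinearMap.coe_snd', Prod.snd_add, Prod.smul_snd, smul_eq_mul] at e4
      linear_combination 2 * b (t, 0) * e4 + 2 * b (t, 0) ^ 2 * e8
        + (fderiv ℝ B (t, 0) (0, 1) + 5 / 2 * (Φ (t, 0)).2 * b (t, 0) * (N (t, 0)).2.1
          + 2 * b (t, 0) * (Φ (t, 0)).2 * (Φ (t, 0)).1 * (N (t, 0)).1) * ht2)
  refine ⟨fun hG1 => ?_, d, hd, hd0, hGd⟩
  have h1 := CubicContact.deriv_eq hG hH hd hGd
  rw [hG1] at h1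
  have e1 := (hasDerivAt_slice_snd hl 0 0).mul
    ((hasFDerivAt_fst (𝕜 := ℝ) (E := ℝ) (F := ℝ)).comp_hasDerivAt 0
      ((hasFDerivAt_snd (𝕜 := ℝ) (E := ℝ) (F := ℝ × ℝ)).comp_hasDerivAt 0
        (hasDerivAt_slice_snd hN 0 0)))
  have e2 := ((hasDerivAt_slice_snd_snd hΦ 0 0).const_mul 2).mul (hasDerivAt_slice_snd hb 0 0)
  have e3 : (fun t => 2 * (Φ (0, t)).2 * b (0, t)) =ᶠ[𝓝 0] fun t => l (0, t) * (N (0, t)).2.1 :=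
    (tendsto_slice_snd 0).eventually eq2
  have e4 := (e1.congr_of_eventuallyEq e3).unique e2
  simp only [hl', hl0, add_zero, sub_zero, hG1, h1, zero_mul, hΦ0, mul_zero] at e4
  exact mul_ne_zero (mul_ne_zero two_ne_zero hb0) hb0 e4.symm

theorem exists_eq_pow_succ_mul {D c : ℝ → ℝ} (hD : ContDiff ℝ ∞ D) (hc : ContDiff ℝ ∞ c)
    (hD0 : D 0 = 0) (n : ℕ) (h : ∀ t, deriv D t = t ^ n * c t) :
    ∃ m : ℝ → ℝ, ContDiff ℝ ∞ m ∧ (∀ t, D t = t ^ (n + 1) * m t) ∧ m 0 = c 0 / (n + 1) := by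
  refine ⟨fun t => ∫ θ in (0 : ℝ)..1, θ ^ n * c (θ * t),
    contDiff_paramIntegral (g := fun z : ℝ × ℝ => z.1 ^ n * c (z.1 * z.2)) (by fun_prop) 0 1,
    fun t => ?_, ?_⟩
  · have h1 : ∀ θ ∈ Set.uIcc (0 : ℝ) 1, HasDerivAt (fun θ => D (θ * t))
        (t ^ (n + 1) * (θ ^ n * c (θ * t))) θ := by
      intro θ _
      have h2 : HasDerivAt (fun θ : ℝ => θ * t) t θ := by
        simpa using (hasDerivAt_id θ).mul_const t
      refine ((hD.differentiable (by simp) (θ * t)).hasDerivAt.comp θ h2).congr_deriv ?_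
      rw [h]
      ring
    have hcont : Continuous fun θ : ℝ => θ ^ n * c (θ * t) := by fun_prop
    have h3 := intervalIntegral.integral_eq_sub_of_hasDerivAt h1
      ((continuous_const.mul hcont).intervalIntegrable _ _)
    rw [intervalIntegral.integral_const_mul] at h3
    rw [h3]
    simp [hD0]
  · simp
    ring

theorem exists_fibre_inverse {W : R2 → ℝ} (hW : ContDiff ℝ ∞ W) (hW0 : W (0, 0) = 0)
    (hWy : fderiv ℝ W (0, 0) (0, 1) ≠ 0) : ∃ η : R2 → ℝ, ContDiff ℝ ∞ η ∧ η (0, 0) = 0 ∧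
      (∀ᶠ q in 𝓝 ((0, 0) : R2), η (q.1, W q) = q.2) ∧
      ∀ᶠ q in 𝓝 ((0, 0) : R2), W (q.1, η q) = q.2 := by
  let T : R2 → R2 := fun q => (q.1, W q)
  have hT : ContDiff ℝ ∞ T := by fun_prop
  have hd : HasFDerivAt T ((ContinuousLinearMap.fst ℝ ℝ ℝ).prod (fderiv ℝ W (0, 0))) (0, 0) :=
    hasFDerivAt_fst.prodMk (hW.differentiable (by simp) _).hasFDerivAt
  have hloc : IsLocalDiffeoAt T (0, 0) := by
    refine isLocalDiffeoAt_of_injective hT ?_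
    rw [hd.fderiv, injective_iff_map_eq_zero]
    rintro ⟨a, b⟩ hab
    simp only [ContinuousLinearMap.prod_apply, ContinuousLinearMap.coe_fst',
      Prod.mk_eq_zero] at hab
    obtain ⟨rfl, h2⟩ := hab
    have : ((0, b) : R2) = b • (0, 1) := by simp
    rw [this, map_smul, smul_eq_mul] at h2
    simp [(mul_eq_zero.1 h2).resolve_right hWy]
  obtain ⟨g, hg, -, hg0, h1, h2⟩ := hloc.exists_global_symm
  have hT0 : T (0, 0) = (0, 0) := by simp [T, hW0]
  rw [hT0] at hg0 h2
  refine ⟨fun q => (g q).2, contDiff_snd.comp hg, by simp [hg0], ?_, ?_⟩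
  · filter_upwards [h1] with q hq
    exact congrArg Prod.snd hq
  · filter_upwards [h2] with q hq
    have h3 : (T (g q)).1 = q.1 := congrArg Prod.fst hq
    have h4 : (T (g q)).2 = q.2 := congrArg Prod.snd hq
    simp only [T] at h3 h4
    have h5 : (q.1, (g q).2) = g q := Prod.ext h3.symm rfl
    rw [h5, h4]

/-- Morse lemma in one variable with one parameter. -/
theorem exists_morse {P : R2 → ℝ} (hP : ContDiff ℝ ∞ P) (h1 : fderiv ℝ P (0, 0) (0, 1) = 0)
    (h2 : 0 < fderiv ℝ (fun q => fderiv ℝ P q (0, 1)) (0, 0) (0, 1)) :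
    ∃ (p : ℝ → ℝ) (W : R2 → ℝ), ContDiff ℝ ∞ p ∧ ContDiff ℝ ∞ W ∧ W (0, 0) = 0 ∧
      fderiv ℝ W (0, 0) (0, 1) ≠ 0 ∧ ∀ᶠ q in 𝓝 ((0, 0) : R2), P q = p q.1 + W q ^ 2 := by
  have hn : (∞ : WithTop ℕ∞) ≠ 0 := by simp
  have hPy := contDiff_fderiv_apply hP (0, 1)
  obtain ⟨σ, hσ, hσ0, hσP⟩ := exists_implicit (R := fun q : ℝ × ℝ => fderiv ℝ P q (0, 1)) hPy h1
    (by
      intro v hv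
      have : ((0, v) : R2) = v • (0, 1) := by simp
      rw [this, map_smul, smul_eq_mul] at hv
      exact (mul_eq_zero.1 hv).resolve_right h2.ne')
  have hPs : ContDiff ℝ ∞ fun z : ℝ × ℝ => P (z.2, z.1) := by fun_prop
  obtain ⟨g, hg, hPg, hgσ⟩ := exists_hadamard hPs hσ
  obtain ⟨e, he, hge, -⟩ := exists_hadamard hg hσ
  have hgσ0 : ∀ᶠ x in 𝓝 (0 : ℝ), g (σ x, x) = 0 := by
    filter_upwards [hσP] with x hx
    rw [hgσ, (hasDerivAt_slice_snd hP x (σ x)).deriv, hx]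
  have hPe : ∀ᶠ x in 𝓝 (0 : ℝ), ∀ t, P (x, t) = P (x, σ x) + (t - σ x) ^ 2 * e (t, x) := by
    filter_upwards [hgσ0] with x hx t
    have a1 := hPg t x
    have a2 := hge t x
    simp only at a1
    rw [hx] at a2
    linear_combination a1 + (t - σ x) * a2
  have he0 : 0 < e (0, 0) := by
    have b1 : ∀ t, P (0, t) = P (0, 0) + t ^ 2 * e (t, 0) := fun t => by
      simpa [hσ0] using hPe.self_of_nhds t
    have he' : ∀ t, HasDerivAt (fun t => e (t, 0)) (fderiv ℝ e (t, 0) (1, 0)) t := fun t =>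
      hasDerivAt_slice_fst he t 0
    have b2 : ∀ t, fderiv ℝ P (0, t) (0, 1)
        = t * (2 * e (t, 0) + t * fderiv ℝ e (t, 0) (1, 0)) := by
      intro t
      have b3 := (((hasDerivAt_pow 2 t).mul (he' t)).const_add (P (0, 0)))
      have b4 := hasDerivAt_slice_snd hP 0 t
      rw [funext b1] at b4
      rw [b4.unique b3]
      push_cast
      ring
    have b5 := hasDerivAt_slice_snd hPy 0 0
    rw [funext b2] at b5
    have b7 := b5.unique <| (hasDerivAt_id (0 : ℝ)).mul (((he' 0).const_mul 2).add
      ((hasDerivAt_id (0 : ℝ)).mul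
        (hasDerivAt_slice_fst (contDiff_fderiv_apply he (1, 0)) 0 0)))
    simp only [id, one_mul, zero_mul, add_zero] at b7
    rw [b7] at h2
    linarith
  obtain ⟨r, hr, hre⟩ := exists_contDiff_eventuallyEq (f := fun q : R2 => √(e (q.2, q.1)))
    (p := (0, 0)) (by
      have hc : ContinuousAt (fun q : R2 => e (q.2, q.1)) (0, 0) :=
        (he.continuous.comp (by fun_prop : Continuous fun q : R2 => (q.2, q.1))).continuousAt
      filter_upwards [hc.eventually_ne he0.ne'] with q hq
      have : ContDiff ℝ ∞ fun q : R2 => e (q.2, q.1) := by fun_prop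
      exact this.contDiffAt.sqrt hq)
  have hr0 : r (0, 0) ≠ 0 := by
    rw [hre.self_of_nhds]
    exact (sqrt_pos.2 he0).ne'
  refine ⟨fun x => P (x, σ x), fun q => (q.2 - σ q.1) * r q, by fun_prop, by fun_prop,
    by simp [hσ0], ?_, ?_⟩
  · have hW : ContDiff ℝ ∞ fun q : R2 => (q.2 - σ q.1) * r q := by fun_prop
    have a1 := ((hasDerivAt_id (0 : ℝ)).sub_const (σ 0)).mul (hasDerivAt_slice_snd hr 0 0)
    rw [(hasDerivAt_slice_snd hW 0 0).unique a1]
    simpa [hσ0] using hr0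
  · have hc : ContinuousAt (fun q : R2 => e (q.2, q.1)) (0, 0) :=
        (he.continuous.comp (by fun_prop : Continuous fun q : R2 => (q.2, q.1))).continuousAt
    filter_upwards [continuousAt_fst.eventually hPe, hre, hc.eventually (lt_mem_nhds he0)]
      with q hq1 hq2 hq3
    rw [hq2, mul_pow, sq_sqrt hq3.le]
    exact hq1 q.2

theorem exists_eq_pow_mul_of_eventually {n : ℕ} : ∀ {f c : ℝ → ℝ}, ContDiff ℝ ∞ f →
    ContinuousAt c 0 → (∀ᶠ t in 𝓝 (0 : ℝ), f t = t ^ n * c t) →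
    ∃ e : ℝ → ℝ, ContDiff ℝ ∞ e ∧ (∀ t, f t = t ^ n * e t) ∧ e 0 = c 0 := by
  induction n with
  | zero =>
    intro f c hf hc h
    exact ⟨f, hf, fun t => by simp, by simpa using h.self_of_nhds⟩
  | succ n ih =>
    intro f c hf hc h
    obtain ⟨g, hg, hfg, -⟩ := exists_hadamard_one hf
    have hf0 : f 0 = 0 := by simpa using h.self_of_nhds
    have hg' : ∀ᶠ t in 𝓝 (0 : ℝ), t ^ 1 * (g t - t ^ n * c t) = 0 := by
      filter_upwards [h] with t ht
      have := hfg t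
      rw [ht, hf0] at this
      linear_combination -this
    have h0 := eq_zero_of_pow_mul_eq_zero (A := fun t => g t - t ^ n * c t)
      (by have := hg.continuous.continuousAt (x := 0); fun_prop) 1 hg'
    obtain ⟨e, he, hge, he0⟩ := ih hg hc (by
      filter_upwards [hg'] with t ht
      rcases eq_or_ne t 0 with rfl | ht0
      · linarith
      · have := (mul_eq_zero.1 ht).resolve_left (by simpa using ht0)
        linarith)
    exact ⟨e, he, fun t => by rw [hfg, hf0, hge]; ring, he0⟩

/-- Normal form of a function with critical line `w = 0` under even-odd splitting. -/
theorem exists_fold_form {Q s : R2 → ℝ} (hQ : ContDiff ℝ ∞ Q) (hs : ContDiff ℝ ∞ s)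
    (h : ∀ᶠ q in 𝓝 ((0, 0) : R2), fderiv ℝ Q q (0, 1) = 2 * q.2 * s q) :
    ∃ (q A k h₁ : R2 → ℝ) (h₀ : ℝ → ℝ), ContDiff ℝ ∞ q ∧ ContDiff ℝ ∞ A ∧ ContDiff ℝ ∞ k ∧
      ContDiff ℝ ∞ h₁ ∧ ContDiff ℝ ∞ h₀ ∧ k (0, 0) = 5 / 2 * h₁ (0, 0) ∧
      (∀ᶠ z in 𝓝 ((0, 0) : R2),
        Q z = q (z.1, z.2 ^ 2) + z.2 ^ 3 * (h₀ z.1 + z.2 ^ 2 * h₁ (z.1, z.2 ^ 2))) ∧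
      ∀ᶠ z in 𝓝 ((0, 0) : R2),
        s z = A (z.1, z.2 ^ 2) + z.2 * (3 / 2 * h₀ z.1 + z.2 ^ 2 * k (z.1, z.2 ^ 2)) := by
  obtain ⟨r, hr, hdiv⟩ := exists_division 1 (E := ℝ) (k := fun z => Q (z.2, z.1)) (by fun_prop)
  have hv : ContDiff ℝ ∞ fun z : R2 => (z.1, (![-z.2, 0] : Fin 2 → ℝ)) := by
    refine contDiff_fst.prodMk (contDiff_pi.2 fun i => ?_)
    fin_cases i
    · simpa using contDiff_snd.neg
    · simpa using contDiff_const
  obtain ⟨q, hq, hqr⟩ : ∃ q : R2 → ℝ, ContDiff ℝ ∞ q ∧ ∀ z, q z = r 0 (z.1, ![-z.2, 0]) :=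
    ⟨_, (hr 0).comp hv, fun z => rfl⟩
  obtain ⟨j, hj, hjr⟩ : ∃ q : R2 → ℝ, ContDiff ℝ ∞ q ∧ ∀ z, q z = r 1 (z.1, ![-z.2, 0]) :=
    ⟨_, (hr 1).comp hv, fun z => rfl⟩
  have hball : ∀ᶠ z in 𝓝 ((0, 0) : R2), ‖z‖ < 1 :=
    continuous_norm.continuousAt.eventually (gt_mem_nhds (by simp))
  have hQj : ∀ᶠ z in 𝓝 ((0, 0) : R2), Q z = q (z.1, z.2 ^ 2) + z.2 * j (z.1, z.2 ^ 2) := by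
    filter_upwards [hball] with z hz
    have h1 : ‖z.1‖ ≤ 1 := (norm_fst_le z).trans hz.le
    have h2 : |z.2| ≤ 1 := (norm_snd_le z).trans hz.le
    have h3 := hdiv z.2 z.1 ![-z.2 ^ 2, 0] h2 h1
      (by
        intro i
        fin_cases i
        · simpa using h2
        · simp)
      (by simp [Fin.sum_univ_two])
    rw [hqr, hjr]
    simpa [mul_comm] using h3
  have hderiv : ∀ {f : R2 → ℝ}, ContDiff ℝ ∞ f → ∀ x w : ℝ,
      HasDerivAt (fun w => f (x, w ^ 2)) (fderiv ℝ f (x, w ^ 2) (0, 1) * (2 * w)) w := by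
    intro f hf x w
    have := (hasDerivAt_slice_snd hf x (w ^ 2)).comp w (hasDerivAt_pow 2 w)
    exact this.congr_deriv (by simp)
  have hj0 : ∀ᶠ x in 𝓝 (0 : ℝ), j (x, 0) = 0 := by
    have h1 := (tendsto_slice_fst (0 : ℝ)).eventually (hQj.eventually_nhds.and h)
    filter_upwards [h1] with x hx
    have h2 : ∀ᶠ w in 𝓝 (0 : ℝ), Q (x, w) = q (x, w ^ 2) + w * j (x, w ^ 2) :=
      (tendsto_slice_snd x).eventually hx.1
    have h3 := (hderiv hq x 0).add ((hasDerivAt_id (0 : ℝ)).mul (hderiv hj x 0))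
    have h4 := (hasDerivAt_slice_snd hQ x 0).unique (h3.congr_of_eventuallyEq h2)
    have h5 := hx.2
    rw [h4] at h5
    simpa using h5
  obtain ⟨h', hh', hjh, -⟩ := exists_hadamard_zero (E := ℝ) (f := fun z => j (z.2, z.1))
    (by fun_prop)
  obtain ⟨h₁', hh₁', hh₁, -⟩ := exists_hadamard_zero (E := ℝ) hh'
  obtain ⟨h₁, hsm, hh₁e⟩ : ∃ h₁ : R2 → ℝ, ContDiff ℝ ∞ h₁ ∧ ∀ x z, h₁' (z, x) = h₁ (x, z) :=
    ⟨fun q => h₁' (q.2, q.1), by fun_prop, fun _ _ => rfl⟩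
  have hQh : ∀ᶠ z in 𝓝 ((0, 0) : R2),
      Q z = q (z.1, z.2 ^ 2) + z.2 ^ 3 * (h' (0, z.1) + z.2 ^ 2 * h₁ (z.1, z.2 ^ 2)) := by
    filter_upwards [hQj, continuousAt_fst.eventually hj0] with z hz1 hz2
    have h3 := hjh (z.2 ^ 2) z.1
    have h4 := hh₁ (z.2 ^ 2) z.1
    rw [hh₁e] at h4
    simp only at h3
    rw [hz1, h3, h4, hz2]
    ring
  have hAsm := contDiff_fderiv_apply hq (0, 1)
  have hksm := contDiff_fderiv_apply hsm (0, 1)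
  refine ⟨q, fun z => fderiv ℝ q z (0, 1), fun z => 5 / 2 * h₁ z + z.2 * fderiv ℝ h₁ z (0, 1), h₁,
    fun x => h' (0, x), hq, hAsm, by fun_prop, hsm, by fun_prop, by simp, hQh, ?_⟩
  have hmul : ∀ᶠ z in 𝓝 ((0, 0) : R2), z.2 * (s z - (fderiv ℝ q (z.1, z.2 ^ 2) (0, 1) + z.2 *
      (3 / 2 * h' (0, z.1) + z.2 ^ 2 * (5 / 2 * h₁ (z.1, z.2 ^ 2) +
        z.2 ^ 2 * fderiv ℝ h₁ (z.1, z.2 ^ 2) (0, 1))))) = 0 := by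
    filter_upwards [hQh.eventually_nhds, h] with ⟨x, w⟩ hx hz
    have hc : Tendsto (fun t => (x, t)) (𝓝 w) (𝓝 ((x, w) : R2)) :=
      (by fun_prop : Continuous fun t : ℝ => (x, t)).continuousAt
    have h2 := hc.eventually hx
    have h3 := (hderiv hq x w).add ((hasDerivAt_pow 3 w).mul
      (((hasDerivAt_pow 2 w).mul (hderiv hsm x w)).const_add (h' (0, x))))
    have h4 := (hasDerivAt_slice_snd hQ x w).unique (h3.congr_of_eventuallyEq h2)
    rw [h4] at hz
    push_cast at hz
    simp only [Pi.mul_apply] at hz ⊢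
    linear_combination -hz / 2
  have hlin : ContDiff ℝ ∞ fun z : R2 => (z.1, z.2 ^ 2) := by fun_prop
  have c1 := (hAsm.comp hlin).continuous
  have c2 := (hksm.comp hlin).continuous
  have c3 := hs.continuous
  have c4 := hsm.continuous
  have c5 := hh'.continuous
  simp only [Function.comp_def] at c1 c2
  have := eventually_eq_zero_of_mul_eq_zero (R := fun z : R2 => z.2) (v := (0, 1))
    contDiff_snd (by fun_prop) (by
      have : HasFDerivAt (fun z : R2 => z.2) (ContinuousLinearMap.snd ℝ ℝ ℝ) (0, 0) :=
        hasFDerivAt_snd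
      rw [this.fderiv]
      simp) hmul
  filter_upwards [this] with z hz
  exact sub_eq_zero.1 hz

theorem aequiv_fCS1p_of_normalForm {f : R2 → R3} {p₀ e : ℝ → ℝ} {W q h : R2 → ℝ}
    (hp : ContDiff ℝ ∞ p₀) (he : ContDiff ℝ ∞ e) (hW : ContDiff ℝ ∞ W) (hq : ContDiff ℝ ∞ q)
    (hh : ContDiff ℝ ∞ h) (hf0 : f (0, 0) = 0) (hW0 : W (0, 0) = 0)
    (hWy : fderiv ℝ W (0, 0) (0, 1) ≠ 0) (hpos : 0 < e 0 * h (0, 0))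
    (hf : ∀ᶠ z in 𝓝 ((0, 0) : R2), f z = (2 * z.1, p₀ z.1 + W z ^ 2,
      q (z.1, W z ^ 2) + W z ^ 3 * (z.1 ^ 2 * e z.1 + W z ^ 2 * h (z.1, W z ^ 2)))) :
    AEquiv f (0, 0) fCS1p (0, 0) := by
  have hp0 : p₀ 0 = 0 := by
    have := congrArg (fun z => z.2.1) hf.self_of_nhds
    simpa [hf0, hW0] using this.symm
  have hq0 : q (0, 0) = 0 := by
    have := congrArg (fun z => z.2.2) hf.self_of_nhds
    simpa [hf0, hW0] using this.symm
  have hne : h (0, 0) ≠ 0 := by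
    intro h0
    simp [h0] at hpos
  have hquot : ∀ᶠ z in 𝓝 ((0, 0) : R2), h z ≠ 0 ∧ 0 < e z.1 / h z := by
    have c1 : ContinuousAt (fun z : R2 => e z.1 / h z) (0, 0) :=
      ((he.continuous.comp continuous_fst).continuousAt).div hh.continuous.continuousAt hne
    refine (hh.continuous.continuousAt.eventually_ne hne).and
      (c1.eventually (lt_mem_nhds ?_))
    have : e 0 / h (0, 0) = e 0 * h (0, 0) / h (0, 0) ^ 2 := by field_simp
    simp only [this]
    positivity
  obtain ⟨κ, hκ, hκe⟩ := exists_contDiff_eventuallyEq (f := fun z : R2 => (h z)⁻¹) (p := (0, 0)) (by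
    filter_upwards [hquot] with z hz
    exact hh.contDiffAt.inv hz.1)
  obtain ⟨ρ, hρ, hρe⟩ := exists_contDiff_eventuallyEq (f := fun z : R2 => √(e z.1 / h z))
    (p := (0, 0)) (by
    filter_upwards [hquot] with z hz
    exact ((he.comp contDiff_fst).contDiffAt.div hh.contDiffAt hz.1).sqrt hz.2.ne')
  have hκ0 : κ (0, 0) ≠ 0 := by
    rw [hκe.self_of_nhds]
    exact inv_ne_zero hne
  have hρ0 : ρ (0, 0) ≠ 0 := by
    rw [hρe.self_of_nhds]
    exact (sqrt_pos.2 hquot.self_of_nhds.2).ne'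
  have hline : ∀ {F : Type} [NormedAddCommGroup F] [NormedSpace ℝ F] (v : F),
      HasDerivAt (fun t : ℝ => t • v) v 0 := fun v => by
    simpa using (hasDerivAt_id (0 : ℝ)).smul_const v
  have hΦ : ContDiff ℝ ∞ fun z : R2 => (z.1 * ρ (z.1, W z ^ 2), W z) := by fun_prop
  have hΨ : ContDiff ℝ ∞ fun X : R3 => (X.1 / 2 * ρ (X.1 / 2, X.2.1 - p₀ (X.1 / 2)),
      X.2.1 - p₀ (X.1 / 2),
      (X.2.2 - q (X.1 / 2, X.2.1 - p₀ (X.1 / 2))) * κ (X.1 / 2, X.2.1 - p₀ (X.1 / 2))) := by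
    fun_prop
  refine AEquiv.of_global _ _ hΦ hΨ ?_ ?_ (by simp [hW0]) ?_
  · rw [injective_iff_map_eq_zero]
    rintro ⟨a, b⟩ hab
    have d0 : HasFDerivAt (fun z : R2 => (z.1 * ρ (z.1, W z ^ 2), W z)) _ ((0 : ℝ) • (a, b)) :=
      (hΦ.differentiable (by simp) _).hasFDerivAt
    have d := d0.comp_hasDerivAt (0 : ℝ) (hline ((a, b) : R2))
    rw [zero_smul, show ((0 : R2)) = (0, 0) from rfl, hab] at d
    have hρW : ContDiff ℝ ∞ fun t : ℝ => ρ (t * a, W (t * a, t * b) ^ 2) := by fun_prop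
    have d1 := (hasFDerivAt_fst (𝕜 := ℝ) (E := ℝ) (F := ℝ)).comp_hasDerivAt (0 : ℝ) d
    have d2 := ((hasDerivAt_id (0 : ℝ)).mul_const a).mul
      (hρW.differentiable (by simp) 0).hasDerivAt
    have d3 := d1.unique d2
    have ha : a = 0 := by simpa [hW0, hρ0] using d3
    subst ha
    have d4 := (hasFDerivAt_snd (𝕜 := ℝ) (E := ℝ) (F := ℝ)).comp_hasDerivAt (0 : ℝ) d
    have d5 := (hasDerivAt_slice_snd hW 0 (0 * b)).comp (0 : ℝ) ((hasDerivAt_id (0 : ℝ)).mul_const b)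
    have d6 : HasDerivAt (fun t : ℝ => W (t * 0, t * b)) 0 0 := d4
    simp only [mul_zero] at d6
    have d8 := d6.unique d5
    have hb : b = 0 := by simpa [hWy] using d8
    rw [hb]
    rfl
  · rw [hf0, injective_iff_map_eq_zero]
    rintro ⟨a, b, c⟩ hab
    have d0 := (hΨ.differentiable (by simp) ((0 : ℝ) • (a, b, c))).hasFDerivAt
    have d := d0.comp_hasDerivAt (0 : ℝ) (hline ((a, b, c) : R3))
    rw [zero_smul, hab] at d
    have d1 : HasDerivAt (fun t : ℝ => t * a / 2 * ρ (t * a / 2, t * b - p₀ (t * a / 2))) 0 0 :=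
      (hasFDerivAt_fst (𝕜 := ℝ) (E := ℝ) (F := R2)).comp_hasDerivAt (0 : ℝ) d
    have d' := (hasFDerivAt_snd (𝕜 := ℝ) (E := ℝ) (F := R2)).comp_hasDerivAt (0 : ℝ) d
    have d2 : HasDerivAt (fun t : ℝ => t * b - p₀ (t * a / 2)) 0 0 :=
      (hasFDerivAt_fst (𝕜 := ℝ) (E := ℝ) (F := ℝ)).comp_hasDerivAt (0 : ℝ) d'
    have d3 : HasDerivAt (fun t : ℝ => (t * c - q (t * a / 2, t * b - p₀ (t * a / 2))) *
        κ (t * a / 2, t * b - p₀ (t * a / 2))) 0 0 :=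
      (hasFDerivAt_snd (𝕜 := ℝ) (E := ℝ) (F := ℝ)).comp_hasDerivAt (0 : ℝ) d'
    have hρW : ContDiff ℝ ∞ fun t : ℝ => ρ (t * a / 2, t * b - p₀ (t * a / 2)) := by fun_prop
    have e1 := d1.unique ((((hasDerivAt_id (0 : ℝ)).mul_const a).div_const 2).mul
      (hρW.differentiable (by simp) 0).hasDerivAt)
    have ha : a = 0 := by simpa [hp0, hρ0] using e1
    subst ha
    simp only [mul_zero, zero_div, hp0, sub_zero] at d2 d3
    have hb : b = 0 := by simpa using (d2.unique ((hasDerivAt_id (0 : ℝ)).mul_const b)).symm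
    subst hb
    simp only [mul_zero, hq0, sub_zero] at d3
    have e3 := d3.unique (((hasDerivAt_id (0 : ℝ)).mul_const c).mul_const (κ (0, 0)))
    have hc : c = 0 := by simpa [hκ0] using e3
    rw [hc]
    rfl
  · have ht : Tendsto (fun z : R2 => (z.1, W z ^ 2)) (𝓝 (0, 0)) (𝓝 (0, 0)) := by
      have := (by fun_prop : Continuous fun z : R2 => (z.1, W z ^ 2)).tendsto (0, 0)
      simpa [hW0] using this
    filter_upwards [hf, ht.eventually hκe, ht.eventually hρe, ht.eventually hquot]
      with z hz1 hz2 hz3 hz4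
    have hr : ρ (z.1, W z ^ 2) ^ 2 = e z.1 / h (z.1, W z ^ 2) := by
      rw [hz3, sq_sqrt hz4.2.le]
    have h2 : 2 * z.1 / 2 = z.1 := by ring
    simp only [hz1, fCS1p, h2, add_sub_cancel_left, hz2, mul_pow, hr]
    have := hz4.1
    refine Prod.ext rfl (Prod.ext rfl ?_)
    simp only
    field_simp

theorem exists_stdSurf_eq {G H : ℝ → ℝ} (hG : ContDiff ℝ ∞ G) (hH : ContDiff ℝ ∞ H) :
    ∃ P Q : R2 → ℝ, ContDiff ℝ ∞ P ∧ ContDiff ℝ ∞ Q ∧ P (0, 0) = 0 ∧ Q (0, 0) = 0 ∧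
      (∀ z, stdSurf G H z = (2 * z.1, P z, Q z)) ∧
      (∀ z, fderiv ℝ P z (0, 1) = stdDensity G H z) ∧
      ∀ z, fderiv ℝ Q z (0, 1) = stdDensity G H z * stdSlope G H z := by
  have hn : (∞ : WithTop ℕ∞) ≠ 0 := by simp
  have hS := contDiff_stdSurf hG hH
  obtain ⟨P, hP, hPe⟩ : ∃ P : R2 → ℝ, ContDiff ℝ ∞ P ∧ ∀ z, P z = (stdSurf G H z).2.1 :=
    ⟨_, contDiff_fst.comp (contDiff_snd.comp hS), fun _ => rfl⟩
  obtain ⟨Q, hQ, hQe⟩ : ∃ Q : R2 → ℝ, ContDiff ℝ ∞ Q ∧ ∀ z, Q z = (stdSurf G H z).2.2 :=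
    ⟨_, contDiff_snd.comp (contDiff_snd.comp hS), fun _ => rfl⟩
  have hslice : ∀ x y, HasDerivAt (fun t => (stdSurf G H (x, t)).2)
      (stdDensity G H (x, y) • (1, stdSlope G H (x, y))) y := by
    intro x y
    have h1 := (hS.differentiable hn (x, y)).hasFDerivAt
    have h2 : HasDerivAt (fun t : ℝ => ((x, t) : R2)) (0, 1) y :=
      (hasDerivAt_const y x).prodMk (hasDerivAt_id y)
    have h3 := (hasFDerivAt_snd (𝕜 := ℝ) (E := ℝ) (F := R2)).comp_hasDerivAt y
      (h1.comp_hasDerivAt y h2)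
    rw [fderiv_stdSurf_snd hG hH] at h3
    exact h3
  refine ⟨P, Q, hP, hQ, by simp [hPe], by simp [hQe], fun z => by rw [hPe, hQe]; rfl, ?_, ?_⟩
  · rintro ⟨x, y⟩
    have h2 : HasDerivAt (fun t => (stdSurf G H (x, t)).2.1) _ y :=
      (hasFDerivAt_fst (𝕜 := ℝ) (E := ℝ) (F := ℝ)).comp_hasDerivAt y (hslice x y)
    simp only [← hPe] at h2
    rw [(hasDerivAt_slice_snd hP x y).unique h2]
    simp
  · rintro ⟨x, y⟩
    have h2 : HasDerivAt (fun t => (stdSurf G H (x, t)).2.2) _ y :=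
      (hasFDerivAt_snd (𝕜 := ℝ) (E := ℝ) (F := ℝ)).comp_hasDerivAt y (hslice x y)
    simp only [← hQe] at h2
    rw [(hasDerivAt_slice_snd hQ x y).unique h2]
    simp

theorem exists_fold_coeff_eq_sq_mul {G H d h₀ : ℝ → ℝ} {W A k : R2 → ℝ} (hG : ContDiff ℝ ∞ G)
    (hH : ContDiff ℝ ∞ H) (hd : ContDiff ℝ ∞ d) (hh₀ : ContDiff ℝ ∞ h₀) (hW : ContDiff ℝ ∞ W)
    (hA : ContDiff ℝ ∞ A) (hk : ContDiff ℝ ∞ k) (hGH : ∀ t, G t - H t = t ^ 3 * d t)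
    (hWy : fderiv ℝ W (0, 0) (0, 1) ≠ 0)
    (hl : ∀ᶠ z in 𝓝 ((0, 0) : R2), stdDensity G H z = 2 * W z * fderiv ℝ W z (0, 1))
    (hs : ∀ᶠ z in 𝓝 ((0, 0) : R2), stdSlope G H z =
      A (z.1, W z ^ 2) + W z * (3 / 2 * h₀ z.1 + W z ^ 2 * k (z.1, W z ^ 2))) :
    ∃ e : ℝ → ℝ, ContDiff ℝ ∞ e ∧ (∀ t, h₀ t = t ^ 2 * e t) ∧
      e 0 = 2 * d 0 / fderiv ℝ W (0, 0) (0, 1) := by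
  have hn : (∞ : WithTop ℕ∞) ≠ 0 := by simp
  have hWc := hW.continuous
  have hWyc : Continuous fun t : ℝ => fderiv ℝ W (t, 0) (0, 1) :=
    (contDiff_fderiv_apply hW (0, 1)).continuous.comp
      (by fun_prop : Continuous fun t : ℝ => ((t, 0) : R2))
  have hl0 := (tendsto_slice_fst (0 : ℝ)).eventually hl
  have hs0 := (tendsto_slice_fst (0 : ℝ)).eventually hs.eventually_nhds
  have hne := hWyc.continuousAt.eventually_ne hWy
  let w : ℝ → ℝ := fun t => d t / (2 * fderiv ℝ W (t, 0) (0, 1))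
  have hw : ∀ᶠ t in 𝓝 (0 : ℝ), W (t, 0) = t ^ 3 * w t := by
    filter_upwards [hl0, hne] with t h1 h2
    simp only [stdDensity, add_zero, sub_zero, hGH] at h1
    simp only [w]
    field_simp
    linear_combination -h1
  have hwc : ContinuousAt w 0 := hd.continuous.continuousAt.div
    (continuousAt_const.mul hWyc.continuousAt) (by simpa using hWy)
  let B : ℝ → ℝ := fun t => 2 * fderiv ℝ A (t, W (t, 0) ^ 2) (0, 1) + 3 * W (t, 0) *
    k (t, W (t, 0) ^ 2) + 2 * W (t, 0) ^ 3 * fderiv ℝ k (t, W (t, 0) ^ 2) (0, 1)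
  have hBc : Continuous B := by
    have c0 : Continuous fun t : ℝ => ((t, W (t, 0) ^ 2) : R2) := by fun_prop
    have c1 := (contDiff_fderiv_apply hA (0, 1)).continuous.comp c0
    have c2 := (contDiff_fderiv_apply hk (0, 1)).continuous.comp c0
    have c3 := hk.continuous
    simp only [Function.comp_def] at c1 c2
    fun_prop
  have hmain : ∀ᶠ t in 𝓝 (0 : ℝ), h₀ t = t ^ 2 * (2 / 3 * ((3 * d t + t * deriv d t) /
      fderiv ℝ W (t, 0) (0, 1) - t * w t * B t)) := by
    filter_upwards [hs0, hne, hw] with t h1 h2 h3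
    have h4 : ∀ᶠ y in 𝓝 (0 : ℝ), stdSlope G H (t, y) = A (t, W (t, y) ^ 2) +
        W (t, y) * (3 / 2 * h₀ t + W (t, y) ^ 2 * k (t, W (t, y) ^ 2)) :=
      (tendsto_slice_snd t).eventually h1
    have w1 := hasDerivAt_slice_snd hW t 0
    have w2 : HasDerivAt (fun y => W (t, y) ^ 2)
        (2 * W (t, 0) * fderiv ℝ W (t, 0) (0, 1)) 0 := by
      refine (w1.pow 2).congr_deriv ?_
      simp
    have w3 := (hasDerivAt_slice_snd hA t (W (t, 0) ^ 2)).comp (0 : ℝ) w2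
    have w4 := (hasDerivAt_slice_snd hk t (W (t, 0) ^ 2)).comp (0 : ℝ) w2
    have w5 := w3.add (w1.mul ((w2.mul w4).const_add (3 / 2 * h₀ t)))
    have w6 := (hasDerivAt_slice_snd (contDiff_stdSlope hG hH) t 0).unique
      (w5.congr_of_eventuallyEq h4)
    rw [fderiv_stdSlope hG hH] at w6
    simp only [Pi.mul_apply, Function.comp_apply] at w6
    have w7 : deriv G t - deriv H t = 3 * t ^ 2 * d t + t ^ 3 * deriv d t := by
      have u1 := (hG.differentiable hn t).hasDerivAt.sub (hH.differentiable hn t).hasDerivAt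
      have u2 := (hasDerivAt_pow 3 t).mul (hd.differentiable hn t).hasDerivAt
      have u3 : G - H = (fun t => t ^ 3) * d := funext hGH
      rw [u3] at u1
      simpa using u1.unique u2
    have w8 : t ^ 2 * (3 * d t + t * deriv d t) = fderiv ℝ W (t, 0) (0, 1) *
        (3 / 2 * h₀ t + W (t, 0) * B t) := by
      simp only [B]
      ring_nf at w6 w7 ⊢
      linear_combination w6 - w7
    rw [h3] at w8
    field_simp
    linear_combination -2 * w8
  obtain ⟨e, he, h1, h2⟩ := exists_eq_pow_mul_of_eventually hh₀ (by
    have c1 := hd.continuous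
    have c2 : Continuous (deriv d) := hd.continuous_deriv (by simp)
    have c3 : ContinuousAt (fun t => (3 * d t + t * deriv d t) / fderiv ℝ W (t, 0) (0, 1)) 0 :=
      ContinuousAt.div (by fun_prop) hWyc.continuousAt hWy
    fun_prop) hmain
  refine ⟨e, he, h1, ?_⟩
  rw [h2]
  ring

theorem fold_coeff_eq {G H d : ℝ → ℝ} {h c : ℝ} {P W A k : R2 → ℝ} (hd : ContDiff ℝ ∞ d)
    (hP : ContDiff ℝ ∞ P) (hW : ContDiff ℝ ∞ W)
    (hA : ContDiff ℝ ∞ A) (hk : ContDiff ℝ ∞ k) (hGH : ∀ t, G t - H t = t ^ 3 * d t)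
    (hW0 : W (0, 0) = 0) (hPy : ∀ z, fderiv ℝ P z (0, 1) = stdDensity G H z)
    (hPW : ∀ᶠ z in 𝓝 ((0, 0) : R2), z.1 = 0 → P z = c + W z ^ 2) (hh : h = 0)
    (hs : ∀ᶠ z in 𝓝 ((0, 0) : R2), z.1 = 0 → stdSlope G H z =
      A (z.1, W z ^ 2) + W z * (3 / 2 * h + W z ^ 2 * k (z.1, W z ^ 2))) :
    d 0 = fderiv ℝ W (0, 0) (0, 1) ^ 3 * k (0, 0) := by
  obtain ⟨w, hw, hWw, hw0⟩ := exists_hadamard_one (f := fun y => W (0, y)) (by fun_prop)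
  rw [(hasDerivAt_slice_snd hW 0 0).deriv] at hw0
  simp only [hW0, zero_add] at hWw
  obtain ⟨S, hS, hSA, -⟩ := exists_hadamard (f := fun z : ℝ × ℝ => A (0, z.1)) (σ := id)
    (by fun_prop) contDiff_id
  have hD : ∀ t, HasDerivAt (fun t => P (0, t) - P (0, -t)) (t ^ 3 * (d t - d (-t))) t := by
    intro t
    have h1 := hasDerivAt_slice_snd hP 0 t
    have h2 := (hasDerivAt_slice_snd hP 0 (-t)).comp t (hasDerivAt_neg t)
    refine (h1.sub h2).congr_deriv ?_
    rw [hPy, hPy]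
    simp only [stdDensity, zero_add, zero_sub, neg_neg]
    linear_combination hGH t + hGH (-t)
  obtain ⟨m, hm, hDm, -⟩ := exists_eq_pow_succ_mul (D := fun t => P (0, t) - P (0, -t))
    (c := fun t => d t - d (-t)) (by fun_prop) (by fun_prop) (by simp) 3 fun t => (hD t).deriv
  have ht1 := tendsto_slice_snd (0 : ℝ)
  have ht2 : Tendsto (fun t : ℝ => ((0, -t) : R2)) (𝓝 0) (𝓝 (0, 0)) := by
    have := (by fun_prop : Continuous fun t : ℝ => ((0, -t) : R2)).tendsto 0
    simpa using this
  have hev : ∀ᶠ t in 𝓝 (0 : ℝ), t ^ 3 * (d t + d (-t) - t * m t * S (W (0, t) ^ 2, W (0, -t) ^ 2)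
      - w t ^ 3 * k (0, W (0, t) ^ 2) - w (-t) ^ 3 * k (0, W (0, -t) ^ 2)) = 0 := by
    filter_upwards [ht1.eventually hPW, ht2.eventually hPW, ht1.eventually hs,
      ht2.eventually hs] with t a1 a2 a3 a4
    have b1 := a1 rfl
    have b2 := a2 rfl
    have b3 := a3 rfl
    have b4 := a4 rfl
    have b5 := hDm t
    have b6 := hSA (W (0, t) ^ 2) (W (0, -t) ^ 2)
    have c1 := hWw t
    have c2 := hWw (-t)
    have c3 := hGH t
    have c4 := hGH (-t)
    simp only [stdSlope, zero_add, zero_sub, neg_neg, id, hh] at b1 b2 b3 b4 b5 b6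
    have e1 : W (0, t) ^ 3 = t ^ 3 * w t ^ 3 := by rw [c1]; ring
    have e2 : W (0, -t) ^ 3 = -t ^ 3 * w (-t) ^ 3 := by rw [c2]; ring
    generalize S _ = S' at b6 ⊢
    generalize k (0, W (0, t) ^ 2) = k1 at b3 ⊢
    generalize k (0, W (0, -t) ^ 2) = k2 at b4 ⊢
    linear_combination b3 - b4 - c3 + c4 + b6 + S' * (b5 - b1 + b2) + k1 * e1 - k2 * e2
  have c1 := hd.continuous
  have c2 := hm.continuous
  have c3 := hS.continuous
  have c4 := hw.continuous
  have c5 := hk.continuous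
  have c6 := hW.continuous
  have := eq_zero_of_pow_mul_eq_zero (A := fun t => d t + d (-t)
      - t * m t * S (W (0, t) ^ 2, W (0, -t) ^ 2)
      - w t ^ 3 * k (0, W (0, t) ^ 2) - w (-t) ^ 3 * k (0, W (0, -t) ^ 2))
    (by fun_prop) 3 hev
  simp only [neg_zero, hW0, hw0, ne_eq, OfNat.ofNat_ne_zero, not_false_eq_true, zero_pow,
    zero_mul, sub_zero] at this
  linarith

theorem aequiv_fCS1p_of_cubicContact_of_pos {G H : ℝ → ℝ} (hG : ContDiff ℝ ∞ G)
    (hH : ContDiff ℝ ∞ H) (hG0 : G 0 = 0) (hH0 : H 0 = 0) (h : CubicContact G H)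
    (hpos : 0 < deriv G 0) : AEquiv (stdSurf G H) (0, 0) fCS1p (0, 0) := by
  obtain ⟨-, d, hd, hd0, hGH⟩ := h
  have hder := CubicContact.deriv_eq hG hH hd hGH
  have hs := contDiff_stdSlope hG hH
  obtain ⟨P, Q, hP, hQ, -, -, hS, hPy, hQy⟩ := exists_stdSurf_eq hG hH
  obtain ⟨p₀, W, hp, hW, hW0, hWy, hPW⟩ := exists_morse hP
    (by rw [hPy]; simp [stdDensity, hG0, hH0])
    (by
      rw [funext hPy, fderiv_stdDensity hG hH]
      simp [hder]
      linarith)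
  obtain ⟨η, hη, hη0, hηW, hWη⟩ := exists_fibre_inverse hW hW0 hWy
  have hηt : Tendsto (fun z : R2 => (z.1, η z)) (𝓝 (0, 0)) (𝓝 (0, 0)) := by
    have := (by fun_prop : Continuous fun z : R2 => (z.1, η z)).tendsto (0, 0)
    simpa [hη0] using this
  have hWt : Tendsto (fun z : R2 => (z.1, W z)) (𝓝 (0, 0)) (𝓝 (0, 0)) := by
    have := (by fun_prop : Continuous fun z : R2 => (z.1, W z)).tendsto (0, 0)
    simpa [hW0] using this
  have hηc : ∀ {f : R2 → ℝ}, ContDiff ℝ ∞ f → ∀ x w, HasDerivAt (fun w => f (x, η (x, w)))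
      (fderiv ℝ f (x, η (x, w)) (0, 1) * fderiv ℝ η (x, w) (0, 1)) w := by
    intro f hf x w
    exact (hasDerivAt_slice_snd hf x (η (x, w))).comp w (hasDerivAt_slice_snd hη x w)
  have hslice : ∀ (x w : ℝ) {p : R2 → Prop}, (∀ᶠ z in 𝓝 (x, w), p z) →
      ∀ᶠ t in 𝓝 w, p (x, t) := fun x w p hp =>
    ((by fun_prop : Continuous fun t : ℝ => ((x, t) : R2)).tendsto w).eventually hp
  obtain ⟨q, A, k, h₁, h₀, hq, hA, hk, hh₁, hh₀, hk0, hQf, hsf⟩ :=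
    exists_fold_form (Q := fun z => Q (z.1, η z)) (s := fun z => stdSlope G H (z.1, η z))
    (by fun_prop) (by fun_prop) (by
      filter_upwards [(hηt.eventually hPW).and hWη |>.eventually_nhds] with ⟨x, w⟩ h1
      have h2 : ∀ᶠ t in 𝓝 w, P (x, η (x, t)) = p₀ x + t ^ 2 := by
        filter_upwards [hslice x w h1] with t ht
        have h3 := ht.1
        have h4 := ht.2
        rw [h3, h4]
      have h3 := (hηc hP x w).unique
        (((hasDerivAt_pow 2 w).const_add (p₀ x)).congr_of_eventuallyEq h2)
      have hsm : ContDiff ℝ ∞ fun z : R2 => Q (z.1, η z) := by fun_prop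
      rw [(hasDerivAt_slice_snd hsm x w).unique (hηc hQ x w), hQy]
      rw [hPy] at h3
      simp only at h3 ⊢
      push_cast at h3
      linear_combination (stdSlope G H (x, η (x, w))) * h3)
  have hQz : ∀ᶠ z in 𝓝 ((0, 0) : R2), Q z = q (z.1, W z ^ 2) +
      W z ^ 3 * (h₀ z.1 + W z ^ 2 * h₁ (z.1, W z ^ 2)) := by
    filter_upwards [hWt.eventually hQf, hηW] with z h1 h2
    simpa only [h2] using h1
  have hsz : ∀ᶠ z in 𝓝 ((0, 0) : R2), stdSlope G H z = A (z.1, W z ^ 2) +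
      W z * (3 / 2 * h₀ z.1 + W z ^ 2 * k (z.1, W z ^ 2)) := by
    filter_upwards [hWt.eventually hsf, hηW] with z h1 h2
    simpa only [h2] using h1
  have hlz : ∀ᶠ z in 𝓝 ((0, 0) : R2), stdDensity G H z = 2 * W z * fderiv ℝ W z (0, 1) := by
    filter_upwards [hPW.eventually_nhds] with ⟨x, y⟩ h1
    have h2 := (hasDerivAt_slice_snd hP x y).unique
      ((((hasDerivAt_slice_snd hW x y).pow 2).const_add (p₀ x)).congr_of_eventuallyEq
        (hslice x y h1))
    rw [← hPy, h2]
    simp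
  obtain ⟨e, he, hh₀e, he0⟩ := exists_fold_coeff_eq_sq_mul hG hH hd hh₀ hW hA hk hGH hWy hlz hsz
  have hdk := fold_coeff_eq (h := h₀ 0) (c := p₀ 0) hd hP hW hA hk hGH hW0 hPy
    (by filter_upwards [hPW] with z h1 h2; rw [h1, h2]) (by simp [hh₀e])
    (by filter_upwards [hsz] with z h1 h2; rw [h1, h2])
  refine aequiv_fCS1p_of_normalForm hp he hW hq hh₁ (stdSurf_zero G H) hW0 hWy ?_ ?_
  · rw [hk0] at hdk
    have : e 0 * h₁ (0, 0) = 4 / 5 * (d 0) ^ 2 / fderiv ℝ W (0, 0) (0, 1) ^ 4 := by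
      rw [he0]
      field_simp
      linear_combination -4 * hdk
    rw [this]
    positivity
  · filter_upwards [hPW, hQz] with z h1 h2
    rw [hS, h1, h2, hh₀e]

theorem primitive_neg (G : ℝ → ℝ) (x : ℝ) : primitive (fun t => -G t) x = -primitive G x :=
  intervalIntegral.integral_neg

theorem stdSurf_neg (G H : ℝ → ℝ) (z : R2) : stdSurf (fun t => -G t) (fun t => -H t) z =
    ((stdSurf G H z).1, -(stdSurf G H z).2.1, (stdSurf G H z).2.2) := by
  simp only [stdSurf, primitive_neg, neg_sq]
  refine Prod.ext rfl (Prod.ext ?_ rfl)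
  simp only
  ring

theorem aequiv_fCS1p_of_cubicContact {G H : ℝ → ℝ} (hG : ContDiff ℝ ∞ G)
    (hH : ContDiff ℝ ∞ H) (hG0 : G 0 = 0) (hH0 : H 0 = 0) (h : CubicContact G H) :
    AEquiv (stdSurf G H) (0, 0) fCS1p (0, 0) := by
  rcases h.1.lt_or_gt with hneg | hpos
  · have hG' : ContDiff ℝ ∞ fun t => -G t := hG.neg
    have hH' : ContDiff ℝ ∞ fun t => -H t := hH.neg
    have hd : deriv (fun t => -G t) 0 = -deriv G 0 := deriv.fun_neg
    have h1 := aequiv_fCS1p_of_cubicContact_of_pos hG' hH' (by simp [hG0]) (by simp [hH0])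
      (by
        obtain ⟨hc, d, hd1, hd0, he⟩ := h
        refine ⟨by rw [hd]; simpa using hc, fun t => -d t, hd1.neg, by simpa using hd0, ?_⟩
        intro t
        linear_combination -he t)
      (by rw [hd]; linarith)
    let L : R3 →L[ℝ] R3 := (ContinuousLinearMap.fst ℝ ℝ R2).prod
      ((-(ContinuousLinearMap.fst ℝ ℝ ℝ).comp (ContinuousLinearMap.snd ℝ ℝ R2)).prod
        ((ContinuousLinearMap.snd ℝ ℝ ℝ).comp (ContinuousLinearMap.snd ℝ ℝ R2)))
    have h2 : AEquiv (stdSurf G H) (0, 0) (stdSurf (fun t => -G t) fun t => -H t) (0, 0) := by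
      refine AEquiv.of_global id L contDiff_id L.contDiff (by simp [Function.injective_id]) ?_ rfl
        (.of_forall fun z => (stdSurf_neg G H z).symm)
      rw [L.fderiv, injective_iff_map_eq_zero]
      rintro ⟨a, b, c⟩ hab
      simpa [L, Prod.ext_iff] using hab
    exact h2.trans h1 (contDiff_stdSurf hG hH).continuous.continuousAt
      (contDiff_stdSurf hG' hH').continuous.continuousAt
  · exact aequiv_fCS1p_of_cubicContact_of_pos hG hH hG0 hH0 h hpos

/-- The Malgrange division theorem. -/
theorem exists_malgrange_division {E : Type} [NormedAddCommGroup E] [NormedSpace ℝ E]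
    [FiniteDimensional ℝ E] (n : ℕ) {k : ℝ × E → ℝ} (hk : ContDiff ℝ ∞ k) :
    ∃ (r : Fin (n + 1) → E × (Fin (n + 1) → ℝ) → ℝ) (q : ℝ × E × (Fin (n + 1) → ℝ) → ℝ),
      (∀ i, ContDiff ℝ ∞ (r i)) ∧ ContDiff ℝ ∞ q ∧
      ∀ᶠ p in 𝓝 (0 : ℝ × E × (Fin (n + 1) → ℝ)), k (p.1, p.2.1) =
        ∑ i, r i p.2 * p.1 ^ (i : ℕ) + q p * (p.1 ^ (n + 1) + ∑ i, p.2.2 i * p.1 ^ (i : ℕ)) := by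
  obtain ⟨r, hr, hdiv⟩ := exists_division n hk
  let U : ℝ → (Fin (n + 1) → ℝ) → Fin (n + 1) → ℝ := fun u a i => if i = 0 then u else a i
  have hU : ContDiff ℝ ∞ fun z : ℝ × (Fin (n + 1) → ℝ) => U z.1 z.2 := by
    refine contDiff_pi.2 fun i => ?_
    by_cases hi : i = 0
    · simpa [U, hi] using contDiff_fst
    · simp only [U, hi, if_false]
      fun_prop
  have hUa : ∀ a, U (a 0) a = a := fun a => by
    funext i
    by_cases hi : i = 0 <;> simp [U, hi]
  have hUs : ∀ u a (t : ℝ), ∑ i, U u a i * t ^ (i : ℕ) = u + ∑ i, U 0 a i * t ^ (i : ℕ) := by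
    intro u a t
    rw [Fin.sum_univ_succ, Fin.sum_univ_succ]
    simp [U]
  let f : ℝ × (ℝ × E × (Fin (n + 1) → ℝ)) → ℝ := fun z =>
    k (z.2.1, z.2.2.1) - ∑ i, r i (z.2.2.1, U z.1 z.2.2.2) * z.2.1 ^ (i : ℕ)
  have hU' : ContDiff ℝ ∞ fun z : ℝ × (ℝ × E × (Fin (n + 1) → ℝ)) => U z.1 z.2.2.2 :=
    hU.comp (by fun_prop : ContDiff ℝ ∞ fun z : ℝ × (ℝ × E × (Fin (n + 1) → ℝ)) =>
      (z.1, z.2.2.2))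
  have hU0 : ContDiff ℝ ∞ fun z : ℝ × E × (Fin (n + 1) → ℝ) => U 0 z.2.2 :=
    hU.comp (by fun_prop : ContDiff ℝ ∞ fun z : ℝ × E × (Fin (n + 1) → ℝ) =>
      ((0 : ℝ), z.2.2))
  have hf : ContDiff ℝ ∞ f := by fun_prop
  let σ : ℝ × E × (Fin (n + 1) → ℝ) → ℝ := fun z =>
    -(z.1 ^ (n + 1) + ∑ i, U 0 z.2.2 i * z.1 ^ (i : ℕ))
  have hσ : ContDiff ℝ ∞ σ := by
    have := fun i => contDiff_pi.1 hU0 i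
    fun_prop
  obtain ⟨g, hg, hfg, -⟩ := exists_hadamard hf hσ
  refine ⟨r, fun p => g (p.2.2 0, p), hr, by fun_prop, ?_⟩
  have hσ0 : σ 0 = 0 := by
    simp [σ, Fin.sum_univ_succ, U]
  have h1 : ∀ᶠ p in 𝓝 (0 : ℝ × E × (Fin (n + 1) → ℝ)), ‖p‖ < 1 :=
    continuous_norm.continuousAt.eventually (gt_mem_nhds (by simp))
  have h2 : ∀ᶠ p in 𝓝 (0 : ℝ × E × (Fin (n + 1) → ℝ)), |σ p| < 1 :=
    hσ.continuous.abs.continuousAt.eventually (gt_mem_nhds (by simp [hσ0]))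
  filter_upwards [h1, h2] with p hp1 hp2
  have b1 : |p.1| ≤ 1 := (norm_fst_le p).trans hp1.le
  have b2 : ‖p.2‖ ≤ 1 := (norm_snd_le p).trans hp1.le
  have b3 : ‖p.2.1‖ ≤ 1 := (norm_fst_le p.2).trans b2
  have b4 : ‖p.2.2‖ ≤ 1 := (norm_snd_le p.2).trans b2
  have h0 : f (σ p, p) = 0 := by
    refine sub_eq_zero.2 (hdiv p.1 p.2.1 _ b1 b3 (fun i => ?_) ?_)
    · by_cases hi : i = 0
      · simpa [U, hi] using hp2.le
      · simpa [U, hi] using (norm_le_pi_norm p.2.2 i).trans b4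
    · rw [hUs]
      simp [σ]
  have h3 := hfg (p.2.2 0) p
  have h4 := hUs (p.2.2 0) p.2.2 p.1
  rw [h0] at h3
  rw [hUa] at h4
  simp only [f, σ, hUa] at h3
  rw [h4]
  linear_combination h3

theorem exists_hadamard_pi {ι E : Type} [Fintype ι] [NormedAddCommGroup E] [NormedSpace ℝ E]
    [FiniteDimensional ℝ E] {f : (ι → ℝ) × E → ℝ} (hf : ContDiff ℝ ∞ f) :
    ∃ R : ι → (ι → ℝ) × E → ℝ, (∀ j, ContDiff ℝ ∞ (R j)) ∧
      ∀ x e, f (x, e) = f (0, e) + ∑ j, x j * R j (x, e) := by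
  classical
  have hn : (∞ : WithTop ℕ∞) ≠ 0 := by simp
  let g : ι → ℝ × ((ι → ℝ) × E) → ℝ := fun j z =>
    fderiv ℝ f (z.1 • z.2.1, z.2.2) (Pi.single j 1, 0)
  have hg : ∀ j, ContDiff ℝ ∞ (g j) := fun j =>
    ((hf.fderiv_right (m := ∞) (by simp)).clm_apply contDiff_const).comp
      (by fun_prop : ContDiff ℝ ∞ fun z : ℝ × ((ι → ℝ) × E) => (z.1 • z.2.1, z.2.2))
  refine ⟨fun j z => ∫ θ in (0 : ℝ)..1, g j (θ, z), fun j => contDiff_paramIntegral (hg j) 0 1,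
    fun x e => ?_⟩
  have h1 : ∀ θ ∈ Set.uIcc (0 : ℝ) 1, HasDerivAt (fun θ : ℝ => f (θ • x, e))
      (∑ j, x j * g j (θ, x, e)) θ := by
    intro θ _
    have h2 : HasDerivAt (fun θ : ℝ => (θ • x, e)) (x, 0) θ := by
      simpa using ((hasDerivAt_id θ).smul_const x).prodMk (hasDerivAt_const θ e)
    refine ((hf.differentiable hn _).hasFDerivAt.comp_hasDerivAt θ h2).congr_deriv ?_
    have h3 : ((x, 0) : (ι → ℝ) × E) = ∑ j, x j • (Pi.single j 1, 0) := by
      refine Prod.ext ?_ ?_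
      · rw [Prod.fst_sum]
        exact pi_eq_sum_univ' x
      · rw [Prod.snd_sum]
        simp
    rw [h3, map_sum]
    simp only [map_smul, smul_eq_mul, g]
  have hc : ∀ j, Continuous fun θ : ℝ => x j * g j (θ, x, e) := fun j =>
    continuous_const.mul ((hg j).continuous.comp (by fun_prop))
  have h4 := intervalIntegral.integral_eq_sub_of_hasDerivAt h1
    ((continuous_finsetSum _ fun j _ => hc j).intervalIntegrable _ _)
  rw [intervalIntegral.integral_finsetSum fun j _ => (hc j).intervalIntegrable _ _] at h4
  simp only [intervalIntegral.integral_const_mul, one_smul, zero_smul] at h4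
  linarith

theorem eq_zero_of_sum_mul_pow_eq {n : ℕ} {Q : ℝ → ℝ} (hQ : ContinuousAt Q 0) :
    ∀ {m : ℕ} {a : Fin m → ℝ}, (∀ᶠ t in 𝓝 (0 : ℝ), t ^ n * ∑ i, a i * t ^ (i : ℕ) =
      t ^ (n + m) * Q t) → ∀ i, a i = 0 := by
  intro m
  induction m generalizing n with
  | zero => exact fun _ i => i.elim0
  | succ m ih =>
    intro a h
    have h0 : a 0 = 0 := by
      have := eq_zero_of_pow_mul_eq_zero
        (A := fun t => ∑ i, a i * t ^ (i : ℕ) - t ^ (m + 1) * Q t) (by fun_prop) n (by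
          filter_upwards [h] with t ht
          rw [mul_sub, ht]
          ring)
      simpa [Fin.sum_univ_succ] using this
    intro i
    refine Fin.cases h0 (fun i => ?_) i
    refine ih (n := n + 1) (a := fun i => a i.succ) ?_ i
    filter_upwards [h] with t ht
    rw [Fin.sum_univ_succ, h0] at ht
    rw [show n + 1 + m = n + (m + 1) by ring, ← ht, pow_succ, mul_assoc, Finset.mul_sum]
    simp only [zero_mul, zero_add, Fin.val_succ]
    congr 1
    refine Finset.sum_congr rfl fun i _ => ?_
    ring

theorem coeff_eq_zero_of_division {R : Fin 5 → ℝ × ℝ → ℝ} {q : ℝ × ℝ × ℝ → ℝ}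
    (hR : ∀ i, ContDiff ℝ ∞ (R i)) (hq : ContDiff ℝ ∞ q) {γ₂ γ₃ γ₄ d b₀ b₁ b₂ p₀ p₁ p₂ : ℝ}
    {S : ℝ → ℝ → ℝ → ℝ}
    (hS : ∀ τ η ε, S τ η ε = τ + ε * (γ₂ * τ ^ 2 + γ₃ * τ ^ 3 + γ₄ * τ ^ 4) + η * (ε * d))
    (h : ∀ᶠ z in 𝓝 (0 : ℝ × ℝ × ℝ), S z.1 z.2.1 z.2.2 ^ 5 + z.2.1 * (p₂ - S z.1 z.2.1 z.2.2 * p₁ +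
      p₀ * S z.1 z.2.1 z.2.2 ^ 2) = z.2.1 * ∑ i, R i z.2 * z.1 ^ (i : ℕ) + q z * (z.1 ^ 5 +
        z.2.1 * (p₂ - p₁ * z.1 + p₀ * z.1 ^ 2 + z.2.2 * (b₀ + b₁ * z.1 + b₂ * z.1 ^ 2)))) :
    (∀ i, R i (0, 0) = 0) ∧ ((∀ i, deriv (fun ε => R i (0, ε)) 0 = 0) → b₀ = 0 ∧
      b₁ = -5 * p₂ * γ₂ ∧ b₂ = 4 * p₁ * γ₂ - 5 * p₂ * γ₃ ∧
      4 * p₁ * γ₃ - 3 * p₀ * γ₂ - 5 * p₂ * γ₄ = 0 ∧ 4 * p₁ * γ₄ - 3 * p₀ * γ₃ + 5 * d = 0) := by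
  obtain ⟨q₁, hq₁, hqq, -⟩ := exists_hadamard_zero (E := ℝ × ℝ)
    (f := fun z : ℝ × (ℝ × ℝ) => q (z.2.1, z.1, z.2.2)) (by fun_prop)
  obtain ⟨q₂, hq₂, hqq₂, -⟩ := exists_hadamard_zero (E := ℝ)
    (f := fun z : ℝ × ℝ => q₁ (0, z.2, z.1)) (by fun_prop)
  choose R₁ hR₁ hRR hR0 using fun i => exists_hadamard_one (f := fun ε => R i (0, ε))
    (by have := hR i; fun_prop)
  simp only at hqq hqq₂ hRR
  have hSc : Continuous fun z : ℝ × ℝ × ℝ => S z.1 z.2.1 z.2.2 := by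
    simp only [hS]
    fun_prop
  have hSη : ∀ τ ε, Continuous fun η => S τ η ε := fun τ ε => by
    simp only [hS]
    fun_prop
  have cq := hq.continuous
  have cq₁ := hq₁.continuous
  have cq₂ := hq₂.continuous
  have cR := fun i => (hR i).continuous
  have cR₁ := fun i => (hR₁ i).continuous
  have t1 : Tendsto (fun z : ℝ × ℝ => ((z.1, 0, z.2) : ℝ × ℝ × ℝ)) (𝓝 0) (𝓝 0) :=
    (by fun_prop : Continuous fun z : ℝ × ℝ => ((z.1, 0, z.2) : ℝ × ℝ × ℝ)).tendsto' _ _ rfl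
  have hq0 : ∀ᶠ z in 𝓝 (0 : ℝ × ℝ), S z.1 0 z.2 ^ 5 = q (z.1, 0, z.2) * z.1 ^ 5 := by
    filter_upwards [t1.eventually h] with z hz
    simpa using hz
  have hI : ∀ᶠ z in 𝓝 (0 : ℝ × ℝ), p₂ - S z.1 0 z.2 * p₁ + p₀ * S z.1 0 z.2 ^ 2 +
      5 * S z.1 0 z.2 ^ 4 * (z.2 * d) = ∑ i, R i (0, z.2) * z.1 ^ (i : ℕ) +
        q₁ (0, z.1, z.2) * z.1 ^ 5 + q (z.1, 0, z.2) * (p₂ - p₁ * z.1 + p₀ * z.1 ^ 2 +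
          z.2 * (b₀ + b₁ * z.1 + b₂ * z.1 ^ 2)) := by
    filter_upwards [t1.eventually h.eventually_nhds, hq0] with ⟨τ, ε⟩ hz hz0
    have t2 : Tendsto (fun η : ℝ => ((τ, η, ε) : ℝ × ℝ × ℝ)) (𝓝 0) (𝓝 (τ, 0, ε)) :=
      (by fun_prop : Continuous fun η : ℝ => ((τ, η, ε) : ℝ × ℝ × ℝ)).tendsto 0
    have c1 := hSη τ ε
    have key := eq_zero_of_pow_mul_eq_zero (A := fun η => p₂ - S τ η ε * p₁ + p₀ * S τ η ε ^ 2 +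
      ε * d * (S τ η ε ^ 4 + S τ η ε ^ 3 * S τ 0 ε + S τ η ε ^ 2 * S τ 0 ε ^ 2 +
        S τ η ε * S τ 0 ε ^ 3 + S τ 0 ε ^ 4) - ∑ i, R i (η, ε) * τ ^ (i : ℕ) -
      q₁ (η, τ, ε) * (τ ^ 5 + η * (p₂ - p₁ * τ + p₀ * τ ^ 2 + ε * (b₀ + b₁ * τ + b₂ * τ ^ 2))) -
      q (τ, 0, ε) * (p₂ - p₁ * τ + p₀ * τ ^ 2 + ε * (b₀ + b₁ * τ + b₂ * τ ^ 2)))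
      (by fun_prop) 1 (by
        filter_upwards [t2.eventually hz] with η hη
        have e1 := hqq η (τ, ε)
        have e2 : S τ η ε = S τ 0 ε + η * (ε * d) := by simp only [hS]; ring
        simp only at hη hz0 e1
        rw [e1] at hη
        generalize S τ 0 ε = s at *
        have e3 : S τ η ε ^ 5 - s ^ 5 = η * (ε * d * (S τ η ε ^ 4 + S τ η ε ^ 3 * s +
          S τ η ε ^ 2 * s ^ 2 + S τ η ε * s ^ 3 + s ^ 4)) := by
          rw [e2]
          ring
        linear_combination hη - e3 - hz0)
    simp only at key ⊢
    linear_combination key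
  have t3 : Tendsto (fun τ : ℝ => ((τ, 0) : ℝ × ℝ)) (𝓝 0) (𝓝 0) :=
    (by fun_prop : Continuous fun τ : ℝ => ((τ, 0) : ℝ × ℝ)).tendsto' _ _ rfl
  have hS0 : ∀ τ, S τ 0 0 = τ := fun τ => by
    rw [hS]
    ring
  have hI0 : ∀ᶠ τ in 𝓝 (0 : ℝ), τ ^ 5 * ∑ i, R i (0, 0) * τ ^ (i : ℕ) =
      τ ^ (5 + 5) * -q₁ (0, τ, 0) := by
    filter_upwards [t3.eventually hI, t3.eventually hq0] with τ h1 h2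
    simp only [hS0] at h1 h2
    linear_combination (p₂ - p₁ * τ + p₀ * τ ^ 2) * h2 - τ ^ 5 * h1
  have hRz := eq_zero_of_sum_mul_pow_eq (by fun_prop) hI0
  refine ⟨hRz, fun hder => ?_⟩
  have hII : ∀ᶠ τ in 𝓝 (0 : ℝ), τ ^ 5 * ((γ₂ * τ ^ 2 + γ₃ * τ ^ 3 + γ₄ * τ ^ 4) *
      (2 * p₀ * τ - p₁) + 5 * d * τ ^ 4) - τ ^ 10 * q₂ (0, τ) -
      5 * (γ₂ * τ ^ 2 + γ₃ * τ ^ 3 + γ₄ * τ ^ 4) * τ ^ 4 * (p₂ - p₁ * τ + p₀ * τ ^ 2) -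
      τ ^ 5 * (b₀ + b₁ * τ + b₂ * τ ^ 2) = 0 := by
    filter_upwards [t3.eventually (hI.and hq0).eventually_nhds, hI0] with τ hz hτ
    have t4 : Tendsto (fun ε : ℝ => ((τ, ε) : ℝ × ℝ)) (𝓝 0) (𝓝 (τ, 0)) :=
      (by fun_prop : Continuous fun ε : ℝ => ((τ, ε) : ℝ × ℝ)).tendsto 0
    have c1 : Continuous fun ε => S τ 0 ε := by
      simp only [hS]
      fun_prop
    have key := eq_zero_of_pow_mul_eq_zero (A := fun ε =>
      τ ^ 5 * ((γ₂ * τ ^ 2 + γ₃ * τ ^ 3 + γ₄ * τ ^ 4) * (p₀ * (S τ 0 ε + τ) - p₁) +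
        5 * d * S τ 0 ε ^ 4) - τ ^ 5 * ∑ i, R₁ i ε * τ ^ (i : ℕ) - τ ^ 10 * q₂ (ε, τ) -
      (γ₂ * τ ^ 2 + γ₃ * τ ^ 3 + γ₄ * τ ^ 4) * (S τ 0 ε ^ 4 + S τ 0 ε ^ 3 * τ +
        S τ 0 ε ^ 2 * τ ^ 2 + S τ 0 ε * τ ^ 3 + τ ^ 4) * (p₂ - p₁ * τ + p₀ * τ ^ 2) -
      S τ 0 ε ^ 5 * (b₀ + b₁ * τ + b₂ * τ ^ 2)) (by fun_prop) 1 (by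
        filter_upwards [t4.eventually hz] with ε hε
        obtain ⟨e1, e2⟩ := hε
        have e3 := hqq₂ ε τ
        have e4 : ∑ i, R i (0, ε) * τ ^ (i : ℕ) = ε * ∑ i, R₁ i ε * τ ^ (i : ℕ) := by
          rw [Finset.mul_sum]
          refine Finset.sum_congr rfl fun i _ => ?_
          rw [hRR, hRz]
          ring
        have e5 : S τ 0 ε - τ = ε * (γ₂ * τ ^ 2 + γ₃ * τ ^ 3 + γ₄ * τ ^ 4) := by
          rw [hS]
          ring
        simp only [hRz, zero_mul, Finset.sum_const_zero, mul_zero] at hτ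
        rw [e4, e3] at e1
        generalize S τ 0 ε = s at *
        generalize γ₂ * τ ^ 2 + γ₃ * τ ^ 3 + γ₄ * τ ^ 4 = w at *
        linear_combination τ ^ 5 * e1 + hτ - (p₂ - p₁ * τ + p₀ * τ ^ 2 +
          ε * (b₀ + b₁ * τ + b₂ * τ ^ 2)) * e2 - (τ ^ 5 * (p₀ * (s + τ) - p₁) -
            (s ^ 4 + s ^ 3 * τ + s ^ 2 * τ ^ 2 + s * τ ^ 3 + τ ^ 4) *
              (p₂ - p₁ * τ + p₀ * τ ^ 2)) * e5)
    simp only [hR0, hder, hS0, zero_mul, Finset.sum_const_zero, mul_zero] at key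
    linear_combination key
  have := eq_zero_of_sum_mul_pow_eq (n := 5) (m := 5) (Q := fun τ => q₂ (0, τ) + 3 * p₀ * γ₄)
    (a := ![-b₀, -5 * p₂ * γ₂ - b₁, 4 * p₁ * γ₂ - 5 * p₂ * γ₃ - b₂,
      4 * p₁ * γ₃ - 3 * p₀ * γ₂ - 5 * p₂ * γ₄, 4 * p₁ * γ₄ - 3 * p₀ * γ₃ + 5 * d])
    (by fun_prop) (by
      filter_upwards [hII] with τ hτ
      simp [Fin.sum_univ_succ]
      linear_combination hτ)
  refine ⟨?_, ?_, ?_, ?_, ?_⟩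
  · simpa using this 0
  · have := this 1
    simp at this
    linarith
  · have := this 2
    simp at this
    linarith
  · simpa using this 3
  · simpa using this 4

section Unfolding

/-- The coefficient matrix of the linear part of the unfolding parameters. -/
def unfoldingMatrix (ζ : Fin 3 → Fin 5 → ℝ) : Matrix (Fin 3) (Fin 3) ℝ :=
  !![ζ 0 0, ζ 0 1, 1 + ζ 0 2; ζ 1 0, ζ 1 1 - 1, ζ 1 2; 1 + ζ 2 0, ζ 2 1, ζ 2 2]

/-- The unfolding parameters, as functions of the point `X` of the target space. -/
def unfoldingCoeff (ζ : Fin 3 → Fin 5 → ℝ) (X : Fin 3 → ℝ) (i : Fin 3) : ℝ :=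
  X 0 * unfoldingMatrix ζ 0 i + X 1 * unfoldingMatrix ζ 1 i + X 2 * unfoldingMatrix ζ 2 i

/-- The change of variable in the fibre. -/
def unfoldingShift (ζ : Fin 3 → Fin 5 → ℝ) (X : Fin 3 → ℝ) (τ : ℝ) : ℝ :=
  τ + (X 0 * ζ 0 3 + X 1 * ζ 1 3 + X 2 * ζ 2 3) +
    (ζ 0 4 * τ ^ 2 + ζ 1 4 * τ ^ 3 + ζ 2 4 * τ ^ 4)

/-- The family of functions generating the surface, rescaled by `δ`. -/
def generatingFamily (e : ℝ → ℝ) (m : R2 → ℝ) (δ t : ℝ) (X : Fin 3 → ℝ) : ℝ :=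
  X 2 - t * X 1 + t ^ 5 * e (δ * t) + X 0 * t ^ 2 * m (δ ^ 3 * X 0, δ * t)

theorem contDiff_unfoldingMatrix (j i : Fin 3) :
    ContDiff ℝ ∞ fun ζ : Fin 3 → Fin 5 → ℝ => unfoldingMatrix ζ j i := by
  fin_cases j <;> fin_cases i <;> simp [unfoldingMatrix] <;> fun_prop

theorem contDiff_unfoldingCoeff (i : Fin 3) :
    ContDiff ℝ ∞ fun z : (Fin 3 → Fin 5 → ℝ) × (Fin 3 → ℝ) => unfoldingCoeff z.1 z.2 i := by
  have h := fun j => (contDiff_unfoldingMatrix j i).comp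
    (contDiff_fst : ContDiff ℝ ∞ fun z : (Fin 3 → Fin 5 → ℝ) × (Fin 3 → ℝ) => z.1)
  simp only [Function.comp_def] at h
  unfold unfoldingCoeff
  have h0 := h 0
  have h1 := h 1
  have h2 := h 2
  fun_prop

theorem contDiff_unfoldingShift : ContDiff ℝ ∞
    fun z : (Fin 3 → Fin 5 → ℝ) × (Fin 3 → ℝ) × ℝ => unfoldingShift z.1 z.2.1 z.2.2 := by
  unfold unfoldingShift
  fun_prop

theorem contDiff_generatingFamily {e : ℝ → ℝ} {m : R2 → ℝ} (he : ContDiff ℝ ∞ e)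
    (hm : ContDiff ℝ ∞ m) : ContDiff ℝ ∞
      fun z : ℝ × ℝ × (Fin 3 → ℝ) => generatingFamily e m z.1 z.2.1 z.2.2 := by
  unfold generatingFamily
  fun_prop

theorem exists_unfolding_division {e : ℝ → ℝ} {m : R2 → ℝ} (he : ContDiff ℝ ∞ e)
    (hm : ContDiff ℝ ∞ m) (he0 : e 0 = 1) :
    ∃ (R : Fin 5 → Fin 3 → (Fin 3 → ℝ) × ((Fin 3 → Fin 5 → ℝ) × ℝ) → ℝ)
      (Q : ℝ × (Fin 3 → ℝ) × ((Fin 3 → Fin 5 → ℝ) × ℝ) → ℝ),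
      (∀ i j, ContDiff ℝ ∞ (R i j)) ∧ ContDiff ℝ ∞ Q ∧ Q 0 = 1 ∧
      ∀ᶠ z in 𝓝 (0 : ℝ × (Fin 3 → ℝ) × ((Fin 3 → Fin 5 → ℝ) × ℝ)),
        generatingFamily e m z.2.2.2 (unfoldingShift z.2.2.1 z.2.1 z.1) z.2.1 =
          ∑ i : Fin 5, (∑ j, z.2.1 j * R i j z.2) * z.1 ^ (i : ℕ) + Q z * (z.1 ^ 5 +
            unfoldingCoeff z.2.2.1 z.2.1 2 * z.1 ^ 2 + unfoldingCoeff z.2.2.1 z.2.1 1 * z.1 +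
              unfoldingCoeff z.2.2.1 z.2.1 0) := by
  have hF := contDiff_generatingFamily he hm
  have hS := contDiff_unfoldingShift
  have hec := he.continuous
  obtain ⟨r, q, hr, hq, hdiv⟩ := exists_malgrange_division
    (E := (Fin 3 → ℝ) × ((Fin 3 → Fin 5 → ℝ) × ℝ)) 4
    (k := fun z => generatingFamily e m z.2.2.2 (unfoldingShift z.2.2.1 z.2.1 z.1) z.2.1)
    (hF.comp (f := fun z : ℝ × (Fin 3 → ℝ) × ((Fin 3 → Fin 5 → ℝ) × ℝ) =>
      (z.2.2.2, unfoldingShift z.2.2.1 z.2.1 z.1, z.2.1)) (by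
        refine ContDiff.prodMk (by fun_prop) (ContDiff.prodMk ?_ (by fun_prop))
        exact hS.comp (f := fun z : ℝ × (Fin 3 → ℝ) × ((Fin 3 → Fin 5 → ℝ) × ℝ) =>
          (z.2.2.1, z.2.1, z.1)) (by fun_prop)))
  have hqc := hq.continuous
  let a : (Fin 3 → ℝ) × ((Fin 3 → Fin 5 → ℝ) × ℝ) → Fin 5 → ℝ := fun z =>
    ![unfoldingCoeff z.2.1 z.1 0, unfoldingCoeff z.2.1 z.1 1, unfoldingCoeff z.2.1 z.1 2, 0, 0]
  have ha : ContDiff ℝ ∞ a := by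
    have h := fun i => (contDiff_unfoldingCoeff i).comp (by fun_prop : ContDiff ℝ ∞
      fun z : (Fin 3 → ℝ) × ((Fin 3 → Fin 5 → ℝ) × ℝ) => (z.2.1, z.1))
    refine contDiff_pi.2 fun i => ?_
    fin_cases i
    · exact h 0
    · exact h 1
    · exact h 2
    · exact contDiff_const
    · exact contDiff_const
  have ha0 : ∀ w, a (0, w) = 0 := fun w => by
    ext i
    fin_cases i <;> simp [a, unfoldingCoeff]
  have hρ : ∀ i, ContDiff ℝ ∞ fun z => r i (z, a z) := fun i =>
    (hr i).comp (contDiff_id.prodMk ha)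
  have hQ : ContDiff ℝ ∞ fun z : ℝ × (Fin 3 → ℝ) × ((Fin 3 → Fin 5 → ℝ) × ℝ) =>
      q (z.1, z.2, a z.2) :=
    hq.comp (contDiff_fst.prodMk (contDiff_snd.prodMk (ha.comp contDiff_snd)))
  choose R hR hρR using fun i => exists_hadamard_pi (hρ i)
  have ht : Tendsto (fun z : ℝ × (Fin 3 → ℝ) × ((Fin 3 → Fin 5 → ℝ) × ℝ) => (z.1, z.2, a z.2))
      (𝓝 0) (𝓝 0) := by
    refine (by fun_prop : Continuous _).tendsto' _ _ ?_
    have := ha0 0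
    simp only [Prod.fst_zero, Prod.snd_zero]
    change (0, 0, a (0, 0)) = _
    rw [this]
    rfl
  have hd := ht.eventually hdiv
  have hz : ∀ᶠ w in 𝓝 (0 : (Fin 3 → Fin 5 → ℝ) × ℝ), ∀ᶠ τ in 𝓝 (0 : ℝ),
      generatingFamily e m w.2 (unfoldingShift w.1 0 τ) 0 =
        ∑ i, r i ((0, w), 0) * τ ^ (i : ℕ) + q (τ, (0, w), 0) * τ ^ 5 := by
    have h1 : Tendsto (fun z : ((Fin 3 → Fin 5 → ℝ) × ℝ) × ℝ =>
        ((z.2, 0, z.1) : ℝ × (Fin 3 → ℝ) × ((Fin 3 → Fin 5 → ℝ) × ℝ))) (𝓝 (0, 0)) (𝓝 0) :=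
      (by fun_prop : Continuous _).tendsto' _ _ rfl
    filter_upwards [(h1.eventually hd).curry_nhds] with w hw
    filter_upwards [hw] with τ h
    simpa [ha0] using h
  have hfac : ∀ (w : (Fin 3 → Fin 5 → ℝ) × ℝ) τ,
      generatingFamily e m w.2 (unfoldingShift w.1 0 τ) 0 = τ ^ 5 *
        ((1 + (w.1 0 4 * τ + w.1 1 4 * τ ^ 2 + w.1 2 4 * τ ^ 3)) ^ 5 *
          e (w.2 * unfoldingShift w.1 0 τ)) := fun w τ => by
    simp only [generatingFamily, unfoldingShift, Pi.zero_apply]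
    ring
  have hSc : ∀ ζ X, Continuous fun τ => unfoldingShift ζ X τ := fun ζ X => by
    unfold unfoldingShift
    fun_prop
  have hr0 : ∀ᶠ w in 𝓝 (0 : (Fin 3 → Fin 5 → ℝ) × ℝ), ∀ i, r i ((0, w), 0) = 0 := by
    filter_upwards [hz] with w hw
    have hS0 : Continuous (unfoldingShift w.1 0) := hSc _ _
    refine eq_zero_of_sum_mul_pow_eq (n := 0) (Q := fun τ =>
      (1 + (w.1 0 4 * τ + w.1 1 4 * τ ^ 2 + w.1 2 4 * τ ^ 3)) ^ 5 *
        e (w.2 * unfoldingShift w.1 0 τ) - q (τ, (0, w), 0)) (by fun_prop) ?_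
    filter_upwards [hw] with τ h
    rw [hfac] at h
    rw [pow_zero, one_mul, show τ ^ (0 + (4 + 1)) = τ ^ 5 from rfl]
    linear_combination -h
  refine ⟨R, _, hR, hQ, ?_, ?_⟩
  · have h1 := hz.self_of_nhds
    have h2 := hr0.self_of_nhds
    have hS0 : Continuous (unfoldingShift 0 0) := hSc _ _
    have h3 := eq_zero_of_pow_mul_eq_zero (A := fun τ => e (0 * unfoldingShift 0 0 τ) -
      q (τ, (0, 0), 0)) (by fun_prop) 5 (by
        filter_upwards [h1] with τ h
        rw [hfac] at h
        simp only [h2, Prod.fst_zero, Prod.snd_zero, zero_mul, Finset.sum_const_zero,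
          Pi.zero_apply, add_zero, one_pow, one_mul, zero_add] at h
        rw [mul_sub, zero_mul]
        linear_combination h)
    rw [zero_mul, he0] at h3
    change q (0, 0, a (0, 0)) = 1
    rw [ha0]
    exact (sub_eq_zero.1 h3).symm
  · have h1 : Tendsto (fun z : ℝ × (Fin 3 → ℝ) × ((Fin 3 → Fin 5 → ℝ) × ℝ) => z.2.2)
        (𝓝 0) (𝓝 0) := (by fun_prop : Continuous _).tendsto' _ _ rfl
    filter_upwards [hd, h1.eventually hr0] with z h h0
    have h2 : ∀ i, r i (z.2, a z.2) = ∑ j, z.2.1 j * R i j z.2 := fun i => by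
      have := hρR i z.2.1 z.2.2
      rw [ha0, h0, zero_add] at this
      exact this
    rw [h]
    simp only [h2]
    have h3 : ∑ i, a z.2 i * z.1 ^ (i : ℕ) = unfoldingCoeff z.2.2.1 z.2.1 2 * z.1 ^ 2 +
        unfoldingCoeff z.2.2.1 z.2.1 1 * z.1 + unfoldingCoeff z.2.2.1 z.2.1 0 := by
      simp [a, Fin.sum_univ_succ]
      ring
    rw [h3, add_assoc (z.1 ^ 5 + _)]
    ring

end Unfolding

theorem eq_zero_of_unfolding_linearization {e : ℝ → ℝ} {m : R2 → ℝ} (he0 : e 0 = 1)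
    (hm0 : m (0, 0) = 1)
    {R : Fin 5 → Fin 3 → (Fin 3 → ℝ) × ((Fin 3 → Fin 5 → ℝ) × ℝ) → ℝ}
    {Q : ℝ × (Fin 3 → ℝ) × ((Fin 3 → Fin 5 → ℝ) × ℝ) → ℝ}
    (hR : ∀ i j, ContDiff ℝ ∞ (R i j)) (hQ : ContDiff ℝ ∞ Q)
    (h : ∀ᶠ z in 𝓝 (0 : ℝ × (Fin 3 → ℝ) × ((Fin 3 → Fin 5 → ℝ) × ℝ)),
      generatingFamily e m z.2.2.2 (unfoldingShift z.2.2.1 z.2.1 z.1) z.2.1 =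
        ∑ i : Fin 5, (∑ j, z.2.1 j * R i j z.2) * z.1 ^ (i : ℕ) + Q z * (z.1 ^ 5 +
          unfoldingCoeff z.2.2.1 z.2.1 2 * z.1 ^ 2 + unfoldingCoeff z.2.2.1 z.2.1 1 * z.1 +
            unfoldingCoeff z.2.2.1 z.2.1 0)) (v : Fin 3 → Fin 5 → ℝ) :
    (∀ i j, R i j 0 = 0) ∧
      ((∀ i j, deriv (fun ε : ℝ => R i j (0, (ε • v, 0))) 0 = 0) → v = 0) := by
  have key := fun j : Fin 3 => coeff_eq_zero_of_division
    (R := fun i x => R i j (x.1 • Pi.single j 1, (x.2 • v, 0)))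
    (q := fun z => Q (z.1, z.2.1 • Pi.single j 1, (z.2.2 • v, 0)))
    (fun i => (hR i j).comp (by fun_prop)) (hQ.comp (by fun_prop))
    (γ₂ := v 0 4) (γ₃ := v 1 4) (γ₄ := v 2 4) (d := v j 3)
    (b₀ := v j 0) (b₁ := v j 1) (b₂ := v j 2) (p₀ := (Pi.single j 1 : Fin 3 → ℝ) 0)
    (p₁ := (Pi.single j 1 : Fin 3 → ℝ) 1) (p₂ := (Pi.single j 1 : Fin 3 → ℝ) 2)
    (S := fun τ η ε => τ + ε * (v 0 4 * τ ^ 2 + v 1 4 * τ ^ 3 + v 2 4 * τ ^ 4) + η * (ε * v j 3))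
    (fun _ _ _ => rfl) (by
      have ht : Tendsto (fun z : ℝ × ℝ × ℝ => ((z.1, z.2.1 • Pi.single j 1, (z.2.2 • v, 0)) :
          ℝ × (Fin 3 → ℝ) × ((Fin 3 → Fin 5 → ℝ) × ℝ))) (𝓝 0) (𝓝 0) :=
        (by fun_prop : Continuous _).tendsto' _ _ (by simp)
      filter_upwards [ht.eventually h] with z hz
      have h1 : unfoldingShift (z.2.2 • v) (z.2.1 • Pi.single j 1) z.1 = z.1 +
          z.2.2 * (v 0 4 * z.1 ^ 2 + v 1 4 * z.1 ^ 3 + v 2 4 * z.1 ^ 4) +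
            z.2.1 * (z.2.2 * v j 3) := by
        fin_cases j <;> simp [unfoldingShift] <;> ring
      rw [h1] at hz
      generalize z.1 + z.2.2 * (v 0 4 * z.1 ^ 2 + v 1 4 * z.1 ^ 3 + v 2 4 * z.1 ^ 4) +
            z.2.1 * (z.2.2 * v j 3) = s at hz ⊢
      have h2 : ∀ i : Fin 5, ∑ k, (z.2.1 • (Pi.single j 1 : Fin 3 → ℝ)) k *
          R i k (z.2.1 • Pi.single j 1, (z.2.2 • v, 0)) =
            z.2.1 * R i j (z.2.1 • Pi.single j 1, (z.2.2 • v, 0)) := fun i => by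
        rw [Finset.sum_eq_single j]
        · simp
        · intro k _ hk
          simp [hk]
        · simp
      simp only [h2] at hz
      simp only [generatingFamily, zero_pow three_ne_zero, zero_mul, he0, hm0] at hz
      simp only [mul_assoc, ← Finset.mul_sum] at hz
      simp only [Pi.smul_apply, smul_eq_mul] at hz
      have h3 : z.1 ^ 5 + (unfoldingCoeff (z.2.2 • v) (z.2.1 • Pi.single j 1) 2 * z.1 ^ 2 +
          (unfoldingCoeff (z.2.2 • v) (z.2.1 • Pi.single j 1) 1 * z.1 +
            unfoldingCoeff (z.2.2 • v) (z.2.1 • Pi.single j 1) 0)) = z.1 ^ 5 +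
          z.2.1 * ((Pi.single j 1 : Fin 3 → ℝ) 2 - (Pi.single j 1 : Fin 3 → ℝ) 1 * z.1 +
            (Pi.single j 1 : Fin 3 → ℝ) 0 * z.1 ^ 2 +
            z.2.2 * (v j 0 + v j 1 * z.1 + v j 2 * z.1 ^ 2)) := by
        fin_cases j <;> simp [unfoldingCoeff, unfoldingMatrix] <;> ring
      have h4 : z.1 ^ 5 + unfoldingCoeff (z.2.2 • v) (z.2.1 • Pi.single j 1) 2 * z.1 ^ 2 +
          unfoldingCoeff (z.2.2 • v) (z.2.1 • Pi.single j 1) 1 * z.1 +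
            unfoldingCoeff (z.2.2 • v) (z.2.1 • Pi.single j 1) 0 = z.1 ^ 5 +
          (unfoldingCoeff (z.2.2 • v) (z.2.1 • Pi.single j 1) 2 * z.1 ^ 2 +
          (unfoldingCoeff (z.2.2 • v) (z.2.1 • Pi.single j 1) 1 * z.1 +
            unfoldingCoeff (z.2.2 • v) (z.2.1 • Pi.single j 1) 0)) := by ring
      rw [h4, h3] at hz
      linear_combination hz)
  refine ⟨fun i j => ?_, fun hv => ?_⟩
  · have := (key j).1 i
    simp only [zero_smul] at this
    exact this
  · have k := fun j => (key j).2 (fun i => by simpa using hv i j)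
    have k0 := k 0
    have k1 := k 1
    have k2 := k 2
    simp at k0 k1 k2
    obtain ⟨a0, a1, a2, a3, a4⟩ := k0
    obtain ⟨b0, b1, b2, b3, b4⟩ := k1
    obtain ⟨c0, c1, c2, c3, c4⟩ := k2
    ext j i
    fin_cases j <;> fin_cases i <;> simp <;> linarith

theorem exists_butterfly_unfolding {e : ℝ → ℝ} {m : R2 → ℝ} (he : ContDiff ℝ ∞ e)
    (hm : ContDiff ℝ ∞ m) (he0 : e 0 = 1) (hm0 : m (0, 0) = 1) :
    ∃ δ : ℝ, δ ≠ 0 ∧ ∃ (ζ : (Fin 3 → ℝ) → Fin 3 → Fin 5 → ℝ) (Q : ℝ × (Fin 3 → ℝ) → ℝ),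
      ContDiff ℝ ∞ ζ ∧ ContDiff ℝ ∞ Q ∧ Q 0 ≠ 0 ∧ (unfoldingMatrix (ζ 0)).det ≠ 0 ∧
      unfoldingMatrix (ζ 0) 0 2 ≠ 0 ∧
      ∀ᶠ z in 𝓝 (0 : ℝ × (Fin 3 → ℝ)),
        generatingFamily e m δ (unfoldingShift (ζ z.2) z.2 z.1) z.2 = Q z * (z.1 ^ 5 +
          unfoldingCoeff (ζ z.2) z.2 2 * z.1 ^ 2 + unfoldingCoeff (ζ z.2) z.2 1 * z.1 +
            unfoldingCoeff (ζ z.2) z.2 0) := by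
  obtain ⟨R, Q, hR, hQ, hQ0, h⟩ := exists_unfolding_division he hm he0
  have lin := eq_zero_of_unfolding_linearization he0 hm0 hR hQ h
  let T : ((Fin 3 → ℝ) × ℝ) × (Fin 3 → Fin 5 → ℝ) → Fin 3 → Fin 5 → ℝ :=
    fun z j i => R i j (z.1.1, (z.2, z.1.2))
  have hT : ContDiff ℝ ∞ T :=
    contDiff_pi.2 fun j => contDiff_pi.2 fun i => (hR i j).comp (by fun_prop)
  obtain ⟨φ, hφ, hφ0, hφR⟩ := exists_implicit (R := T) hT (a0 := (0, 0)) (b0 := 0)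
    (by ext j i; exact (lin 0).1 i j) (fun v hv => by
      refine (lin v).2 fun i j => ?_
      have h1 : HasDerivAt (fun ε : ℝ => (((0, 0), ε • v) : ((Fin 3 → ℝ) × ℝ) ×
          (Fin 3 → Fin 5 → ℝ))) (0, v) 0 := by
        have := (hasDerivAt_id (0 : ℝ)).smul_const v
        rw [one_smul] at this
        exact (hasDerivAt_const _ _).prodMk this
      have h2 : HasFDerivAt T (fderiv ℝ T ((0, 0), 0)) (((0, 0), (0 : ℝ) • v)) := by
        rw [zero_smul]
        exact (hT.differentiable (by simp) _).hasFDerivAt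
      have h3 := h2.comp_hasDerivAt (0 : ℝ) h1
      rw [hv] at h3
      exact (hasDerivAt_pi.1 (hasDerivAt_pi.1 h3 j) i).deriv)
  have ht : Tendsto (fun z : ℝ × ℝ × (Fin 3 → ℝ) => ((z.2.1, z.2.2, (φ (z.2.2, z.1), z.1)) :
      ℝ × (Fin 3 → ℝ) × ((Fin 3 → Fin 5 → ℝ) × ℝ))) (𝓝 (0, 0)) (𝓝 0) := by
    refine (by fun_prop : Continuous _).tendsto' _ _ ?_
    change (0, 0, (φ (0, 0), 0)) = _
    rw [hφ0]
    rfl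
  have ht2 : Tendsto (fun z : ℝ × ℝ × (Fin 3 → ℝ) => (z.2.2, z.1)) (𝓝 (0, 0)) (𝓝 (0, 0)) :=
    (by fun_prop : Continuous _).tendsto' _ _ rfl
  have h1 := ((ht.eventually h).and (ht2.eventually hφR)).curry_nhds
  have hM := fun j i => ((contDiff_unfoldingMatrix j i).continuous.comp
    (by fun_prop : Continuous fun δ : ℝ => φ (0, δ)))
  have hd : ∀ᶠ δ in 𝓝 (0 : ℝ), (unfoldingMatrix (φ (0, δ))).det ≠ 0 := by
    have hc : Continuous fun δ : ℝ => (unfoldingMatrix (φ (0, δ))).det :=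
      (continuous_matrix hM).matrix_det
    refine hc.continuousAt.eventually_ne ?_
    rw [hφ0]
    simp [unfoldingMatrix, Matrix.det_fin_three]
  have hm2 : ∀ᶠ δ in 𝓝 (0 : ℝ), unfoldingMatrix (φ (0, δ)) 0 2 ≠ 0 := by
    refine (hM 0 2).continuousAt.eventually_ne ?_
    simp [hφ0, unfoldingMatrix]
  have hq : ∀ᶠ δ in 𝓝 (0 : ℝ), Q (0, 0, (φ (0, δ), δ)) ≠ 0 := by
    refine (by fun_prop : Continuous fun δ : ℝ => Q (0, 0, (φ (0, δ), δ))).continuousAt.eventually_ne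
      ?_
    rw [hφ0]
    change Q 0 ≠ 0
    simp [hQ0]
  obtain ⟨δ, ⟨⟨hδ1, hδ2⟩, hδ3, hδ4⟩, hδ⟩ := (((h1.and hd).and (hm2.and hq)).filter_mono
    nhdsWithin_le_nhds |>.and (self_mem_nhdsWithin : ∀ᶠ δ in 𝓝[≠] (0 : ℝ), δ ∈ ({0}ᶜ : Set ℝ))).exists
  refine ⟨δ, hδ, fun X => φ (X, δ), fun z => Q (z.1, z.2, (φ (z.2, δ), δ)), by fun_prop,
    by fun_prop, hδ4, hδ2, hδ3, ?_⟩
  filter_upwards [hδ1] with z hz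
  obtain ⟨h2, h3⟩ := hz
  have h4 : ∀ i j, R i j (z.2, (φ (z.2, δ), δ)) = 0 := fun i j => congrFun (congrFun h3 j) i
  simpa only [h4, mul_zero, Finset.sum_const_zero, zero_mul, zero_add] using h2

section ButterflyNormalForm

theorem hasDerivAt_fst {E F : Type*} [NormedAddCommGroup E] [NormedSpace ℝ E]
    [NormedAddCommGroup F] [NormedSpace ℝ F] {y : ℝ → E × F} {y' : E × F} {t : ℝ}
    (h : HasDerivAt y y' t) : HasDerivAt (fun s => (y s).1) y'.1 t :=
  (hasFDerivAt_fst (𝕜 := ℝ) (p := y t)).comp_hasDerivAt t h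

theorem hasDerivAt_snd {E F : Type*} [NormedAddCommGroup E] [NormedSpace ℝ E]
    [NormedAddCommGroup F] [NormedSpace ℝ F] {y : ℝ → E × F} {y' : E × F} {t : ℝ}
    (h : HasDerivAt y y' t) : HasDerivAt (fun s => (y s).2) y'.2 t :=
  (hasFDerivAt_snd (𝕜 := ℝ) (p := y t)).comp_hasDerivAt t h

/-- The germ generated by the family `Z - t * Y + t ^ 2 * k (x, t)`. -/
def generatedGerm (k : R2 → ℝ) (z : R2) : R3 :=
  (z.1, 2 * z.2 * k z + z.2 ^ 2 * fderiv ℝ k z (0, 1),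
    z.2 ^ 2 * (k z + z.2 * fderiv ℝ k z (0, 1)))

theorem contDiff_generatedGerm {k : R2 → ℝ} (hk : ContDiff ℝ ∞ k) :
    ContDiff ℝ ∞ (generatedGerm k) := by
  have := contDiff_fderiv_apply hk (0, 1)
  unfold generatedGerm
  fun_prop

theorem generatedGerm_zero (k : R2 → ℝ) : generatedGerm k (0, 0) = (0, 0, 0) := by
  simp [generatedGerm]

theorem hasDerivAt_generatedGerm_line {k : R2 → ℝ} (hk : ContDiff ℝ ∞ k) (hk0 : k (0, 0) = 0)
    (v : R2) : HasDerivAt (fun ε : ℝ => generatedGerm k (ε • v)) (v.1, 0, 0) 0 := by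
  have hk' := contDiff_fderiv_apply hk (0, 1)
  have h1 : HasDerivAt (fun ε : ℝ => ε • v) v 0 := by
    simpa using (hasDerivAt_id (0 : ℝ)).smul_const v
  have d1 : DifferentiableAt ℝ (fun ε : ℝ => k (ε • v)) 0 :=
    (hk.differentiable (by simp)).differentiableAt.comp (0 : ℝ) h1.differentiableAt
  have d2 : DifferentiableAt ℝ (fun ε : ℝ => fderiv ℝ k (ε • v) (0, 1)) 0 :=
    (hk'.differentiable (by simp)).differentiableAt.comp (0 : ℝ) h1.differentiableAt
  have e0 : k ((0 : ℝ) • v) = 0 := by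
    rw [zero_smul]
    exact hk0
  have a1 : HasDerivAt (fun ε : ℝ => ε * v.1) v.1 0 := by
    simpa using (hasDerivAt_id (0 : ℝ)).mul_const v.1
  have a2 : HasDerivAt (fun ε : ℝ => ε * v.2) v.2 0 := by
    simpa using (hasDerivAt_id (0 : ℝ)).mul_const v.2
  refine a1.prodMk (HasDerivAt.prodMk ?_ ?_)
  · refine (((a2.const_mul 2).mul d1.hasDerivAt).add
      ((a2.pow 2).mul d2.hasDerivAt)).congr_deriv ?_
    rw [e0]
    simp
  · refine ((a2.pow 2).mul (d1.hasDerivAt.add (a2.mul d2.hasDerivAt))).congr_deriv ?_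
    simp

theorem hasDerivAt_unfoldingCoeff_line {ζ : (Fin 3 → ℝ) → Fin 3 → Fin 5 → ℝ}
    (hζ : ContDiff ℝ ∞ ζ) {X : ℝ → Fin 3 → ℝ} {X' : Fin 3 → ℝ} (hX : HasDerivAt X X' 0)
    (hX0 : X 0 = 0) (i : Fin 3) :
    HasDerivAt (fun ε => unfoldingCoeff (ζ (X ε)) (X ε) i)
      (Matrix.vecMul X' (unfoldingMatrix (ζ 0)) i) 0 := by
  have hM : ∀ j, DifferentiableAt ℝ (fun ε => unfoldingMatrix (ζ (X ε)) j i) 0 := fun j =>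
    (((contDiff_unfoldingMatrix j i).comp hζ).differentiable (by simp)).differentiableAt.comp
      (0 : ℝ) hX.differentiableAt
  have hXj := hasDerivAt_pi.1 hX
  refine ((((hXj 0).mul (hM 0).hasDerivAt).add ((hXj 1).mul (hM 1).hasDerivAt)).add
    ((hXj 2).mul (hM 2).hasDerivAt)).congr_deriv ?_
  simp [Matrix.vecMul, dotProduct, Fin.sum_univ_three, hX0]

theorem hasDerivAt_unfoldingShift_line {ζ : (Fin 3 → ℝ) → Fin 3 → Fin 5 → ℝ}
    (hζ : ContDiff ℝ ∞ ζ) {X : ℝ → Fin 3 → ℝ} {X' : Fin 3 → ℝ} (hX : HasDerivAt X X' 0)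
    (hX0 : X 0 = 0) {θ : ℝ → ℝ} {θ' : ℝ} (hθ : HasDerivAt θ θ' 0) (hθ0 : θ 0 = 0) :
    HasDerivAt (fun ε => unfoldingShift (ζ (X ε)) (X ε) (θ ε))
      (θ' + (X' 0 * ζ 0 0 3 + X' 1 * ζ 0 1 3 + X' 2 * ζ 0 2 3)) 0 := by
  have hM : ∀ j i, DifferentiableAt ℝ (fun ε => ζ (X ε) j i) 0 := fun j i => by
    have h1 : ContDiff ℝ ∞ fun Y => ζ Y j i := by fun_prop
    exact (h1.differentiable (by simp)).differentiableAt.comp (0 : ℝ) hX.differentiableAt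
  have hXj := hasDerivAt_pi.1 hX
  refine ((hθ.add ((((hXj 0).mul (hM 0 3).hasDerivAt).add ((hXj 1).mul (hM 1 3).hasDerivAt)).add
    ((hXj 2).mul (hM 2 3).hasDerivAt))).add ((((hM 0 4).hasDerivAt.mul (hθ.pow 2)).add
      ((hM 1 4).hasDerivAt.mul (hθ.pow 3))).add ((hM 2 4).hasDerivAt.mul (hθ.pow 4)))).congr_deriv ?_
  simp [hX0, hθ0]

theorem aequiv_fCBF_of_unfolding {k : R2 → ℝ} (hk : ContDiff ℝ ∞ k) (hk0 : k (0, 0) = 0)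
    {ζ : (Fin 3 → ℝ) → Fin 3 → Fin 5 → ℝ} {Q : ℝ × (Fin 3 → ℝ) → ℝ} (hζ : ContDiff ℝ ∞ ζ)
    (hQ : ContDiff ℝ ∞ Q) (hQ0 : Q 0 ≠ 0) (hdet : (unfoldingMatrix (ζ 0)).det ≠ 0)
    (hM : unfoldingMatrix (ζ 0) 0 2 ≠ 0)
    (h : ∀ᶠ z in 𝓝 (0 : ℝ × (Fin 3 → ℝ)),
      z.2 2 - unfoldingShift (ζ z.2) z.2 z.1 * z.2 1 + unfoldingShift (ζ z.2) z.2 z.1 ^ 2 *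
          k (z.2 0, unfoldingShift (ζ z.2) z.2 z.1) =
        Q z * (z.1 ^ 5 + unfoldingCoeff (ζ z.2) z.2 2 * z.1 ^ 2 +
          unfoldingCoeff (ζ z.2) z.2 1 * z.1 + unfoldingCoeff (ζ z.2) z.2 0)) :
    AEquiv (generatedGerm k) (0, 0) fCBF (0, 0) := by
  have hS : ContDiff ℝ ∞ fun z : (ℝ × (Fin 3 → ℝ)) × ℝ =>
      unfoldingShift (ζ z.1.2) z.1.2 z.2 - z.1.1 := by
    have := contDiff_unfoldingShift.comp (f := fun z : (ℝ × (Fin 3 → ℝ)) × ℝ =>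
      (ζ z.1.2, z.1.2, z.2)) (by fun_prop)
    exact this.sub (by fun_prop)
  obtain ⟨Θ, hΘ, hΘ0, hΘS⟩ := exists_implicit hS (a0 := (0, 0)) (b0 := 0)
    (by simp [unfoldingShift]) (fun v hv => by
      have h1 : HasDerivAt (fun ε : ℝ => (((0, 0), ε * v) : (ℝ × (Fin 3 → ℝ)) × ℝ)) (0, v) 0 := by
        have := (hasDerivAt_id (0 : ℝ)).mul_const v
        rw [one_mul] at this
        exact (hasDerivAt_const _ _).prodMk this
      have h2 := hasDerivAt_unfoldingShift_line hζ (hasDerivAt_const (0 : ℝ) (0 : Fin 3 → ℝ)) rfl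
        (θ := fun ε => ε * v) (by simpa using (hasDerivAt_id (0 : ℝ)).mul_const v) (by simp)
      have h3 : HasFDerivAt (fun z : (ℝ × (Fin 3 → ℝ)) × ℝ =>
          unfoldingShift (ζ z.1.2) z.1.2 z.2 - z.1.1) (fderiv ℝ (fun z : (ℝ × (Fin 3 → ℝ)) × ℝ =>
          unfoldingShift (ζ z.1.2) z.1.2 z.2 - z.1.1) ((0, 0), 0)) ((0, 0), 0 * v) := by
        rw [zero_mul]
        exact (hS.differentiable (by simp) _).hasFDerivAt
      have h4 := h3.comp_hasDerivAt (0 : ℝ) h1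
      rw [hv] at h4
      have h5 := (h2.sub_const 0).unique h4
      simpa using h5)
  have hβ : ∀ i, ContDiff ℝ ∞ fun X => unfoldingCoeff (ζ X) X i := fun i =>
    (contDiff_unfoldingCoeff i).comp (hζ.prodMk contDiff_id)
  let V : R3 → Fin 3 → ℝ := fun y => ![y.1, y.2.1, y.2.2]
  have hV : ContDiff ℝ ∞ V := by
    refine contDiff_pi.2 fun i => ?_
    fin_cases i <;> simp [V] <;> fun_prop
  have hV0 : V (0, 0, 0) = 0 := by
    ext i
    fin_cases i <;> rfl
  have hVd : ∀ {y : ℝ → R3} {y' : R3}, HasDerivAt y y' 0 → HasDerivAt (fun ε => V (y ε)) (V y') 0 :=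
    fun {y y'} hy => by
      have g : ∀ i, HasDerivAt (fun ε => V (y ε) i) (V y' i) 0 := fun i => by
        fin_cases i
        · exact hasDerivAt_fst hy
        · exact hasDerivAt_fst (hasDerivAt_snd hy)
        · exact hasDerivAt_snd (hasDerivAt_snd hy)
      exact hasDerivAt_pi.2 g
  have hN := contDiff_generatedGerm hk
  have hN0 := generatedGerm_zero k
  let W : R2 → Fin 3 → ℝ := fun z => V (generatedGerm k z)
  have hW : ContDiff ℝ ∞ W := hV.comp hN
  have hW0 : W (0, 0) = 0 := by
    simp only [W, hN0, hV0]
  let Φ : R2 → R2 := fun z => (unfoldingCoeff (ζ (W z)) (W z) 2, Θ (z.2, W z))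
  let Ψ : R3 → R3 := fun y => (unfoldingCoeff (ζ (V y)) (V y) 2, -unfoldingCoeff (ζ (V y)) (V y) 1,
    unfoldingCoeff (ζ (V y)) (V y) 0 - unfoldingCoeff (ζ (V y)) (V y) 2 ^ 2)
  have hβ0 : ∀ i, unfoldingCoeff (ζ 0) 0 i = 0 := fun i => by simp [unfoldingCoeff]
  have hΦ : ContDiff ℝ ∞ Φ := by
    have := (hβ 2).comp hW
    exact this.prodMk (hΘ.comp (contDiff_snd.prodMk hW))
  have hΨ : ContDiff ℝ ∞ Ψ := by
    have := fun i => (hβ i).comp hV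
    exact (this 2).prodMk ((this 1).neg.prodMk ((this 0).sub ((this 2).pow 2)))
  have hline : ∀ v : R2, HasDerivAt (fun ε : ℝ => ε • v) v 0 := fun v => by
    simpa using (hasDerivAt_id (0 : ℝ)).smul_const v
  refine AEquiv.of_global Φ Ψ hΦ hΨ ?_ ?_ ?_ ?_
  · refine (injective_iff_map_eq_zero _).2 fun v hv => ?_
    have hX : HasDerivAt (fun ε : ℝ => W (ε • v)) (V (v.1, 0, 0)) 0 :=
      hVd (hasDerivAt_generatedGerm_line hk hk0 v)
    have hX0 : W ((0 : ℝ) • v) = 0 := by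
      rw [zero_smul]
      exact hW0
    have h1 : HasFDerivAt Φ (fderiv ℝ Φ (0, 0)) ((0 : ℝ) • v) := by
      rw [zero_smul]
      exact (hΦ.differentiable (by simp) _).hasFDerivAt
    have h2 := h1.comp_hasDerivAt (0 : ℝ) (hline v)
    rw [hv] at h2
    have h3 : HasDerivAt (fun ε : ℝ => unfoldingCoeff (ζ (W (ε • v))) (W (ε • v)) 2) 0 0 :=
      hasDerivAt_fst h2
    have h4 : HasDerivAt (fun ε : ℝ => Θ (ε * v.2, W (ε • v))) 0 0 :=
      hasDerivAt_snd h2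
    have h5 := (hasDerivAt_unfoldingCoeff_line hζ hX hX0 2).unique h3
    have hv1 : v.1 = 0 := by
      simpa [Matrix.vecMul, dotProduct, Fin.sum_univ_three, V, hM] using h5
    have h6 := hasDerivAt_unfoldingShift_line hζ hX hX0 h4 (by rw [hX0, zero_mul]; exact hΘ0)
    have h7 : (fun ε : ℝ => unfoldingShift (ζ (W (ε • v))) (W (ε • v)) (Θ (ε * v.2, W (ε • v))))
        =ᶠ[𝓝 0] fun ε => ε * v.2 := by
      have ht : Tendsto (fun ε : ℝ => (ε * v.2, W (ε • v))) (𝓝 0) (𝓝 (0, 0)) := by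
        refine (by fun_prop : Continuous _).tendsto' _ _ ?_
        rw [hX0, zero_mul]
      filter_upwards [ht.eventually hΘS] with ε hε
      exact sub_eq_zero.1 hε
    have h8 := (h6.congr_of_eventuallyEq h7.symm).unique
      (by simpa using (hasDerivAt_id (0 : ℝ)).mul_const v.2 : HasDerivAt (fun ε => ε * v.2) v.2 0)
    have hv2 : v.2 = 0 := by
      simpa [V, hv1] using h8.symm
    exact Prod.ext hv1 hv2
  · rw [hN0]
    refine (injective_iff_map_eq_zero _).2 fun v hv => ?_
    have hlin : HasDerivAt (fun ε : ℝ => ε • v) v 0 := by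
      simpa using (hasDerivAt_id (0 : ℝ)).smul_const v
    have hX := hVd hlin
    have hX0 : V ((0 : ℝ) • v) = 0 := by
      rw [zero_smul]
      exact hV0
    have h1 : HasFDerivAt Ψ (fderiv ℝ Ψ (0, 0, 0)) ((0 : ℝ) • v) := by
      rw [zero_smul]
      exact (hΨ.differentiable (by simp) _).hasFDerivAt
    have h2 := h1.comp_hasDerivAt (0 : ℝ) hlin
    rw [hv] at h2
    have b := hasDerivAt_unfoldingCoeff_line hζ hX hX0
    have c2 := (hasDerivAt_fst h2).unique (b 2)
    have c1 := (hasDerivAt_fst (hasDerivAt_snd h2)).unique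
      (b 1).neg
    have c0 := (hasDerivAt_snd (hasDerivAt_snd h2)).unique
      ((b 0).sub ((b 2).pow 2))
    have hz : Matrix.vecMul (V v) (unfoldingMatrix (ζ 0)) = 0 := by
      simp [show V 0 = 0 from hV0, hβ0] at c0 c1 c2
      ext i
      fin_cases i
      · exact c0.symm
      · exact c1
      · exact c2.symm
    have hVv := Matrix.eq_zero_of_vecMul_eq_zero hdet hz
    have e0 := congrFun hVv 0
    have e1 := congrFun hVv 1
    have e2 := congrFun hVv 2
    exact Prod.ext e0 (Prod.ext e1 e2)
  · simp only [Φ, hW0, hβ0]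
    exact Prod.ext rfl hΘ0
  · have ht1 : Tendsto (fun z : R2 => (Θ (z.2, W z), W z)) (𝓝 (0, 0)) (𝓝 0) := by
      refine (by fun_prop : Continuous _).tendsto' _ _ ?_
      simp only [hW0, hΘ0]
      rfl
    have ht2 : Tendsto (fun z : R2 => (z.2, W z)) (𝓝 (0, 0)) (𝓝 (0, 0)) := by
      refine (by fun_prop : Continuous _).tendsto' _ _ ?_
      simp only [hW0]
    filter_upwards [ht1.eventually h.eventually_nhds, ht2.eventually hΘS,
      ht1.eventually (hQ.continuous.continuousAt.eventually_ne hQ0)] with z hz hθ hq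
    set X := W z with hX
    set τ := Θ (z.2, X) with hτ
    have hSt : unfoldingShift (ζ X) X τ = z.2 := sub_eq_zero.1 hθ
    have X0 : X 0 = z.1 := rfl
    have X1 : X 1 = 2 * z.2 * k z + z.2 ^ 2 * fderiv ℝ k z (0, 1) := rfl
    have X2 : X 2 = z.2 ^ 2 * (k z + z.2 * fderiv ℝ k z (0, 1)) := rfl
    have hP : τ ^ 5 + unfoldingCoeff (ζ X) X 2 * τ ^ 2 + unfoldingCoeff (ζ X) X 1 * τ +
        unfoldingCoeff (ζ X) X 0 = 0 := by
      have := hz.self_of_nhds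
      simp only [hSt, X0, X1, X2] at this
      refine (mul_eq_zero.1 (this.symm.trans ?_)).resolve_left hq
      ring
    have hl : Tendsto (fun s : ℝ => (s, X)) (𝓝 τ) (𝓝 (τ, X)) :=
      (by fun_prop : Continuous fun s : ℝ => (s, X)).tendsto τ
    have hSd : DifferentiableAt ℝ (fun s => unfoldingShift (ζ X) X s) τ := by
      unfold unfoldingShift
      fun_prop
    have hQd : DifferentiableAt ℝ (fun s => Q (s, X)) τ := by
      have := hQ.differentiable (by simp)
      fun_prop
    have hkd : HasDerivAt (fun s => k (X 0, s)) (fderiv ℝ k z (0, 1)) (unfoldingShift (ζ X) X τ) := by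
      rw [hSt]
      exact hasDerivAt_slice_snd hk z.1 z.2
    have hkd' := hkd.comp τ hSd.hasDerivAt
    have D1 := ((hSd.hasDerivAt.mul_const (X 1)).const_sub (X 2)).add ((hSd.hasDerivAt.pow 2).mul hkd')
    have D2 := hQd.hasDerivAt.mul (((((hasDerivAt_id τ).pow 5).add (((hasDerivAt_id τ).pow 2).const_mul
      (unfoldingCoeff (ζ X) X 2))).add ((hasDerivAt_id τ).const_mul
        (unfoldingCoeff (ζ X) X 1))).add_const (unfoldingCoeff (ζ X) X 0))
    have D := (D1.congr_of_eventuallyEq (EventuallyEq.symm (hl.eventually hz))).unique D2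
    have hP' : 5 * τ ^ 4 + 2 * unfoldingCoeff (ζ X) X 2 * τ + unfoldingCoeff (ζ X) X 1 = 0 := by
      simp [hSt, X0, X1] at D
      rw [hP, mul_zero, zero_add] at D
      refine (mul_eq_zero.1 (?_ : Q (τ, X) * _ = 0)).resolve_left hq
      linear_combination -D
    change (unfoldingCoeff (ζ X) X 2, -unfoldingCoeff (ζ X) X 1,
      unfoldingCoeff (ζ X) X 0 - unfoldingCoeff (ζ X) X 2 ^ 2) =
        fCBF (unfoldingCoeff (ζ X) X 2, τ)
    refine Prod.ext rfl (Prod.ext ?_ ?_)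
    · simp only [fCBF]
      linear_combination -hP'
    · simp only [fCBF]
      linear_combination hP - τ * hP'

end ButterflyNormalForm

theorem exists_aequiv_generatedGerm_fCBF {e : ℝ → ℝ} {m : R2 → ℝ} (he : ContDiff ℝ ∞ e)
    (hm : ContDiff ℝ ∞ m) (he0 : e 0 = 1) (hm0 : m (0, 0) = 1) :
    ∃ δ : ℝ, δ ≠ 0 ∧ AEquiv (generatedGerm fun z => z.2 ^ 3 * e (δ * z.2) +
      z.1 * m (δ ^ 3 * z.1, δ * z.2)) (0, 0) fCBF (0, 0) := by
  obtain ⟨δ, hδ, ζ, Q, hζ, hQ, hQ0, hdet, hM, h⟩ := exists_butterfly_unfolding he hm he0 hm0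
  refine ⟨δ, hδ, aequiv_fCBF_of_unfolding (by fun_prop) (by simp) hζ hQ hQ0 hdet hM ?_⟩
  filter_upwards [h] with z hz
  rw [← hz, generatingFamily]
  ring

theorem aequiv_generatedGerm_of_scaling {k k' : R2 → ℝ} (hk : ContDiff ℝ ∞ k)
    (hk' : ContDiff ℝ ∞ k') {a b r : ℝ} (ha : a ≠ 0) (hb : b ≠ 0) (hr : r ≠ 0)
    (h : ∀ z : R2, k (a * z.1, b * z.2) = r * k' z) :
    AEquiv (generatedGerm k') (0, 0) (generatedGerm k) (0, 0) := by
  let L : R2 →L[ℝ] R2 := (a • ContinuousLinearMap.fst ℝ ℝ ℝ).prod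
    (b • ContinuousLinearMap.snd ℝ ℝ ℝ)
  let M : R3 →L[ℝ] R3 := (a • ContinuousLinearMap.fst ℝ ℝ R2).prod
    (((b * r) • (ContinuousLinearMap.fst ℝ ℝ ℝ).comp (ContinuousLinearMap.snd ℝ ℝ R2)).prod
      ((b ^ 2 * r) • (ContinuousLinearMap.snd ℝ ℝ ℝ).comp (ContinuousLinearMap.snd ℝ ℝ R2)))
  refine AEquiv.of_global L M L.contDiff M.contDiff ?_ ?_ (by simp [L]) (.of_forall fun z => ?_)
  · rw [L.fderiv, injective_iff_map_eq_zero]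
    rintro ⟨x, y⟩ hxy
    simpa [L, Prod.ext_iff, ha, hb] using hxy
  · rw [M.fderiv, injective_iff_map_eq_zero]
    rintro ⟨x, y, w⟩ hxy
    simpa [M, Prod.ext_iff, ha, hb, hr] using hxy
  · have h1 := ((hasDerivAt_slice_snd hk (a * z.1) (b * z.2)).comp z.2
      (by simpa using (hasDerivAt_id z.2).const_mul b : HasDerivAt (fun t => b * t) b z.2))
    have h2 := (hasDerivAt_slice_snd hk' z.1 z.2).const_mul r
    have h3 : (fun t => k (a * z.1, t)) ∘ (fun t => b * t) = fun t => r * k' (z.1, t) :=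
      funext fun t => h (z.1, t)
    rw [h3] at h1
    have h4 := h1.unique h2
    have h5 := h z
    refine Prod.ext rfl (Prod.ext ?_ ?_)
    · simp only [M, L, generatedGerm, ContinuousLinearMap.prod_apply, smul_apply,
        ContinuousLinearMap.comp_apply, ContinuousLinearMap.coe_fst', ContinuousLinearMap.coe_snd',
        smul_eq_mul]
      linear_combination (-2 * b * z.2) * h5 - b * z.2 ^ 2 * h4
    · simp only [M, L, generatedGerm, ContinuousLinearMap.prod_apply, smul_apply,
        ContinuousLinearMap.comp_apply, ContinuousLinearMap.coe_fst', ContinuousLinearMap.coe_snd',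
        smul_eq_mul]
      linear_combination (-b ^ 2 * z.2 ^ 2) * h5 - b ^ 2 * z.2 ^ 3 * h4

theorem aequiv_generatedGerm_fCBF {k m : R2 → ℝ} {e : ℝ → ℝ} (he : ContDiff ℝ ∞ e)
    (hm : ContDiff ℝ ∞ m) (h : ∀ z, k z = z.2 ^ 3 * e z.2 + z.1 * m z) (he0 : e 0 ≠ 0)
    (hm0 : m (0, 0) ≠ 0) : AEquiv (generatedGerm k) (0, 0) fCBF (0, 0) := by
  obtain ⟨δ, hδ, hA⟩ := exists_aequiv_generatedGerm_fCBF (e := fun t => e t / e 0)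
    (m := fun z => m (e 0 / m (0, 0) * z.1, z.2) / m (0, 0)) (by fun_prop) (by fun_prop)
    (div_self he0) (by simp [hm0])
  have hk : ContDiff ℝ ∞ k := by
    rw [funext h]
    fun_prop
  have hS := aequiv_generatedGerm_of_scaling hk (k' := fun z => z.2 ^ 3 * (e (δ * z.2) / e 0) +
    z.1 * (m (e 0 / m (0, 0) * (δ ^ 3 * z.1), δ * z.2) / m (0, 0))) (by fun_prop)
    (a := δ ^ 3 * (e 0 / m (0, 0))) (b := δ) (r := δ ^ 3 * e 0) (by positivity) hδ (by positivity)
    fun z => by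
      rw [h]
      simp only
      rw [show e 0 / m (0, 0) * (δ ^ 3 * z.1) = δ ^ 3 * (e 0 / m (0, 0)) * z.1 by ring]
      field_simp
  have hc : ContinuousAt (generatedGerm k) (0, 0) := (contDiff_generatedGerm hk).continuous.continuousAt
  have hc' := (contDiff_generatedGerm (k := fun z => z.2 ^ 3 * (e (δ * z.2) / e 0) +
    z.1 * (m (e 0 / m (0, 0) * (δ ^ 3 * z.1), δ * z.2) / m (0, 0))) (by fun_prop)).continuous.continuousAt
      (x := (0, 0))
  exact (hS.symm hc').trans hA hc hc'

theorem exists_taylor_two_snd {K : R2 → ℝ} (hK : ContDiff ℝ ∞ K) : ∃ (a b : ℝ → ℝ) (k : R2 → ℝ),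
    ContDiff ℝ ∞ a ∧ ContDiff ℝ ∞ b ∧ ContDiff ℝ ∞ k ∧
    ∀ z, K z = a z.1 + z.2 * b z.1 + z.2 ^ 2 * k z := by
  obtain ⟨g, hg, hKg, -⟩ := exists_hadamard_zero (f := fun z : ℝ × ℝ => K (z.2, z.1))
    (by fun_prop)
  obtain ⟨k, hk, hgk, -⟩ := exists_hadamard_zero hg
  refine ⟨fun x => K (x, 0), fun x => g (0, x), fun z => k (z.2, z.1), by fun_prop, by fun_prop,
    by fun_prop, fun ⟨x, s⟩ => ?_⟩
  simp only
  linear_combination hKg s x + s * hgk s x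

theorem hasDerivAt_graph_snd {A η : R2 → ℝ} (hA : ContDiff ℝ ∞ A) (hη : ContDiff ℝ ∞ η)
    (x s : ℝ) : HasDerivAt (fun s => A (x, η (x, s)))
      (fderiv ℝ A (x, η (x, s)) (0, 1) * fderiv ℝ η (x, s) (0, 1)) s :=
  HasDerivAt.comp (h₂ := fun y => A (x, y)) s (hasDerivAt_slice_snd hA x (η (x, s)))
    (hasDerivAt_slice_snd hη x s)

/-- A map germ whose second and third components have proportional derivatives along the fibres
of the first one is a generated germ. -/
theorem exists_aequiv_generatedGerm {P Q W η : R2 → ℝ} (hP : ContDiff ℝ ∞ P)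
    (hQ : ContDiff ℝ ∞ Q) (hW : ContDiff ℝ ∞ W) (hη : ContDiff ℝ ∞ η) (hW0 : W (0, 0) = 0)
    (hWy : fderiv ℝ W (0, 0) (0, 1) ≠ 0)
    (hηW : ∀ᶠ q in 𝓝 ((0, 0) : R2), η (q.1, W q) = q.2)
    (hWη : ∀ᶠ q in 𝓝 ((0, 0) : R2), W (q.1, η q) = q.2)
    (hQy : ∀ z, fderiv ℝ Q z (0, 1) = fderiv ℝ P z (0, 1) * W z) :
    ∃ (b : ℝ → ℝ) (k : R2 → ℝ), ContDiff ℝ ∞ b ∧ ContDiff ℝ ∞ k ∧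
      (∀ᶠ z in 𝓝 ((0, 0) : R2),
        P (z.1, η z) = b z.1 + 2 * z.2 * k z + z.2 ^ 2 * fderiv ℝ k z (0, 1)) ∧
      AEquiv (fun z => (2 * z.1, P z, Q z)) (0, 0) (generatedGerm k) (0, 0) := by
  obtain ⟨a, b, k, ha, hb, hk, hK⟩ := exists_taylor_two_snd
    (K := fun z => z.2 * P (z.1, η z) - Q (z.1, η z)) (by fun_prop)
  have hPk : ∀ᶠ z in 𝓝 ((0, 0) : R2),
      P (z.1, η z) = b z.1 + 2 * z.2 * k z + z.2 ^ 2 * fderiv ℝ k z (0, 1) := by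
    filter_upwards [hWη] with ⟨x, s⟩ h
    have h1 := ((hasDerivAt_id s).mul (hasDerivAt_graph_snd hP hη x s)).sub (hasDerivAt_graph_snd hQ hη x s)
    have h2 := (((hasDerivAt_id s).mul_const (b x)).const_add (a x)).add
      ((hasDerivAt_pow 2 s).mul (hasDerivAt_slice_snd hk x s))
    have h3 := h1.unique (h2.congr_of_eventuallyEq (Eventually.of_forall fun t => hK (x, t)))
    rw [hQy] at h3
    simp only [id] at h h3 ⊢
    rw [h] at h3
    push_cast at h3
    linear_combination h3
  refine ⟨b, k, hb, hk, hPk, ?_⟩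
  refine AEquiv.of_global (fun z => (z.1, W z))
    (fun Y => (Y.1 / 2, Y.2.1 - b (Y.1 / 2), Y.2.2 + a (Y.1 / 2))) (by fun_prop)
    ((contDiff_fst.div_const 2).prodMk (by fun_prop)) ?_ ?_ (by simp [hW0]) ?_
  · have h1 : HasFDerivAt (fun z : R2 => (z.1, W z)) _ (0, 0) :=
      hasFDerivAt_fst.prodMk (hW.differentiable (by simp) (0, 0)).hasFDerivAt
    rw [h1.fderiv, injective_iff_map_eq_zero]
    rintro ⟨x, y⟩ h2
    simp only [ContinuousLinearMap.prod_apply, ContinuousLinearMap.coe_fst', Prod.mk_eq_zero] at h2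
    obtain ⟨rfl, h3⟩ := h2
    have h4 : ((0, y) : R2) = y • ((0, 1) : R2) := by simp
    rw [h4, map_smul, smul_eq_mul] at h3
    simpa [hWy] using h3
  · have hx : ∀ Y : R3, HasFDerivAt (fun Y : R3 => Y.1 / 2)
        ((2 : ℝ)⁻¹ • ContinuousLinearMap.fst ℝ ℝ (ℝ × ℝ)) Y := fun Y => by
      simpa [div_eq_inv_mul] using
        (hasFDerivAt_fst (𝕜 := ℝ) (p := Y)).const_mul (2 : ℝ)⁻¹
    have hc : ∀ {f : ℝ → ℝ}, ContDiff ℝ ∞ f → ∀ Y : R3,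
        HasFDerivAt (fun Y : R3 => f (Y.1 / 2)) _ Y := fun hf Y =>
      ((hf.differentiable (by simp) (Y.1 / 2)).hasDerivAt.comp_hasFDerivAt Y (hx Y))
    have h1 : HasFDerivAt (fun Y : R3 => (Y.1 / 2, Y.2.1 - b (Y.1 / 2), Y.2.2 + a (Y.1 / 2))) _
        (2 * 0, P (0, 0), Q (0, 0)) := (hx (2 * 0, P (0, 0), Q (0, 0))).prodMk
      (((hasFDerivAt_snd.fst).sub (hc hb (2 * 0, P (0, 0), Q (0, 0)))).prodMk
        ((hasFDerivAt_snd.snd).add (hc ha (2 * 0, P (0, 0), Q (0, 0)))))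
    rw [h1.fderiv, injective_iff_map_eq_zero]
    rintro ⟨X, Y, Z⟩ h2
    simp at h2
    obtain ⟨rfl, h3, h4⟩ := h2
    exact Prod.ext rfl (Prod.ext (by simpa using h3) (by simpa using h4))
  · have hWt : Tendsto (fun z : R2 => (z.1, W z)) (𝓝 (0, 0)) (𝓝 (0, 0)) := by
      have := (by fun_prop : Continuous fun z : R2 => (z.1, W z)).tendsto (0, 0)
      simpa [hW0] using this
    filter_upwards [hηW, hWt.eventually hPk] with ⟨x, y⟩ h1 h2
    have h3 := hK (x, W (x, y))
    simp only at h1 h2 h3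
    rw [h1] at h2 h3
    simp only [generatedGerm, mul_div_cancel_left₀ x (two_ne_zero' ℝ)]
    refine Prod.ext rfl (Prod.ext ?_ ?_)
    · simp only
      linear_combination h2
    · simp only
      linear_combination W (x, y) * h2 - h3

/-- The order of vanishing of the generating coefficient along the central fibre. -/
theorem exists_generating_coeff_eq {P η k : R2 → ℝ} {b c : ℝ → ℝ} (hη : ContDiff ℝ ∞ η)
    (hk : ContDiff ℝ ∞ k) (hc : ContDiff ℝ ∞ c) (hPc : ∀ y, P (0, y) = y ^ 4 * c y)
    (hc0 : c 0 ≠ 0) (hη0 : η (0, 0) = 0) (hηs : fderiv ℝ η (0, 0) (0, 1) ≠ 0)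
    (hPk : ∀ᶠ z in 𝓝 ((0, 0) : R2),
      P (z.1, η z) = b z.1 + 2 * z.2 * k z + z.2 ^ 2 * fderiv ℝ k z (0, 1)) :
    ∃ e : ℝ → ℝ, ContDiff ℝ ∞ e ∧ e 0 ≠ 0 ∧ ∀ s, k (0, s) = s ^ 3 * e s := by
  obtain ⟨h, hh, hηh, hh0⟩ := exists_hadamard_one (f := fun s => η (0, s)) (by fun_prop)
  rw [(hasDerivAt_slice_snd hη 0 0).deriv] at hh0
  have hD : ContDiff ℝ ∞ fun s => s * b 0 + s ^ 2 * k (0, s) := by fun_prop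
  have hD' : ∀ s, deriv (fun s => s * b 0 + s ^ 2 * k (0, s)) s =
      b 0 + 2 * s * k (0, s) + s ^ 2 * fderiv ℝ k (0, s) (0, 1) := by
    intro s
    have h1 := ((hasDerivAt_id s).mul_const (b 0)).add
      ((hasDerivAt_pow 2 s).mul (hasDerivAt_slice_snd hk 0 s))
    refine (h1.congr_deriv ?_).deriv
    push_cast
    ring
  have c1 := hh.continuous
  have c2 := hc.continuous
  have c3 := hη.continuous
  have c4 := hk.continuous
  obtain ⟨r, hr, hDr, hr0⟩ := exists_eq_pow_mul_of_eventually
    (f := deriv fun s => s * b 0 + s ^ 2 * k (0, s))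
    (c := fun s => h s ^ 4 * c (η (0, s))) (n := 4) hD.deriv' (by fun_prop) (by
      filter_upwards [(tendsto_slice_snd 0).eventually hPk] with s hs
      have h1 := hηh s
      simp only [hη0, zero_add] at hs h1
      rw [hD', ← hs, hPc]
      nth_rw 1 [h1]
      ring)
  obtain ⟨e, he, hDe, he0⟩ := exists_eq_pow_succ_mul hD hr (by simp) 4 hDr
  have c5 := he.continuous
  have hb0 : b 0 = 0 := by
    have := eq_zero_of_pow_mul_eq_zero (A := fun s => b 0 + s * k (0, s) - s ^ 4 * e s)
      (by fun_prop) 1 (Eventually.of_forall fun s => by linear_combination hDe s)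
    simpa using this
  refine ⟨e, he, ?_, fun s => ?_⟩
  · rw [he0, hr0, hh0, hη0]
    positivity
  · rcases eq_or_ne s 0 with rfl | hs
    · have := eq_zero_of_pow_mul_eq_zero (A := fun s => k (0, s) - s ^ 3 * e s)
        (by fun_prop) 2 (Eventually.of_forall fun s => by
          linear_combination hDe s - s * hb0)
      simpa [sub_eq_zero] using this
    · have h1 : s ^ 2 * (k (0, s) - s ^ 3 * e s) = 0 := by linear_combination hDe s - s * hb0
      rcases mul_eq_zero.1 h1 with h2 | h2
      · exact absurd h2 (pow_ne_zero 2 hs)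
      · linarith

/-- The first mixed coefficient of the generating function. -/
theorem two_mul_deriv_generating_coeff {P η k : R2 → ℝ} {b : ℝ → ℝ} (hP : ContDiff ℝ ∞ P)
    (hη : ContDiff ℝ ∞ η) (hk : ContDiff ℝ ∞ k) (hη0 : η (0, 0) = 0)
    (hP0 : fderiv ℝ P (0, 0) (0, 1) = 0)
    (hPk : ∀ᶠ z in 𝓝 ((0, 0) : R2),
      P (z.1, η z) = b z.1 + 2 * z.2 * k z + z.2 ^ 2 * fderiv ℝ k z (0, 1)) :
    2 * deriv (fun x => k (x, 0)) 0 =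
      fderiv ℝ (fun z => fderiv ℝ P z (0, 1)) (0, 0) (1, fderiv ℝ η (0, 0) (1, 0)) *
        fderiv ℝ η (0, 0) (0, 1) := by
  have hPy := contDiff_fderiv_apply hP (0, 1)
  have hηy := contDiff_fderiv_apply hη (0, 1)
  have hky := contDiff_fderiv_apply hk (0, 1)
  have h1 : ∀ᶠ x in 𝓝 (0 : ℝ), 2 * k (x, 0) =
      fderiv ℝ P (x, η (x, 0)) (0, 1) * fderiv ℝ η (x, 0) (0, 1) := by
    filter_upwards [(tendsto_slice_fst 0).eventually hPk.eventually_nhds] with x hx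
    have h2 := hasDerivAt_graph_snd hP hη x 0
    have h3 := (((hasDerivAt_id (0 : ℝ)).const_mul 2).mul
      (hasDerivAt_slice_snd hk x 0)).const_add (b x) |>.add
      ((hasDerivAt_pow 2 (0 : ℝ)).mul (hasDerivAt_slice_snd hky x 0))
    have h4 : ∀ᶠ s in 𝓝 (0 : ℝ), P (x, η (x, s)) =
        b x + 2 * s * k (x, s) + s ^ 2 * fderiv ℝ k (x, s) (0, 1) :=
      ((by fun_prop : Continuous fun t : ℝ => ((x, t) : R2)).tendsto 0).eventually hx
    have h5 := h2.unique (h3.congr_of_eventuallyEq h4)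
    rw [h5]
    simp
  have hηx := hasDerivAt_slice_fst hη 0 0
  have h2 : HasDerivAt (fun x : ℝ => ((x, η (x, 0)) : R2)) (1, fderiv ℝ η (0, 0) (1, 0)) 0 :=
    (hasDerivAt_id 0).prodMk hηx
  have h3 : HasDerivAt (fun x : ℝ => fderiv ℝ P (x, η (x, 0)) (0, 1)) _ 0 :=
    HasFDerivAt.comp_hasDerivAt (l := fun z => fderiv ℝ P z (0, 1)) (0 : ℝ)
      (hPy.differentiable (by simp) (0, η (0, 0))).hasFDerivAt h2
  have h4 := (h3.mul (hasDerivAt_slice_fst hηy 0 0)).congr_of_eventuallyEq h1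
  have h5 := ((hasDerivAt_slice_fst hk 0 0).const_mul 2).unique h4
  rw [(hasDerivAt_slice_fst hk 0 0).deriv, h5, hη0, hP0]
  simp

theorem aequiv_fCBF_of_cubicContact {G H : ℝ → ℝ} (hG : ContDiff ℝ ∞ G)
    (hH : ContDiff ℝ ∞ H) (hG0 : G 0 = 0) (hH0 : H 0 = 0)
    (h : CubicContact G fun t => H (-t)) : AEquiv (stdSurf G H) (0, 0) fCBF (0, 0) := by
  obtain ⟨hc, d, hd, hd0, hGH⟩ := h
  have hder := CubicContact.deriv_eq hG (by fun_prop) hd hGH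
  have hH' : deriv H 0 = -deriv G 0 := by
    rw [← hder, deriv_comp_neg]
    simp
  have hs := contDiff_stdSlope hG hH
  obtain ⟨P, Q, hP, hQ, hP0, -, hS, hPy, hQy⟩ := exists_stdSurf_eq hG hH
  have hs0 : stdSlope G H (0, 0) = 0 := by simp [stdSlope, hG0, hH0]
  have hsy : fderiv ℝ (stdSlope G H) (0, 0) (0, 1) = 2 * deriv G 0 := by
    rw [fderiv_stdSlope hG hH]
    simp [hH']
    ring
  have hsy0 : fderiv ℝ (stdSlope G H) (0, 0) (0, 1) ≠ 0 := by
    rw [hsy]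
    exact mul_ne_zero two_ne_zero hc
  obtain ⟨η, hη, hη0, hηW, hWη⟩ := exists_fibre_inverse hs hs0 hsy0
  obtain ⟨b, k, -, hk, hPk, hequiv⟩ := exists_aequiv_generatedGerm hP hQ hs hη hs0 hsy0 hηW
    hWη fun z => by rw [hQy, hPy]
  rw [← funext hS] at hequiv
  have hηs : 2 * deriv G 0 * fderiv ℝ η (0, 0) (0, 1) = 1 := by
    have h1 := hasDerivAt_graph_snd hs hη 0 0
    rw [hη0, hsy] at h1
    exact h1.unique ((hasDerivAt_id 0).congr_of_eventuallyEq ((tendsto_slice_snd 0).eventually hWη))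
  obtain ⟨c, hcs, hPc, hc0⟩ := exists_eq_pow_succ_mul (D := fun y => P (0, y)) (by fun_prop) hd hP0
    3 fun y => by
      rw [(hasDerivAt_slice_snd hP 0 y).deriv, hPy, ← hGH]
      simp [stdDensity]
  obtain ⟨e, he, he0, hke⟩ := exists_generating_coeff_eq hη hk hcs hPc
    (by rw [hc0]; positivity) hη0 (right_ne_zero_of_mul_eq_one hηs) hPk
  obtain ⟨m, hm, hkm, hm0⟩ := exists_hadamard_zero hk
  have hm1 := two_mul_deriv_generating_coeff hP hη hk hη0
    (by rw [hPy]; simp [stdDensity, hG0, hH0]) hPk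
  rw [funext hPy, fderiv_stdDensity hG hH, ← hm0 0] at hm1
  simp only [add_zero, sub_zero, hH'] at hm1
  have hm2 : 2 * m (0, 0) = 1 := by linear_combination hm1 + hηs
  refine hequiv.trans (aequiv_generatedGerm_fCBF he hm (fun z => ?_) he0 ?_)
    (contDiff_stdSurf hG hH).continuous.continuousAt
    (contDiff_generatedGerm hk).continuous.continuousAt
  · rw [← hke, ← hkm]
  · intro h0
    simp [h0] at hm2

/-- duality between cuspidal butterflies and cuspidal S₁⁺ singularities
under conjugation. -/
theorem cuspidal_butterfly_S1_duality
    (f fhat : R2 → R3) (g1 g2 w1 w2 : ℝ → ℝ)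
    (hf : IsGTMS f g1 g2 w1 w2)
    (hfhat : IsGTMS fhat g1 g2 w1 (fun v => -w2 v))
    (p : R2) (hpg : g1 p.1 * g2 p.2 = 1) (hpw : w1 p.1 * w2 p.2 ≠ 0) :
    AEquiv f p fCBF (0, 0) ↔ AEquiv fhat p fCS1p (0, 0) := by
  obtain ⟨G, H, hG, hH, hG0, hH0, h1, h2⟩ := exists_aequiv_stdSurf hf hfhat p hpg hpw
  have hHn : ContDiff ℝ ∞ fun t => H (-t) := by fun_prop
  have hHn0 : H (-0) = 0 := by simpa using hH0
  have hc := hf.smooth_f.continuous.continuousAt (x := p)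
  have hc' := hfhat.smooth_f.continuous.continuousAt (x := p)
  have hs := (contDiff_stdSurf hG hH).continuous.continuousAt (x := (0, 0))
  have hs' := (contDiff_stdSurf hG hHn).continuous.continuousAt (x := (0, 0))
  constructor
  · intro h
    have h3 := cubicContact_of_aequiv_fCBF hG hHn hG0 hHn0 ((h1.symm hc).trans h hs' hc)
    simp only [neg_neg] at h3
    exact h2.trans (aequiv_fCS1p_of_cubicContact hG hH hG0 hH0 h3) hc' hs
  · intro h
    have h3 := cubicContact_of_aequiv_fCS1p hG hH hG0 hH0 ((h2.symm hc').trans h hs hc')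
    exact h1.trans (aequiv_fCBF_of_cubicContact hG hHn hG0 hHn0 (by simpa only [neg_neg] using h3))
      hc hs'
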